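/- arXiv:1104.3060 — 5 statements merged into one kernel-verified Lean document; each statement's English description precedes it below -/
import Mathlib

section
/- Let q ∈ (0,1), β ∈ ℝ, n,p ∈ ℕ with p < n, and let ω be a convex upwards (concave) modulus of continuity. There exists an absolute constant C > 0 such that whenever n − p ≥ 6/(1−q), there is a number J = J_{q,p}(n,ω) satisfying ((1+q^p)/(1+q)) · K(q^p) ≤ J ≤ K(q) for which | E(C^q_β H_ω; V_{n,p}) − (q^{n−p+1}/p) · (4J/π²) · ((1−q^p)/(1−q)) · e_{n−p+1}(ω) | ≤ C · (q^{n−p+1}/p) · ω(1/(n−p+1)) / ((1−q)^{δ(p)} (n−p+1)), where e_m(ω) = ∫₀^{π/2} ω(2t/m) sin t dt, K(r) = ∫₀^{π/2} dt/√(1 − r² sin² t) is the complete elliptic integral of the first kind, and δ(p) = 2 if p = 1 and δ(p) = 3 if p ≥ 2. -/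
open Real MeasureTheory intervalIntegral

noncomputable section

/-- A modulus of continuity: continuous, nondecreasing, subadditive on `[0,∞)`, vanishing at 0. -/
def IsModulus (ω : ℝ → ℝ) : Prop :=
  ContinuousOn ω (Set.Ici 0) ∧ MonotoneOn ω (Set.Ici 0) ∧
    (∀ s t : ℝ, 0 ≤ s → 0 ≤ t → ω (s + t) ≤ ω s + ω t) ∧ ω 0 = 0

/-- A convex upwards (i.e. concave) modulus of continuity. -/
def IsConcaveModulus (ω : ℝ → ℝ) : Prop :=
  IsModulus ω ∧ ConcaveOn ℝ (Set.Ici 0) ω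

/-- The class `H_ω` of continuous `2π`-periodic functions with modulus of continuity `ω`. -/
def Hclass (ω : ℝ → ℝ) : Set (ℝ → ℝ) :=
  {φ | Continuous φ ∧ (∀ x, φ (x + 2 * π) = φ x) ∧ ∀ s t : ℝ, |φ s - φ t| ≤ ω |s - t|}

/-- The Poisson kernel `P_{q,β}(t) = Σ_{k≥1} q^k cos(kt + βπ/2)`. -/
def Pker (q β t : ℝ) : ℝ :=
  ∑' k : ℕ, q ^ (k + 1) * Real.cos ((k + 1 : ℕ) * t + β * π / 2)

/-- The class `C^q_β H_ω` of Poisson integrals of functions from `H_ω`. -/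
def CqbH (q β : ℝ) (ω : ℝ → ℝ) : Set (ℝ → ℝ) :=
  {f | ∃ A₀ : ℝ, ∃ φ ∈ Hclass ω,
      f = fun x => A₀ + (1 / π) * ∫ t in (0:ℝ)..(2 * π), φ (x + t) * Pker q β t}

/-- Fourier cosine coefficient. -/
def coefA (f : ℝ → ℝ) (j : ℕ) : ℝ := (1 / π) * ∫ t in (0:ℝ)..(2 * π), f t * Real.cos (j * t)

/-- Fourier sine coefficient. -/
def coefB (f : ℝ → ℝ) (j : ℕ) : ℝ := (1 / π) * ∫ t in (0:ℝ)..(2 * π), f t * Real.sin (j * t)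

/-- The `k`-th partial sum of the Fourier series of `f`. -/
def Ssum (f : ℝ → ℝ) (k : ℕ) (x : ℝ) : ℝ :=
  coefA f 0 / 2 +
    ∑ j ∈ Finset.Icc 1 k, (coefA f j * Real.cos (j * x) + coefB f j * Real.sin (j * x))

/-- The de la Vallée Poussin sum `V_{n,p}(f;x) = (1/p) Σ_{k=n-p}^{n-1} S_k(f;x)`. -/
def Vsum (n p : ℕ) (f : ℝ → ℝ) (x : ℝ) : ℝ :=
  (1 / (p : ℝ)) * ∑ k ∈ Finset.Ico (n - p) n, Ssum f k x

/-- `E(N; A) = sup_{f ∈ N} ‖f - A f‖_C`. -/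
def Edev (N : Set (ℝ → ℝ)) (A : (ℝ → ℝ) → ℝ → ℝ) : ℝ :=
  ⨆ f : N, ⨆ x : ℝ, |(f : ℝ → ℝ) x - A f x|

/-- The constant `K_{p,q}`. -/
def Kpq (p : ℕ) (q : ℝ) : ℝ :=
  ∫ t in (0:ℝ)..(2 * π),
    Real.sqrt (1 - 2 * q ^ p * Real.cos (p * t) + q ^ (2 * p)) /
      (1 - 2 * q * Real.cos t + q ^ 2)

/-- `e_m(ω) = ∫₀^{π/2} ω(2t/m) sin t dt`. -/
def eInt (m : ℕ) (ω : ℝ → ℝ) : ℝ := ∫ t in (0:ℝ)..(π / 2), ω (2 * t / m) * Real.sin t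

/-- `δ(p) = 2` if `p = 1`, `δ(p) = 3` otherwise. -/
def δp (p : ℕ) : ℕ := if p = 1 then 2 else 3

/-- `Z_r(u) = 1/√(1 - 2r cos u + r²)`. -/
def Zf (r u : ℝ) : ℝ := 1 / Real.sqrt (1 - 2 * r * Real.cos u + r ^ 2)

/-- `θ_r(u) = arctan(r sin u / (1 - r cos u))`. -/
def θf (r u : ℝ) : ℝ := Real.arctan (r * Real.sin u / (1 - r * Real.cos u))

/-- The complete elliptic integral of the first kind. -/
def ellK (r : ℝ) : ℝ := ∫ t in (0:ℝ)..(π / 2), 1 / Real.sqrt (1 - r ^ 2 * Real.sin t ^ 2)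

/-- `α_q = ⌊3q/(1-q)⌋ + 2`. -/
def αq (q : ℝ) : ℕ := ⌊3 * q / (1 - q)⌋₊ + 2

lemma cm_nonneg {ω : ℝ → ℝ} (h : IsConcaveModulus ω) {s : ℝ} (hs : 0 ≤ s) : 0 ≤ ω s := by
  have := h.1.2.1 (Set.mem_Ici.2 le_rfl) (Set.mem_Ici.2 hs) hs
  rw [h.1.2.2.2] at this; exact this

lemma cm_mono {ω : ℝ → ℝ} (h : IsConcaveModulus ω) {s t : ℝ} (hs : 0 ≤ s) (hst : s ≤ t) :
    ω s ≤ ω t := h.1.2.1 (Set.mem_Ici.2 hs) (Set.mem_Ici.2 (hs.trans hst)) hst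

lemma cm_scale {ω : ℝ → ℝ} (h : IsConcaveModulus ω) {s L : ℝ} (hs : 0 ≤ s) (hL : 1 ≤ L) :
    ω (L * s) ≤ L * ω s := by
  have hL0 : 0 < L := by linarith
  have := h.2.2 (show (0:ℝ) ∈ Set.Ici (0:ℝ) from Set.mem_Ici.2 le_rfl)
    (show L * s ∈ Set.Ici (0:ℝ) from Set.mem_Ici.2 (by positivity))
    (show (0:ℝ) ≤ 1 - 1 / L by rw [sub_nonneg, div_le_one hL0]; exact hL)
    (show (0:ℝ) ≤ 1 / L by positivity) (by ring)
  simp only [smul_eq_mul, h.1.2.2.2, mul_zero, zero_add] at this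
  have e : 1 / L * (L * s) = s := by field_simp
  rw [e] at this
  calc ω (L * s) = L * (1 / L * ω (L * s)) := by field_simp
    _ ≤ L * ω s := by gcongr

lemma cm_half {ω : ℝ → ℝ} (h : IsConcaveModulus ω) {s t : ℝ} (hs : 0 ≤ s) (ht : 0 ≤ t) :
    ω (2 * s) / 2 + ω (2 * t) / 2 ≤ ω (s + t) := by
  have := h.2.2 (show 2 * s ∈ Set.Ici (0:ℝ) from Set.mem_Ici.2 (by positivity))
    (show 2 * t ∈ Set.Ici (0:ℝ) from Set.mem_Ici.2 (by positivity))
    (show (0:ℝ) ≤ 1 / 2 by norm_num) (show (0:ℝ) ≤ 1 / 2 by norm_num) (by norm_num)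
  simp only [smul_eq_mul] at this
  have e : 1 / 2 * (2 * s) + 1 / 2 * (2 * t) = s + t := by ring
  rw [e] at this
  linarith

lemma cm_pi {ω : ℝ → ℝ} (h : IsConcaveModulus ω) {m : ℝ} (hm : 0 < m) {s : ℝ} (hs0 : 0 ≤ s)
    (hs : s ≤ 4 / m) : ω s ≤ 4 * ω (1 / m) := by
  calc ω s ≤ ω (4 * (1 / m)) := cm_mono h hs0 (by rw [mul_one_div]; exact hs)
    _ ≤ 4 * ω (1 / m) := cm_scale h (by positivity) (by norm_num)

lemma cm_contOn {ω : ℝ → ℝ} (h : IsConcaveModulus ω) {m : ℕ} :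
    ContinuousOn (fun t : ℝ => ω (2 * t / m)) (Set.Ici 0) := by
  refine h.1.1.comp (by fun_prop) ?_
  intro t ht
  have : (0:ℝ) ≤ t := ht
  exact Set.mem_Ici.2 (by positivity)

lemma eInt_nonneg {ω : ℝ → ℝ} (h : IsConcaveModulus ω) (m : ℕ) : 0 ≤ eInt m ω := by
  unfold eInt
  refine intervalIntegral.integral_nonneg (by positivity) ?_
  intro t ht
  refine mul_nonneg (cm_nonneg h (by have := ht.1; positivity)) ?_
  exact sin_nonneg_of_nonneg_of_le_pi ht.1 (by linarith [ht.2, pi_pos])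

lemma eInt_le {ω : ℝ → ℝ} (h : IsConcaveModulus ω) {m : ℕ} (hm : 0 < m) :
    eInt m ω ≤ 8 * ω (1 / (m : ℝ)) := by
  have hm' : (0:ℝ) < m := by exact_mod_cast hm
  unfold eInt
  have : ‖∫ t in (0:ℝ)..(π / 2), ω (2 * t / m) * Real.sin t‖ ≤
      (4 * ω (1 / (m:ℝ))) * |π / 2 - 0| := by
    apply intervalIntegral.norm_integral_le_of_norm_le_const
    intro t ht
    rw [Set.uIoc_of_le (by positivity)] at ht
    have h0 : 0 ≤ 2 * t / m := by have := ht.1; positivity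
    rw [norm_mul, Real.norm_eq_abs, Real.norm_eq_abs, abs_of_nonneg (cm_nonneg h h0)]
    calc ω (2 * t / m) * |sin t| ≤ ω (2 * t / m) * 1 := by
          gcongr
          · exact cm_nonneg h h0
          · exact abs_sin_le_one t
      _ ≤ _ := by
          rw [mul_one]
          refine cm_pi h hm' h0 ?_
          gcongr
          linarith [ht.2, pi_le_four]
  rw [sub_zero, abs_of_pos (by positivity : 0 < π / 2)] at this
  have h1 := cm_nonneg h (s := 1 / (m:ℝ)) (by positivity)
  have := (le_abs_self _).trans this
  nlinarith [pi_le_four]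

/-- window estimate -/
lemma window_est {χ g g' : ℝ → ℝ} {c ε W : ℝ} (hχ : Continuous χ)
    (hg : ∀ u, HasDerivAt g (g' u) u) (hg' : Continuous g') (hε : ∀ u, |g' u| ≤ ε)
    (hW : ∀ u, |u - c| ≤ π / 2 → |χ u - χ c| ≤ W) (hc : cos c = 0) :
    |(∫ u in (c - π / 2)..(c + π / 2), χ u * (g' u * sin u + g u * cos u)) -
      (1 / π) * (∫ u in (c - π / 2)..(c + π / 2), g u) *
        ∫ u in (c - π / 2)..(c + π / 2), χ u * cos u| ≤ 20 * W * ε := by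
  have hgc : Continuous g := continuous_iff_continuousAt.2 fun u => (hg u).continuousAt
  have hε0 : 0 ≤ ε := (abs_nonneg _).trans (hε 0)
  have hW0 : 0 ≤ W := (abs_nonneg _).trans (hW c (by rw [sub_self, abs_zero]; positivity))
  have hs1 : sin (c - π / 2) = 0 := by rw [sin_sub_pi_div_two, hc, neg_zero]
  have hs2 : sin (c + π / 2) = 0 := by rw [sin_add_pi_div_two, hc]
  have hlip : ∀ u, |g u - g c| ≤ ε * |u - c| := by
    intro u
    have := Convex.norm_image_sub_le_of_norm_hasDerivWithin_le (f := g) (f' := g') (s := Set.univ)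
      (C := ε) (x := c) (y := u) (fun x _ => (hg x).hasDerivWithinAt) (fun x _ => hε x)
      convex_univ trivial trivial
    simpa using this
  have z1 : ∫ u in (c - π / 2)..(c + π / 2), (g' u * sin u + g u * cos u) = 0 := by
    rw [intervalIntegral.integral_eq_sub_of_hasDerivAt (f := fun u => g u * sin u)
      (fun u _ => (hg u).mul (hasDerivAt_sin u))
      ((by fun_prop : Continuous _).intervalIntegrable _ _)]
    rw [hs1, hs2]; ring
  have z2 : ∫ u in (c - π / 2)..(c + π / 2), cos u = 0 := by
    rw [integral_cos, hs1, hs2]; ring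
  set A := c - π / 2
  set B := c + π / 2
  have hAB : A ≤ B := by simp only [A, B]; linarith [pi_pos]
  have hBA : |B - A| = π := by
    have : B - A = π := by simp only [A, B]; ring
    rw [this, abs_of_pos pi_pos]
  have hu : ∀ u ∈ Set.uIoc A B, |u - c| ≤ π / 2 := by
    intro u hu
    rw [Set.uIoc_of_le hAB] at hu
    simp only [A, B] at hu
    rw [abs_le]; constructor <;> linarith [hu.1, hu.2]
  -- first
  have e1 : (∫ u in A..B, χ u * (g' u * sin u + g u * cos u)) =
      (∫ u in A..B, (χ u - χ c) * (g' u * sin u + (g u - g c) * cos u)) +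
        g c * ∫ u in A..B, χ u * cos u := by
    have i1 : (∫ u in A..B, χ u * (g' u * sin u + g u * cos u)) =
      ∫ u in A..B, (((χ u - χ c) * (g' u * sin u + (g u - g c) * cos u) + g c * (χ u * cos u)) +
        (χ c * (g' u * sin u + g u * cos u) - (χ c * g c) * cos u)) := by
      congr 1; ext u; ring
    rw [i1, intervalIntegral.integral_add ((by fun_prop : Continuous _).intervalIntegrable _ _)
      ((by fun_prop : Continuous _).intervalIntegrable _ _),
      intervalIntegral.integral_add ((by fun_prop : Continuous _).intervalIntegrable _ _)
      ((by fun_prop : Continuous _).intervalIntegrable _ _),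
      intervalIntegral.integral_sub ((by fun_prop : Continuous _).intervalIntegrable _ _)
      ((by fun_prop : Continuous _).intervalIntegrable _ _)]
    simp only [intervalIntegral.integral_const_mul]
    rw [z1, z2]; ring
  have b1 : |∫ u in A..B, (χ u - χ c) * (g' u * sin u + (g u - g c) * cos u)| ≤
      (W * (ε + ε * (π / 2))) * π := by
    rw [← hBA, ← Real.norm_eq_abs]
    apply intervalIntegral.norm_integral_le_of_norm_le_const
    intro u hu'
    have h1 := hu u hu'
    rw [Real.norm_eq_abs, abs_mul]
    rw [hBA]
    gcongr
    · exact hW u h1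
    · calc _ ≤ |g' u * sin u| + |(g u - g c) * cos u| := abs_add_le _ _
        _ ≤ ε * 1 + (ε * (π / 2)) * 1 := by
          rw [abs_mul, abs_mul]
          gcongr
          · exact hε u
          · exact abs_sin_le_one u
          · exact (hlip u).trans (by gcongr)
          · exact abs_cos_le_one u
        _ = _ := by ring
  have e2 : (∫ u in A..B, χ u * cos u) = ∫ u in A..B, (χ u - χ c) * cos u := by
    have i1 : (∫ u in A..B, (χ u - χ c) * cos u) = ∫ u in A..B, (χ u * cos u - χ c * cos u) := by
      congr 1; ext u; ring
    rw [i1, intervalIntegral.integral_sub ((by fun_prop : Continuous _).intervalIntegrable _ _)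
      ((by fun_prop : Continuous _).intervalIntegrable _ _), intervalIntegral.integral_const_mul,
      z2]; ring
  have b2 : |∫ u in A..B, χ u * cos u| ≤ W * π := by
    rw [e2]
    rw [← hBA, ← Real.norm_eq_abs]
    apply intervalIntegral.norm_integral_le_of_norm_le_const
    intro u hu'
    rw [Real.norm_eq_abs, abs_mul]
    calc _ ≤ W * 1 := by
          gcongr
          · exact hW u (hu u hu')
          · exact abs_cos_le_one u
      _ = W := mul_one W
  have b3 : |g c - (1 / π) * ∫ u in A..B, g u| ≤ ε * (π / 2) := by
    have i1 : g c - (1 / π) * ∫ u in A..B, g u = (1 / π) * ∫ u in A..B, (g c - g u) := by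
      rw [intervalIntegral.integral_sub ((by fun_prop : Continuous _).intervalIntegrable _ _)
        ((by fun_prop : Continuous _).intervalIntegrable _ _)]
      simp only [intervalIntegral.integral_const, smul_eq_mul]
      have : B - A = π := by simp only [A, B]; ring
      rw [this]; field_simp
    rw [i1, abs_mul, abs_of_pos (by positivity : 0 < 1 / π)]
    have : |∫ u in A..B, (g c - g u)| ≤ (ε * (π / 2)) * |B - A| := by
      rw [← Real.norm_eq_abs]
      apply intervalIntegral.norm_integral_le_of_norm_le_const
      intro u hu'
      rw [Real.norm_eq_abs, abs_sub_comm]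
      exact (hlip u).trans (by gcongr; exact hu u hu')
    rw [hBA] at this
    calc _ ≤ (1 / π) * ((ε * (π / 2)) * π) := by gcongr
      _ = _ := by field_simp
  rw [e1]
  have : (∫ u in A..B, (χ u - χ c) * (g' u * sin u + (g u - g c) * cos u)) +
        g c * (∫ u in A..B, χ u * cos u) - 1 / π * (∫ u in A..B, g u) * (∫ u in A..B, χ u * cos u)
      = (∫ u in A..B, (χ u - χ c) * (g' u * sin u + (g u - g c) * cos u)) +
        (g c - 1 / π * (∫ u in A..B, g u)) * (∫ u in A..B, χ u * cos u) := by ring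
  rw [this]
  calc _ ≤ (W * (ε + ε * (π / 2))) * π + (ε * (π / 2)) * (W * π) := by
        refine (abs_add_le _ _).trans ?_
        rw [abs_mul]
        gcongr
    _ = (W * ε) * (π + π ^ 2) := by ring
    _ ≤ (W * ε) * 20 := by
        gcongr
        nlinarith [pi_lt_d2, pi_pos]
    _ = _ := by ring

lemma pair_formula {χ : ℝ → ℝ} (hχ : Continuous χ) {c : ℝ} (hc : cos c = 0) :
    (∫ u in (c - π / 2)..(c + π / 2), χ u * cos u) =
      -sin c * ∫ v in (0:ℝ)..(π / 2), (χ (c + v) - χ (c - v)) * sin v := by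
  have e1 : (∫ u in (c - π / 2)..(c + π / 2), χ u * cos u) =
      (∫ u in (c - π / 2)..c, χ u * cos u) + ∫ u in c..(c + π / 2), χ u * cos u := by
    rw [intervalIntegral.integral_add_adjacent_intervals]
    · exact (by fun_prop : Continuous fun u => χ u * cos u).intervalIntegrable _ _
    · exact (by fun_prop : Continuous fun u => χ u * cos u).intervalIntegrable _ _
  have e2 : (∫ u in (c - π / 2)..c, χ u * cos u) =
      ∫ v in (0:ℝ)..(π / 2), χ (c - v) * cos (c - v) := by
    rw [intervalIntegral.integral_comp_sub_left (fun u => χ u * cos u) c]; simp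
  have e3 : (∫ u in c..(c + π / 2), χ u * cos u) =
      ∫ v in (0:ℝ)..(π / 2), χ (c + v) * cos (c + v) := by
    rw [intervalIntegral.integral_comp_add_left (fun u => χ u * cos u) c]; simp
  rw [e1, e2, e3, ← intervalIntegral.integral_add
    ((by fun_prop : Continuous _).intervalIntegrable _ _)
    ((by fun_prop : Continuous _).intervalIntegrable _ _), ← intervalIntegral.integral_const_mul]
  congr 1; ext v
  rw [cos_sub, cos_add, hc]; ring

lemma abs_sin_of_cos_zero {c : ℝ} (hc : cos c = 0) : |sin c| = 1 := by
  have := sin_sq_add_cos_sq c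
  rw [hc] at this
  have h2 : |sin c| ^ 2 = 1 := by rw [sq_abs]; linarith
  nlinarith [abs_nonneg (sin c)]

lemma pair_bound {ω χ : ℝ → ℝ} (hω : IsConcaveModulus ω) (hχ : Continuous χ) {c L : ℝ} {m : ℕ}
    (hc : cos c = 0) (h : ∀ u v, |χ u - χ v| ≤ L * ω (|u - v| / m)) :
    |∫ u in (c - π / 2)..(c + π / 2), χ u * cos u| ≤ L * eInt m ω := by
  rw [pair_formula hχ hc, abs_mul, abs_neg, abs_sin_of_cos_zero hc, one_mul]
  unfold eInt
  rw [← intervalIntegral.integral_const_mul, ← Real.norm_eq_abs]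
  apply intervalIntegral.norm_integral_le_of_norm_le (by positivity)
  · refine Filter.Eventually.of_forall fun v hv => ?_
    rw [norm_mul, Real.norm_eq_abs, Real.norm_eq_abs]
    have hs : 0 ≤ sin v := sin_nonneg_of_nonneg_of_le_pi hv.1.le (by linarith [hv.2, pi_pos])
    rw [abs_of_nonneg hs, ← mul_assoc]
    gcongr
    have := h (c + v) (c - v)
    have e : c + v - (c - v) = 2 * v := by ring
    rwa [e, abs_of_nonneg (by linarith [hv.1] : (0:ℝ) ≤ 2 * v)] at this
  · apply ContinuousOn.intervalIntegrable
    rw [Set.uIcc_of_le (by positivity)]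
    have h1 : ContinuousOn (fun t : ℝ => ω (2 * t / m)) (Set.Icc 0 (π / 2)) :=
      (cm_contOn hω).mono Set.Icc_subset_Ici_self
    exact continuousOn_const.mul (h1.mul continuous_sin.continuousOn)

lemma total_est {χ g g' : ℝ → ℝ} {ε W : ℝ} (N : ℕ) (hχ : Continuous χ)
    (hg : ∀ u, HasDerivAt g (g' u) u) (hg' : Continuous g') (hε : ∀ u, |g' u| ≤ ε)
    (hW : ∀ u c, |u - c| ≤ π / 2 → |χ u - χ c| ≤ W) :
    |(∫ u in (0:ℝ)..(N * π), χ u * (g' u * sin u + g u * cos u)) -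
      ∑ k ∈ Finset.range N, (1 / π) * (∫ u in (k * π)..((k + 1 : ℕ) * π), g u) *
        ∫ u in (k * π)..((k + 1 : ℕ) * π), χ u * cos u| ≤ N * (20 * W * ε) := by
  have hgc : Continuous g := continuous_iff_continuousAt.2 fun u => (hg u).continuousAt
  have e1 : (∫ u in (0:ℝ)..(N * π), χ u * (g' u * sin u + g u * cos u)) =
      ∑ k ∈ Finset.range N, ∫ u in (k * π)..((k + 1 : ℕ) * π),
        χ u * (g' u * sin u + g u * cos u) := by
    rw [intervalIntegral.sum_integral_adjacent_intervals (a := fun k : ℕ => (k : ℝ) * π)]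
    · simp
    · intro k _
      exact (by fun_prop : Continuous _).intervalIntegrable _ _
  rw [e1, ← Finset.sum_sub_distrib]
  refine (Finset.abs_sum_le_sum_abs _ _).trans ?_
  have : (N : ℝ) * (20 * W * ε) = ∑ k ∈ Finset.range N, 20 * W * ε := by simp
  rw [this]
  refine Finset.sum_le_sum fun k _ => ?_
  have hc : cos (k * π + π / 2) = 0 := by rw [cos_add_pi_div_two, sin_nat_mul_pi, neg_zero]
  have := window_est (c := k * π + π / 2) hχ hg hg' hε (fun u hu => hW u _ hu) hc
  have a1 : (k:ℝ) * π + π / 2 - π / 2 = k * π := by ring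
  have a2 : (k:ℝ) * π + π / 2 + π / 2 = (k + 1 : ℕ) * π := by push_cast; ring
  rwa [a1, a2] at this

lemma total_upper {ω χ g g' : ℝ → ℝ} {ε W L : ℝ} {m : ℕ} (N : ℕ) (hω : IsConcaveModulus ω)
    (hχ : Continuous χ)
    (hg : ∀ u, HasDerivAt g (g' u) u) (hg' : Continuous g') (hε : ∀ u, |g' u| ≤ ε)
    (hW : ∀ u c, |u - c| ≤ π / 2 → |χ u - χ c| ≤ W) (hg0 : ∀ u, 0 ≤ g u)
    (h : ∀ u v, |χ u - χ v| ≤ L * ω (|u - v| / m)) :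
    |∫ u in (0:ℝ)..(N * π), χ u * (g' u * sin u + g u * cos u)| ≤
      (L * eInt m ω) / π * (∫ u in (0:ℝ)..(N * π), g u) + N * (20 * W * ε) := by
  have hgc : Continuous g := continuous_iff_continuousAt.2 fun u => (hg u).continuousAt
  have h1 := total_est N hχ hg hg' hε hW
  set S := ∑ k ∈ Finset.range N, (1 / π) * (∫ u in (k * π)..((k + 1 : ℕ) * π), g u) *
        ∫ u in (k * π)..((k + 1 : ℕ) * π), χ u * cos u with hS
  have h2 : |S| ≤ (L * eInt m ω) / π * (∫ u in (0:ℝ)..(N * π), g u) := by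
    have e1 : (∫ u in (0:ℝ)..(N * π), g u) =
        ∑ k ∈ Finset.range N, ∫ u in (k * π)..((k + 1 : ℕ) * π), g u := by
      rw [intervalIntegral.sum_integral_adjacent_intervals (a := fun k : ℕ => (k : ℝ) * π)]
      · simp
      · intro k _
        exact hgc.intervalIntegrable _ _
    rw [e1, Finset.mul_sum]
    refine (Finset.abs_sum_le_sum_abs _ _).trans ?_
    refine Finset.sum_le_sum fun k _ => ?_
    have hp : 0 ≤ ∫ u in (k * π)..((k + 1 : ℕ) * π), g u := by
      apply intervalIntegral.integral_nonneg
      · push_cast; nlinarith [pi_pos]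
      · intro u _; exact hg0 u
    rw [abs_mul, abs_of_nonneg (by positivity)]
    have hc : cos (k * π + π / 2) = 0 := by rw [cos_add_pi_div_two, sin_nat_mul_pi, neg_zero]
    have := pair_bound (c := k * π + π / 2) hω hχ hc h
    have a1 : (k:ℝ) * π + π / 2 - π / 2 = k * π := by ring
    have a2 : (k:ℝ) * π + π / 2 + π / 2 = (k + 1 : ℕ) * π := by push_cast; ring
    rw [a1, a2] at this
    calc _ ≤ 1 / π * (∫ u in (k * π)..((k + 1 : ℕ) * π), g u) * (L * eInt m ω) := by gcongr
      _ = _ := by ring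
  have := abs_sub_abs_le_abs_sub (∫ u in (0:ℝ)..(N * π), χ u * (g' u * sin u + g u * cos u)) S
  linarith

lemma total_lower {χ g g' : ℝ → ℝ} {ε W e : ℝ} (N : ℕ)
    (hχ : Continuous χ)
    (hg : ∀ u, HasDerivAt g (g' u) u) (hg' : Continuous g') (hε : ∀ u, |g' u| ≤ ε)
    (hW : ∀ u c, |u - c| ≤ π / 2 → |χ u - χ c| ≤ W)
    (h : ∀ k : ℕ, ∫ u in (k * π)..((k + 1 : ℕ) * π), χ u * cos u = e) :
    e / π * (∫ u in (0:ℝ)..(N * π), g u) - N * (20 * W * ε) ≤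
    ∫ u in (0:ℝ)..(N * π), χ u * (g' u * sin u + g u * cos u) := by
  have hgc : Continuous g := continuous_iff_continuousAt.2 fun u => (hg u).continuousAt
  have h1 := total_est N hχ hg hg' hε hW
  have e1 : (∫ u in (0:ℝ)..(N * π), g u) =
        ∑ k ∈ Finset.range N, ∫ u in (k * π)..((k + 1 : ℕ) * π), g u := by
      rw [intervalIntegral.sum_integral_adjacent_intervals (a := fun k : ℕ => (k : ℝ) * π)]
      · simp
      · intro k _
        exact hgc.intervalIntegrable _ _
  have e2 : ∑ k ∈ Finset.range N, (1 / π) * (∫ u in (k * π)..((k + 1 : ℕ) * π), g u) *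
        ∫ u in (k * π)..((k + 1 : ℕ) * π), χ u * cos u = e / π * (∫ u in (0:ℝ)..(N * π), g u) := by
    rw [e1, Finset.mul_sum]
    refine Finset.sum_congr rfl fun k _ => ?_
    rw [h k]; ring
  rw [e2] at h1
  linarith [(abs_le.1 h1).1]

/-- triangle wave -/
def tri (u : ℝ) : ℝ := arcsin (cos u)

lemma tri_eq (u : ℝ) : tri u = π / 2 - arccos (cos u) := by
  unfold tri; rw [arccos]; ring

lemma arccos_cos_le (w : ℝ) : arccos (cos w) ≤ |w| := by
  rcases le_total |w| π with h | h
  · rw [← cos_abs, arccos_cos (abs_nonneg w) h]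
  · exact (arccos_le_pi _).trans h

lemma arccos_cos_exists (u : ℝ) : ∃ k : ℤ, arccos (cos u) = |u - k * (2 * π)| := by
  refine ⟨round (u / (2 * π)), ?_⟩
  have h := abs_sub_round (u / (2 * π))
  have h2 : |u - round (u / (2 * π)) * (2 * π)| ≤ π := by
    have e : u - round (u / (2 * π)) * (2 * π) = (u / (2 * π) - round (u / (2 * π))) * (2 * π) := by
      field_simp
    rw [e, abs_mul, abs_of_pos (by positivity : 0 < 2 * π)]
    calc _ ≤ 1 / 2 * (2 * π) := by gcongr
      _ = π := by ring
  rw [← arccos_cos (abs_nonneg _) h2, cos_abs, cos_sub_int_mul_two_pi]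

lemma tri_lip (u v : ℝ) : |tri u - tri v| ≤ |u - v| := by
  have key : ∀ u v : ℝ, arccos (cos v) - arccos (cos u) ≤ |u - v| := by
    intro u v
    obtain ⟨k, hk⟩ := arccos_cos_exists u
    have h1 := arccos_cos_le (v - k * (2 * π))
    rw [cos_sub_int_mul_two_pi] at h1
    have h2 : |v - k * (2 * π)| ≤ |u - k * (2 * π)| + |u - v| := by
      have e : v - k * (2 * π) = (u - k * (2 * π)) - (u - v) := by ring
      rw [e]; exact abs_sub _ _
    linarith
  rw [tri_eq, tri_eq, abs_le]
  have h1 := key u v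
  have h2 := key v u
  rw [abs_sub_comm] at h2
  constructor <;> linarith

lemma tri_abs_le (u : ℝ) : |tri u| ≤ π / 2 := by
  rw [abs_le]; exact ⟨neg_pi_div_two_le_arcsin _, arcsin_le_pi_div_two _⟩

/-- odd extension of `ω(2v/m)/2` -/
def sig (ω : ℝ → ℝ) (m : ℕ) (v : ℝ) : ℝ :=
  if 0 ≤ v then ω (2 * v / m) / 2 else -(ω (2 * (-v) / m) / 2)

lemma sig_neg {ω : ℝ → ℝ} (hω : IsConcaveModulus ω) (m : ℕ) (v : ℝ) :
    sig ω m (-v) = - sig ω m v := by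
  unfold sig
  rcases lt_trichotomy v 0 with h | h | h
  · rw [if_pos (by linarith), if_neg (by linarith)]; ring
  · subst h; simp [hω.1.2.2.2]
  · rw [if_neg (by linarith), if_pos h.le, neg_neg]

lemma sig_diff {ω : ℝ → ℝ} (hω : IsConcaveModulus ω) (m : ℕ) (v w : ℝ) :
    |sig ω m v - sig ω m w| ≤ ω (|v - w| / m) := by
  have key : ∀ v w : ℝ, 0 ≤ w → w ≤ v → |ω (2 * v / m) / 2 - ω (2 * w / m) / 2| ≤ ω ((v - w) / m) := by
    intro v w hw hv
    have h1 := cm_mono hω (s := 2 * w / m) (t := 2 * v / m) (by positivity) (by gcongr)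
    have hd : 0 ≤ (v - w) / m := div_nonneg (by linarith) (by positivity)
    have h2 := hω.1.2.2.1 (2 * w / m) ((v - w) / m + (v - w) / m) (by positivity) (by positivity)
    have h3 := hω.1.2.2.1 ((v - w) / m) ((v - w) / m) hd hd
    have e : 2 * w / m + ((v - w) / m + (v - w) / m) = 2 * v / m := by ring
    rw [e] at h2
    rw [abs_le]; constructor <;> linarith
  have key2 : ∀ v w : ℝ, 0 ≤ w → 0 ≤ v → |ω (2 * v / m) / 2 - ω (2 * w / m) / 2| ≤ ω (|v - w| / m) := by
    intro v w hw hv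
    rcases le_total w v with h | h
    · rw [abs_of_nonneg (by linarith : 0 ≤ v - w)]; exact key v w hw h
    · rw [abs_sub_comm, abs_sub_comm v w, abs_of_nonneg (by linarith : 0 ≤ w - v)]
      exact key w v hv h
  have key3 : ∀ v w : ℝ, 0 ≤ w → 0 ≤ v → |ω (2 * v / m) / 2 + ω (2 * w / m) / 2| ≤ ω ((v + w) / m) := by
    intro v w hw hv
    have h1 := cm_nonneg hω (s := 2 * v / m) (by positivity)
    have h2 := cm_nonneg hω (s := 2 * w / m) (by positivity)
    rw [abs_of_nonneg (by positivity)]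
    have := cm_half hω (s := v / m) (t := w / m) (by positivity) (by positivity)
    convert this using 2
    · rw [mul_div_assoc]
    · rw [mul_div_assoc]
    · ring
  unfold sig
  split_ifs with h1 h2 h2
  · exact key2 v w h2 h1
  · rw [sub_neg_eq_add, abs_of_nonneg (by linarith : 0 ≤ v - w)]
    have := key3 v (-w) (by linarith) h1
    rwa [← sub_eq_add_neg] at this
  · have := key3 (-v) w h2 (by linarith)
    rw [abs_of_nonpos (by linarith : v - w ≤ 0)]
    have e : -(v - w) = -v + w := by ring
    rw [e, ← abs_neg]
    convert this using 2; ring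
  · have := key2 (-v) (-w) (by linarith) (by linarith)
    have e : |(-v) - (-w)| = |v - w| := by rw [← abs_neg]; congr 1; ring
    rw [e] at this
    rw [← abs_neg]
    convert this using 2; ring

/-- the extremal function in the phase variable -/
def Phi0 (ω : ℝ → ℝ) (m : ℕ) (u : ℝ) : ℝ := sig ω m (tri u)

lemma Phi0_diff {ω : ℝ → ℝ} (hω : IsConcaveModulus ω) (m : ℕ) (u v : ℝ) :
    |Phi0 ω m u - Phi0 ω m v| ≤ ω (|u - v| / m) := by
  refine (sig_diff hω m _ _).trans (cm_mono hω (by positivity) ?_)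
  exact div_le_div_of_nonneg_right (tri_lip u v) (by positivity)

lemma cont_of_mod {ω χ : ℝ → ℝ} (hω : IsConcaveModulus ω) {K : ℝ} (hK : 0 ≤ K)
    (h : ∀ u v, |χ u - χ v| ≤ ω (K * |u - v|)) : Continuous χ := by
  rw [continuous_iff_continuousAt]
  intro v
  rw [ContinuousAt, tendsto_iff_norm_sub_tendsto_zero]
  have h1 : Filter.Tendsto (fun u => ω (K * |u - v|)) (nhds v) (nhds 0) := by
    have h2 : ContinuousOn (fun u => ω (K * |u - v|)) Set.univ := by
      refine hω.1.1.comp (by fun_prop) ?_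
      intro u _
      exact Set.mem_Ici.2 (by positivity)
    have h3 := (continuousOn_univ.1 h2).tendsto v
    simpa [hω.1.2.2.2] using h3
  exact squeeze_zero (fun _ => norm_nonneg _) (fun u => h u v) h1

lemma Phi0_cont {ω : ℝ → ℝ} (hω : IsConcaveModulus ω) (m : ℕ) : Continuous (Phi0 ω m) := by
  apply cont_of_mod hω (K := 1 / m) (by positivity)
  intro u v
  have := Phi0_diff hω m u v
  rwa [one_div_mul_eq_div]

lemma Phi0_periodic (ω : ℝ → ℝ) (m : ℕ) (u : ℝ) (k : ℕ) :
    Phi0 ω m (u + k * (2 * π)) = Phi0 ω m u := by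
  unfold Phi0 tri; rw [cos_add_nat_mul_two_pi]

lemma Phi0_window {ω : ℝ → ℝ} (hω : IsConcaveModulus ω) (m : ℕ) (k : ℕ) :
    ∫ u in (k * π)..((k + 1 : ℕ) * π), Phi0 ω m u * cos u = eInt m ω := by
  have hper : Function.Periodic (fun u => Phi0 ω m u * cos u) π := by
    intro u
    have : Phi0 ω m (u + π) = - Phi0 ω m u := by
      unfold Phi0 tri
      rw [cos_add_pi, arcsin_neg, sig_neg hω]
    simp only [this, cos_add_pi]; ring
  have e0 : ((k + 1 : ℕ) : ℝ) * π = k * π + π := by push_cast; ring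
  rw [e0, hper.intervalIntegral_add_eq (k * π) 0, zero_add]
  have := pair_formula (Phi0_cont hω m) (c := π / 2) cos_pi_div_two
  rw [sub_self, add_halves] at this
  rw [this, sin_pi_div_two, eInt, ← intervalIntegral.integral_const_mul]
  apply intervalIntegral.integral_congr
  intro v hv
  rw [Set.uIcc_of_le (by positivity)] at hv
  have h1 : tri (π / 2 + v) = -v := by
    unfold tri
    rw [add_comm, cos_add_pi_div_two, arcsin_neg, arcsin_sin (by linarith [hv.1, pi_pos]) hv.2]
  have h2 : tri (π / 2 - v) = v := by
    unfold tri
    rw [cos_pi_div_two_sub, arcsin_sin (by linarith [hv.1, pi_pos]) hv.2]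
  simp only [Phi0, h1, h2, sig_neg hω]
  unfold sig
  rw [if_pos hv.1]; ring

/-- Amplitude/phase data. -/
structure AP (a b a' b' : ℝ → ℝ) (Λ M : ℝ) (m : ℕ) : Prop where
  da : ∀ t, HasDerivAt a (a' t) t
  db : ∀ t, HasDerivAt b (b' t) t
  ca : Continuous a'
  cb : Continuous b'
  pa : ∀ t, a (t + 2 * π) = a t
  pb : ∀ t, b (t + 2 * π) = b t
  la : ∀ t, |a' t| ≤ Λ
  lb : ∀ t, |b' t| ≤ Λ
  hM : ∀ t, exp (a t) ≤ M
  hm : 0 < m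
  hΛ : 2 * Λ ≤ m

/-- derivative of `exp (a t) * sin (m t + b t)` -/
def Sder (a b a' b' : ℝ → ℝ) (m : ℕ) (t : ℝ) : ℝ :=
  exp (a t) * (a' t * sin (m * t + b t) + (m + b' t) * cos (m * t + b t))

section
variable {a b a' b' : ℝ → ℝ} {Λ M : ℝ} {m : ℕ}

lemma AP.conta (h : AP a b a' b' Λ M m) : Continuous a :=
  continuous_iff_continuousAt.2 fun u => (h.da u).continuousAt
lemma AP.contb (h : AP a b a' b' Λ M m) : Continuous b :=
  continuous_iff_continuousAt.2 fun u => (h.db u).continuousAt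
lemma AP.L0 (h : AP a b a' b' Λ M m) : 0 ≤ Λ := (abs_nonneg _).trans (h.la 0)
lemma AP.M0 (h : AP a b a' b' Λ M m) : 0 ≤ M := (exp_pos _).le.trans (h.hM 0)
lemma AP.m0 (h : AP a b a' b' Λ M m) : (0:ℝ) < m := by exact_mod_cast h.hm
lemma AP.dth (h : AP a b a' b' Λ M m) (t : ℝ) :
    HasDerivAt (fun t => (m:ℝ) * t + b t) (m + b' t) t := by
  have h1 := ((hasDerivAt_id t).const_mul (m:ℝ)).add (h.db t)
  rw [mul_one] at h1
  exact h1
lemma AP.bb_lip (h : AP a b a' b' Λ M m) (s t : ℝ) : |b s - b t| ≤ Λ * |s - t| := by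
  have := Convex.norm_image_sub_le_of_norm_hasDerivWithin_le (f := b) (f' := b') (s := Set.univ)
      (C := Λ) (x := t) (y := s) (fun x _ => (h.db x).hasDerivWithinAt) (fun x _ => h.lb x)
      convex_univ trivial trivial
  simpa using this
lemma AP.thlow (h : AP a b a' b' Λ M m) (t : ℝ) : (m:ℝ) / 2 ≤ m + b' t := by
  have := (abs_le.1 (h.lb t)).1
  have := h.hΛ
  linarith
lemma AP.mL (h : AP a b a' b' Λ M m) : 0 < (m:ℝ) - Λ := by
  have := h.hΛ; have := h.m0; linarith

lemma AP.inv (h : AP a b a' b' Λ M m) : ∃ τ : ℝ → ℝ, (∀ u, m * τ u + b (τ u) = u) ∧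
    (∀ t, τ (m * t + b t) = t) ∧ Continuous τ ∧
    (∀ u, HasDerivAt τ (1 / (m + b' (τ u))) u) ∧
    (∀ u v, |τ u - τ v| ≤ |u - v| / (m - Λ)) := by
  have hmono : StrictMono (fun t => (m:ℝ) * t + b t) := by
    apply strictMono_of_deriv_pos
    intro t
    rw [(h.dth t).deriv]
    have := h.thlow t
    have := h.m0
    linarith
  have hcont : Continuous (fun t => (m:ℝ) * t + b t) := by
    have := h.contb; fun_prop
  have hb0 : ∀ t, |b t - b 0| ≤ Λ * |t| := fun t => by simpa using h.bb_lip t 0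
  have hmL := h.mL
  have hsurj : Function.Surjective (fun t => (m:ℝ) * t + b t) := by
    apply hcont.surjective
    · apply Filter.tendsto_atTop_mono' (f₁ := fun t => ((m:ℝ) - Λ) * t + b 0)
      · filter_upwards [Filter.eventually_ge_atTop 0] with t ht
        have := (abs_le.1 (hb0 t)).1
        rw [abs_of_nonneg ht] at this
        nlinarith
      · exact Filter.tendsto_atTop_add_const_right _ _
          (Filter.tendsto_id.const_mul_atTop hmL)
    · refine Filter.tendsto_atBot_mono' Filter.atBot (f₁ := fun t => ((m:ℝ) - Λ) * t + b 0) ?_ ?_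
      · filter_upwards [Filter.eventually_le_atBot 0] with t ht
        have := (abs_le.1 (hb0 t)).2
        rw [abs_of_nonpos ht] at this
        nlinarith
      · exact Filter.tendsto_atBot_add_const_right _ _
          (Filter.tendsto_id.const_mul_atBot hmL)
  let e := hmono.orderIsoOfSurjective _ hsurj
  have he : ∀ t, e t = (m:ℝ) * t + b t := fun t => rfl
  have h1 : ∀ u, (m:ℝ) * e.symm u + b (e.symm u) = u := fun u => by
    rw [← he]; exact e.apply_symm_apply u
  have h2 : ∀ t, e.symm (m * t + b t) = t := fun t => by
    rw [← he]; exact e.symm_apply_apply t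
  refine ⟨e.symm, h1, h2, e.symm.continuous, ?_, ?_⟩
  · intro u
    rw [one_div]
    refine HasDerivAt.of_local_left_inverse (f := fun t => (m:ℝ) * t + b t)
      e.symm.continuous.continuousAt (h.dth _) ?_ (Filter.Eventually.of_forall h1)
    have := h.thlow (e.symm u)
    have := h.m0
    linarith
  · intro u v
    rw [le_div_iff₀ hmL]
    have := h.bb_lip (e.symm u) (e.symm v)
    have e1 : (m:ℝ) * (e.symm u - e.symm v) = (u - v) - (b (e.symm u) - b (e.symm v)) := by
      linear_combination h1 u - h1 v
    have e2 : (m:ℝ) * |e.symm u - e.symm v| ≤ |u - v| + |b (e.symm u) - b (e.symm v)| := by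
      have e3 : (m:ℝ) * |e.symm u - e.symm v| = |(m:ℝ) * (e.symm u - e.symm v)| := by
        rw [abs_mul, abs_of_pos h.m0]
      rw [e3, e1]; exact abs_sub _ _
    linarith

/-- transfer into the phase variable -/
lemma AP.transfer (h : AP a b a' b' Λ M m) {τ : ℝ → ℝ} (h1 : ∀ u, m * τ u + b (τ u) = u)
    (h2 : ∀ t, τ (m * t + b t) = t) {H : ℝ → ℝ} (hH : Continuous H) {F : ℝ → ℝ}
    (hF : ∀ t, F (t + 2 * π) = F t) (hFH : ∀ t, F t = H (m * t + b t) * (m + b' t)) :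
    ∫ t in (0:ℝ)..(2 * π), F t = ∫ u in (0:ℝ)..((2 * m : ℕ) * π), H u := by
  have e0 := Function.Periodic.intervalIntegral_add_eq (f := F) hF 0 (τ 0)
  rw [zero_add] at e0
  rw [e0]
  have := intervalIntegral.integral_comp_mul_deriv (a := τ 0) (b := τ 0 + 2 * π)
    (fun t _ => h.dth t) (by have := h.cb; fun_prop) hH
  rw [h1 0] at this
  have e1 : (m:ℝ) * (τ 0 + 2 * π) + b (τ 0 + 2 * π) = (2 * m : ℕ) * π := by
    rw [h.pb]; push_cast; linear_combination h1 0
  rw [e1] at this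
  rw [← this]
  congr 1; ext t
  rw [hFH]; rfl

lemma AP.common (h : AP a b a' b' Λ M m) : ∃ τ g g' : ℝ → ℝ,
    (∀ u, m * τ u + b (τ u) = u) ∧ (∀ t, τ (m * t + b t) = t) ∧ Continuous τ ∧
    (∀ u v, |τ u - τ v| ≤ |u - v| / (m - Λ)) ∧
    (∀ u, HasDerivAt g (g' u) u) ∧ Continuous g' ∧ (∀ u, |g' u| ≤ 2 * M * Λ / m) ∧
    (∀ u, 0 ≤ g u) ∧
    (|(∫ u in (0:ℝ)..((2 * m : ℕ) * π), g u) - m * ∫ t in (0:ℝ)..(2 * π), exp (a t)| ≤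
      2 * π * M * Λ) ∧
    ∀ φ : ℝ → ℝ, Continuous φ → (∀ t, φ (t + 2 * π) = φ t) →
      ∫ t in (0:ℝ)..(2 * π), φ t * Sder a b a' b' m t =
        ∫ u in (0:ℝ)..((2 * m : ℕ) * π), φ (τ u) * (g' u * sin u + g u * cos u) := by
  obtain ⟨τ, h1, h2, h3, h4, h5⟩ := h.inv
  have hpos : ∀ t, 0 < m + b' t := fun t => by
    have := h.thlow t
    have := h.m0
    linarith
  have ca := h.conta
  have cb := h.contb
  have ca' := h.ca
  have cb' := h.cb
  have hg'c : Continuous fun u => exp (a (τ u)) * (a' (τ u) * (1 / (m + b' (τ u)))) := by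
    have : Continuous fun u => 1 / (m + b' (τ u)) :=
      continuous_const.div (by fun_prop) (fun u => (hpos _).ne')
    fun_prop
  refine ⟨τ, fun u => exp (a (τ u)), fun u => exp (a (τ u)) * (a' (τ u) * (1 / (m + b' (τ u)))),
    h1, h2, h3, h5, ?_, hg'c, ?_, fun u => (exp_pos _).le, ?_, ?_⟩
  · intro u
    exact ((h.da (τ u)).comp u (h4 u)).exp
  · intro u
    rw [abs_mul, abs_mul, abs_of_pos (exp_pos _), abs_of_pos (one_div_pos.2 (hpos _))]
    have hm := h.m0
    have hM := h.M0
    have hL := h.L0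
    calc _ ≤ M * (Λ * (1 / (m / 2))) := by
          have hp := hpos (τ u)
          gcongr
          · exact h.hM _
          · exact h.la _
          · exact h.thlow _
      _ = _ := by field_simp
  · have e1 := h.transfer h1 h2 (H := fun u => exp (a (τ u))) (by fun_prop)
      (F := fun t => exp (a t) * (m + b' t)) ?_ (fun t => by rw [h2])
    · rw [← e1, ← intervalIntegral.integral_const_mul, ← intervalIntegral.integral_sub
        ((by fun_prop : Continuous _).intervalIntegrable _ _)
        ((by fun_prop : Continuous _).intervalIntegrable _ _)]
      have : ‖∫ t in (0:ℝ)..(2 * π), (exp (a t) * (m + b' t) - m * exp (a t))‖ ≤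
          (M * Λ) * |2 * π - 0| := by
        apply intervalIntegral.norm_integral_le_of_norm_le_const
        intro t _
        have e : exp (a t) * (m + b' t) - m * exp (a t) = exp (a t) * b' t := by ring
        rw [e, norm_mul, Real.norm_eq_abs, Real.norm_eq_abs, abs_of_pos (exp_pos _)]
        have hM := h.M0
        gcongr
        · exact h.hM t
        · exact h.lb t
      rw [sub_zero, abs_of_pos two_pi_pos] at this
      rw [Real.norm_eq_abs] at this
      linarith
    · intro t
      have hb' : b' (t + 2 * π) = b' t := by
        have h7 := (h.db (t + 2 * π)).comp_add_const t (2 * π)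
        have h8 : (fun x => b (x + 2 * π)) = b := funext h.pb
        rw [h8] at h7
        exact h7.unique (h.db t)
      rw [h.pa, hb']
  · intro φ hφ hper
    have hb' : ∀ t, b' (t + 2 * π) = b' t := by
      intro t
      have h7 := (h.db (t + 2 * π)).comp_add_const t (2 * π)
      have h8 : (fun x => b (x + 2 * π)) = b := funext h.pb
      rw [h8] at h7
      exact h7.unique (h.db t)
    have ha' : ∀ t, a' (t + 2 * π) = a' t := by
      intro t
      have h7 := (h.da (t + 2 * π)).comp_add_const t (2 * π)
      have h8 : (fun x => a (x + 2 * π)) = a := funext h.pa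
      rw [h8] at h7
      exact h7.unique (h.da t)
    apply h.transfer h1 h2
    · have : Continuous fun u => exp (a (τ u)) := by fun_prop
      fun_prop
    · intro t
      have e : (m:ℝ) * (t + 2 * π) + b t = (m * t + b t) + m * (2 * π) := by ring
      simp only [Sder, hper, ha', hb', h.pa, h.pb, e, sin_add_nat_mul_two_pi,
        cos_add_nat_mul_two_pi]
    · intro t
      simp only [Sder, h2]
      have := (hpos t).ne'
      field_simp

lemma AP.I_bound (h : AP a b a' b' Λ M m) :
    0 ≤ (∫ t in (0:ℝ)..(2 * π), exp (a t)) ∧ (∫ t in (0:ℝ)..(2 * π), exp (a t)) ≤ 2 * π * M := by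
  constructor
  · exact intervalIntegral.integral_nonneg (by positivity) fun t _ => (exp_pos _).le
  · have : ‖∫ t in (0:ℝ)..(2 * π), exp (a t)‖ ≤ M * |2 * π - 0| := by
      apply intervalIntegral.norm_integral_le_of_norm_le_const
      intro t _
      rw [Real.norm_eq_abs, abs_of_pos (exp_pos _)]
      exact h.hM t
    rw [sub_zero, abs_of_pos two_pi_pos] at this
    have := (le_abs_self _).trans this
    linarith

lemma AP.upper (h : AP a b a' b' Λ M m) {ω : ℝ → ℝ} (hω : IsConcaveModulus ω) {φ : ℝ → ℝ}
    (hφ : φ ∈ Hclass ω) :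
    |∫ t in (0:ℝ)..(2 * π), φ t * Sder a b a' b' m t| ≤
      m / π * eInt m ω * (∫ t in (0:ℝ)..(2 * π), exp (a t)) + 704 * (ω (1 / m) * (M * Λ)) := by
  obtain ⟨τ, g, g', h1, h2, h3, h4, h5, h6, h7, h8, h9, h10⟩ := h.common
  rw [h10 φ hφ.1 hφ.2.1]
  have hm := h.m0
  have hmL := h.mL
  have hM := h.M0
  have hL0 := h.L0
  have hΛ := h.hΛ
  set L : ℝ := m / (m - Λ) with hL
  have hL1 : 1 ≤ L := by rw [hL, le_div_iff₀ hmL]; linarith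
  have hL2 : L ≤ 2 := by rw [hL, div_le_iff₀ hmL]; linarith
  have hL3 : L * m ≤ m + 2 * Λ := by
    rw [hL, div_mul_eq_mul_div, div_le_iff₀ hmL]; nlinarith
  have hmod : ∀ u v, |φ (τ u) - φ (τ v)| ≤ L * ω (|u - v| / m) := by
    intro u v
    refine (hφ.2.2 _ _).trans ?_
    refine le_trans ?_ (cm_scale hω (by positivity) hL1)
    refine cm_mono hω (abs_nonneg _) ((h4 u v).trans (le_of_eq ?_))
    rw [hL]; field_simp
  have hw0 : 0 ≤ ω (1 / m) := cm_nonneg hω (by positivity)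
  have hW : ∀ u c, |u - c| ≤ π / 2 → |φ (τ u) - φ (τ c)| ≤ 8 * ω (1 / m) := by
    intro u c huc
    refine (hmod u c).trans ?_
    have : ω (|u - c| / m) ≤ 4 * ω (1 / m) := by
      refine cm_pi hω hm (by positivity) ?_
      gcongr
      linarith [pi_le_four]
    have h0 : 0 ≤ ω (|u - c| / m) := cm_nonneg hω (by positivity)
    nlinarith
  have key := total_upper (2 * m) hω (hφ.1.comp h3) h5 h6 h7 hW h8 hmod
  simp only [Function.comp_apply] at key
  refine key.trans ?_
  obtain ⟨hI0, hI1⟩ := h.I_bound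
  set I := ∫ t in (0:ℝ)..(2 * π), exp (a t)
  set G := ∫ u in (0:ℝ)..((2 * m : ℕ) * π), g u
  have he0 := eInt_nonneg hω m
  have he1 := eInt_le hω h.hm
  set e := eInt m ω
  set w := ω (1 / (m:ℝ))
  have hG : G ≤ m * I + 2 * π * M * Λ := by linarith [(abs_le.1 h9).2]
  have hLG : L * G ≤ m * I + 8 * π * M * Λ := by
    have : 0 ≤ 2 * π * M * Λ := by positivity
    calc L * G ≤ L * (m * I + 2 * π * M * Λ) := by gcongr
      _ = (L * m) * I + L * (2 * π * M * Λ) := by ring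
      _ ≤ (m + 2 * Λ) * I + 2 * (2 * π * M * Λ) := by gcongr
      _ = m * I + 2 * Λ * I + 4 * π * M * Λ := by ring
      _ ≤ m * I + 2 * Λ * (2 * π * M) + 4 * π * M * Λ := by gcongr
      _ = _ := by ring
  have t1 : L * e / π * G ≤ m / π * e * I + 64 * (w * (M * Λ)) := by
    calc L * e / π * G = e / π * (L * G) := by ring
      _ ≤ e / π * (m * I + 8 * π * M * Λ) := by gcongr
      _ = m / π * e * I + e * (8 * (M * Λ)) := by field_simp
      _ ≤ m / π * e * I + (8 * w) * (8 * (M * Λ)) := by gcongr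
      _ = _ := by ring
  have t2 : ((2 * m : ℕ) : ℝ) * (20 * (8 * w) * (2 * M * Λ / m)) = 640 * (w * (M * Λ)) := by
    push_cast; field_simp; ring
  rw [t2]
  linarith

lemma AP.lower (h : AP a b a' b' Λ M m) {ω : ℝ → ℝ} (hω : IsConcaveModulus ω) :
    ∃ φ ∈ Hclass ω,
      m / π * eInt m ω * (∫ t in (0:ℝ)..(2 * π), exp (a t)) - 704 * (ω (1 / m) * (M * Λ)) ≤
    ∫ t in (0:ℝ)..(2 * π), φ t * Sder a b a' b' m t := by
  obtain ⟨τ, g, g', h1, h2, h3, h4, h5, h6, h7, h8, h9, h10⟩ := h.common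
  have hm := h.m0
  have hmL := h.mL
  have hM := h.M0
  have hL0 := h.L0
  have hΛ := h.hΛ
  have cb := h.contb
  set L : ℝ := 1 + Λ / m with hL
  have hL1 : 1 ≤ L := by rw [hL]; have : 0 ≤ Λ / m := by positivity
                         linarith
  have hLp : 0 < L := by linarith
  have cP := Phi0_cont hω m
  have hc : Continuous fun t => 1 / L * Phi0 ω m (m * t + b t) := by fun_prop
  have hp : ∀ t, 1 / L * Phi0 ω m (m * (t + 2 * π) + b (t + 2 * π)) =
      1 / L * Phi0 ω m (m * t + b t) := by
    intro t
    rw [h.pb]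
    have e : (m:ℝ) * (t + 2 * π) + b t = (m * t + b t) + m * (2 * π) := by ring
    rw [e, Phi0_periodic]
  refine ⟨fun t => 1 / L * Phi0 ω m (m * t + b t), ⟨hc, hp, ?_⟩, ?_⟩
  · intro s t
    rw [← mul_sub, abs_mul, abs_of_pos (by positivity : 0 < 1 / L)]
    have hd : |m * s + b s - (m * t + b t)| / m ≤ L * |s - t| := by
      rw [div_le_iff₀ hm]
      have e : m * s + b s - (m * t + b t) = m * (s - t) + (b s - b t) := by ring
      rw [e]
      calc _ ≤ |m * (s - t)| + |b s - b t| := abs_add_le _ _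
        _ ≤ m * |s - t| + Λ * |s - t| := by
          rw [abs_mul, abs_of_pos hm]
          gcongr
          exact h.bb_lip s t
        _ = _ := by rw [hL]; field_simp
    calc _ ≤ 1 / L * ω (|m * s + b s - (m * t + b t)| / m) := by
          gcongr; exact Phi0_diff hω m _ _
      _ ≤ 1 / L * ω (L * |s - t|) := by
          gcongr; exact cm_mono hω (by positivity) hd
      _ ≤ 1 / L * (L * ω |s - t|) := by
          gcongr; exact cm_scale hω (abs_nonneg _) hL1
      _ = _ := by field_simp
  · rw [h10 _ hc hp]
    simp only [h1]
    have e1 : ∫ u in (0:ℝ)..((2 * m : ℕ) * π), 1 / L * Phi0 ω m u * (g' u * sin u + g u * cos u) =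
        1 / L * ∫ u in (0:ℝ)..((2 * m : ℕ) * π), Phi0 ω m u * (g' u * sin u + g u * cos u) := by
      rw [← intervalIntegral.integral_const_mul]
      congr 1; ext u; ring
    rw [e1]
    have hw0 : 0 ≤ ω (1 / m) := cm_nonneg hω (by positivity)
    have hW : ∀ u c, |u - c| ≤ π / 2 → |Phi0 ω m u - Phi0 ω m c| ≤ 4 * ω (1 / m) := by
      intro u c huc
      refine (Phi0_diff hω m u c).trans ?_
      refine cm_pi hω hm (by positivity) ?_
      gcongr
      linarith [pi_le_four]
    have key := total_lower (2 * m) cP h5 h6 h7 hW (Phi0_window hω m)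
    obtain ⟨hI0, hI1⟩ := h.I_bound
    set I := ∫ t in (0:ℝ)..(2 * π), exp (a t)
    set G := ∫ u in (0:ℝ)..((2 * m : ℕ) * π), g u
    set X := ∫ u in (0:ℝ)..((2 * m : ℕ) * π), Phi0 ω m u * (g' u * sin u + g u * cos u)
    have he0 := eInt_nonneg hω m
    have he1 := eInt_le hω h.hm
    set e := eInt m ω
    set w := ω (1 / (m:ℝ))
    have hG : m * I - 2 * π * M * Λ ≤ G := by linarith [(abs_le.1 h9).1]
    have t1 : m / π * e * I - 16 * (w * (M * Λ)) ≤ e / π * G := by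
      calc m / π * e * I - 16 * (w * (M * Λ)) = m / π * e * I - (8 * w) * (2 * (M * Λ)) := by ring
        _ ≤ m / π * e * I - e * (2 * (M * Λ)) := by gcongr
        _ = e / π * (m * I - 2 * π * M * Λ) := by field_simp
        _ ≤ _ := by gcongr
    have t2 : ((2 * m : ℕ) : ℝ) * (20 * (4 * w) * (2 * M * Λ / m)) = 320 * (w * (M * Λ)) := by
      push_cast; field_simp; ring
    rw [t2] at key
    have hq : 0 ≤ w * (M * Λ) := by positivity
    have t3 : m / π * e * I * (Λ / m) ≤ 16 * (w * (M * Λ)) := by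
      calc m / π * e * I * (Λ / m) = e * (1 / π * I * Λ) := by field_simp
        _ ≤ (8 * w) * (1 / π * (2 * π * M) * Λ) := by gcongr
        _ = _ := by field_simp; ring
    have hP0 : 0 ≤ m / π * e * I := by positivity
    set P := m / π * e * I
    rw [one_div_mul_eq_div, le_div_iff₀ hLp, hL]
    have hx : 0 ≤ Λ / m := by positivity
    nlinarith [mul_nonneg hq hx]
end

/-- `q e^{it}` -/
def zz (q t : ℝ) : ℂ := (q : ℂ) * Complex.exp (t * Complex.I)

/-- complex logarithm of the amplitude -/
def LL (q : ℝ) (p : ℕ) (t : ℝ) : ℂ :=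
  Complex.log (1 - zz q t ^ p) - 2 * Complex.log (1 - zz q t)

/-- its derivative -/
def LL' (q : ℝ) (p : ℕ) (t : ℝ) : ℂ :=
  (-(p * zz q t ^ p * Complex.I)) / (1 - zz q t ^ p) -
    2 * ((-(zz q t * Complex.I)) / (1 - zz q t))

lemma zz_norm {q : ℝ} (hq : 0 ≤ q) (t : ℝ) : ‖zz q t‖ = q := by
  unfold zz
  rw [norm_mul, Complex.norm_exp_ofReal_mul_I, mul_one, Complex.norm_real, Real.norm_eq_abs,
    abs_of_nonneg hq]

lemma zz_periodic (q t : ℝ) : zz q (t + 2 * π) = zz q t := by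
  unfold zz
  congr 1
  rw [Complex.exp_eq_exp_iff_exists_int]
  exact ⟨1, by push_cast; ring⟩

lemma zz_deriv (q t : ℝ) : HasDerivAt (zz q) (zz q t * Complex.I) t := by
  have h1 : HasDerivAt (fun t : ℝ => (t : ℂ) * Complex.I) Complex.I t := by
    have := (HasDerivAt.ofReal_comp (hasDerivAt_id t)).mul_const Complex.I
    simpa using this
  have h2 := (h1.cexp).const_mul (q : ℂ)
  exact h2.congr_deriv (by unfold zz; ring)

lemma zz_pow_deriv (q t : ℝ) (p : ℕ) :
    HasDerivAt (fun t => zz q t ^ p) (p * zz q t ^ p * Complex.I) t := by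
  have h := (zz_deriv q t).pow p
  rcases p with _ | p
  · simpa using hasDerivAt_const t (1:ℂ)
  · exact h.congr_deriv (by rw [Nat.add_sub_cancel]; ring)

lemma slit_of_norm_lt {w : ℂ} (h : ‖w‖ < 1) : 1 - w ∈ Complex.slitPlane := by
  left
  have := Complex.re_le_norm w
  simp; linarith

lemma one_sub_ne {w : ℂ} (h : ‖w‖ < 1) : 1 - w ≠ 0 := Complex.slitPlane_ne_zero (slit_of_norm_lt h)

lemma zz_pow_norm_lt {q : ℝ} (hq : 0 < q) (hq1 : q < 1) (t : ℝ) {p : ℕ} (hp : 0 < p) :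
    ‖zz q t ^ p‖ < 1 := by
  rw [norm_pow, zz_norm hq.le]
  exact pow_lt_one₀ hq.le hq1 hp.ne'

lemma zz_norm_lt {q : ℝ} (hq : 0 < q) (hq1 : q < 1) (t : ℝ) : ‖zz q t‖ < 1 := by
  rw [zz_norm hq.le]; exact hq1

lemma LL_deriv {q : ℝ} (hq : 0 < q) (hq1 : q < 1) {p : ℕ} (hp : 0 < p) (t : ℝ) :
    HasDerivAt (LL q p) (LL' q p t) t := by
  have h1 := ((zz_pow_deriv q t p).const_sub 1).clog_real
    (slit_of_norm_lt (zz_pow_norm_lt hq hq1 t hp))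
  have h2 := ((zz_deriv q t).const_sub 1).clog_real (slit_of_norm_lt (zz_norm_lt hq hq1 t))
  exact h1.sub (h2.const_mul 2)

lemma zz_cont (q : ℝ) : Continuous (zz q) :=
  continuous_iff_continuousAt.2 fun t => (zz_deriv q t).continuousAt

lemma LL'_cont {q : ℝ} (hq : 0 < q) (hq1 : q < 1) {p : ℕ} (hp : 0 < p) :
    Continuous (LL' q p) := by
  have := zz_cont q
  unfold LL'
  refine Continuous.sub (Continuous.div (by fun_prop) (by fun_prop) ?_)
    (continuous_const.mul (Continuous.div (by fun_prop) (by fun_prop) ?_))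
  · exact fun t => one_sub_ne (zz_pow_norm_lt hq hq1 t hp)
  · exact fun t => one_sub_ne (zz_norm_lt hq hq1 t)

lemma norm_one_sub_ge (w : ℂ) : 1 - ‖w‖ ≤ ‖1 - w‖ := by
  have := norm_sub_norm_le (1:ℂ) w
  simpa using this

lemma pq_bound {q : ℝ} (hq : 0 < q) (hq1 : q < 1) (p : ℕ) :
    p * q ^ p * (1 - q) ≤ 1 - q ^ p := by
  have h := geom_sum_mul q p
  have h2 : (p:ℝ) * q ^ p ≤ ∑ i ∈ Finset.range p, q ^ i := by
    have : (p:ℝ) * q ^ p = ∑ i ∈ Finset.range p, q ^ p := by simp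
    rw [this]
    exact Finset.sum_le_sum fun i hi =>
      pow_le_pow_of_le_one hq.le hq1.le (Finset.mem_range.1 hi).le
  nlinarith

lemma LL'_bound {q : ℝ} (hq : 0 < q) (hq1 : q < 1) {p : ℕ} (hp : 0 < p) (t : ℝ) :
    ‖LL' q p t‖ ≤ 3 / (1 - q) := by
  have h1q : 0 < 1 - q := by linarith
  have hqp : q ^ p < 1 := pow_lt_one₀ hq.le hq1 hp.ne'
  have n1 : ‖(-(p * zz q t ^ p * Complex.I)) / (1 - zz q t ^ p)‖ ≤ 1 / (1 - q) := by
    have := norm_one_sub_ge (zz q t ^ p)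
    rw [norm_pow, zz_norm hq.le] at this
    rw [norm_div, norm_neg, norm_mul, norm_mul, norm_pow, zz_norm hq.le, Complex.norm_I, mul_one,
      Complex.norm_natCast]
    rw [div_le_div_iff₀ (by linarith) h1q]
    linarith [pq_bound hq hq1 p]
  have n2 : ‖2 * ((-(zz q t * Complex.I)) / (1 - zz q t))‖ ≤ 2 / (1 - q) := by
    have := norm_one_sub_ge (zz q t)
    rw [zz_norm hq.le] at this
    rw [norm_mul, norm_div, norm_neg, norm_mul, zz_norm hq.le, Complex.norm_I, mul_one]
    simp only [Complex.norm_ofNat]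
    rw [mul_div_assoc', div_le_div_iff₀ (by linarith) h1q]
    nlinarith
  unfold LL'
  calc _ ≤ 1 / (1 - q) + 2 / (1 - q) := (norm_sub_le _ _).trans (add_le_add n1 n2)
    _ = _ := by ring

/-- complex amplitude -/
def GG (q : ℝ) (p : ℕ) (t : ℝ) : ℂ := (1 - zz q t ^ p) / (1 - zz q t) ^ 2

lemma exp_LL {q : ℝ} (hq : 0 < q) (hq1 : q < 1) {p : ℕ} (hp : 0 < p) (t : ℝ) :
    Complex.exp (LL q p t) = GG q p t := by
  unfold LL GG
  rw [Complex.exp_sub, Complex.exp_log (one_sub_ne (zz_pow_norm_lt hq hq1 t hp))]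
  congr 1
  have : (2:ℂ) * Complex.log (1 - zz q t) = (2:ℕ) * Complex.log (1 - zz q t) := by norm_num
  rw [this, Complex.exp_nat_mul, Complex.exp_log (one_sub_ne (zz_norm_lt hq hq1 t))]

lemma GG_norm {q : ℝ} (hq : 0 < q) (hq1 : q < 1) {p : ℕ} (hp : 0 < p) (t : ℝ) :
    Real.exp (LL q p t).re = ‖GG q p t‖ := by
  rw [← exp_LL hq hq1 hp, Complex.norm_exp]

lemma GG_bound {q : ℝ} (hq : 0 < q) (hq1 : q < 1) {p : ℕ} (hp : 0 < p) (t : ℝ) :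
    ‖GG q p t‖ ≤ 2 / (1 - q) ^ (δp p - 1) := by
  have h1q : 0 < 1 - q := by linarith
  have h1 := norm_one_sub_ge (zz q t)
  rw [zz_norm hq.le] at h1
  unfold δp
  split_ifs with h
  · subst h
    have hne := one_sub_ne (zz_norm_lt hq hq1 t)
    have e : GG q 1 t = 1 / (1 - zz q t) := by unfold GG; field_simp
    rw [e, norm_div, norm_one]
    simp only [Nat.reduceSub, pow_one]
    rw [div_le_div_iff₀ (by linarith) h1q]
    linarith
  · unfold GG
    rw [norm_div, norm_pow]
    simp only [Nat.reduceSub]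
    gcongr
    calc _ ≤ ‖(1:ℂ)‖ + ‖zz q t ^ p‖ := norm_sub_le _ _
      _ ≤ 1 + 1 := by
        rw [norm_one]; gcongr; exact (zz_pow_norm_lt hq hq1 t hp).le
      _ = 2 := by norm_num

def aa (q : ℝ) (p : ℕ) (t : ℝ) : ℝ := (LL q p t).re
def aa' (q : ℝ) (p : ℕ) (t : ℝ) : ℝ := (LL' q p t).re
def bb (q : ℝ) (p : ℕ) (γ : ℝ) (t : ℝ) : ℝ := (LL q p t).im + γ
def bb' (q : ℝ) (p : ℕ) (t : ℝ) : ℝ := (LL' q p t).im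

lemma theAP {q : ℝ} (hq : 0 < q) (hq1 : q < 1) {p : ℕ} (hp : 0 < p) (γ : ℝ) {m : ℕ}
    (hm : 6 / (1 - q) ≤ m) :
    AP (aa q p) (bb q p γ) (aa' q p) (bb' q p) (3 / (1 - q)) (2 / (1 - q) ^ (δp p - 1)) m where
  da t := by
    have := Complex.reCLM.hasFDerivAt.comp_hasDerivAt t (LL_deriv hq hq1 hp t)
    exact this
  db t := by
    have := Complex.imCLM.hasFDerivAt.comp_hasDerivAt t (LL_deriv hq hq1 hp t)
    exact HasDerivAt.add_const γ this
  ca := Complex.continuous_re.comp (LL'_cont hq hq1 hp)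
  cb := Complex.continuous_im.comp (LL'_cont hq hq1 hp)
  pa t := by unfold aa LL; rw [zz_periodic]
  pb t := by unfold bb LL; rw [zz_periodic]
  la t := (Complex.abs_re_le_norm _).trans (LL'_bound hq hq1 hp t)
  lb t := (Complex.abs_im_le_norm _).trans (LL'_bound hq hq1 hp t)
  hM t := by
    unfold aa
    rw [GG_norm hq hq1 hp]
    exact GG_bound hq hq1 hp t
  hm := by
    have h1q : 0 < 1 - q := by linarith
    have : (0:ℝ) < m := lt_of_lt_of_le (by positivity) hm
    exact_mod_cast this
  hΛ := by
    calc 2 * (3 / (1 - q)) = 6 / (1 - q) := by ring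
      _ ≤ m := hm

/-- real coefficients -/
def wl (q : ℝ) (p l : ℕ) : ℝ := (min (l + 1) p : ℕ) * q ^ l

lemma GG_hasSum {q : ℝ} (hq : 0 < q) (hq1 : q < 1) (p : ℕ) (t : ℝ) :
    HasSum (fun l : ℕ => ((min (l + 1) p : ℕ) : ℂ) * zz q t ^ l) (GG q p t) := by
  set z := zz q t
  have hz : ‖z‖ < 1 := zz_norm_lt hq hq1 t
  have hne := one_sub_ne hz
  have h1 : ∀ k : ℕ, HasSum (fun l : ℕ => if k ≤ l then z ^ l else 0) (z ^ k * (1 - z)⁻¹) := by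
    intro k
    have h2 := (hasSum_geometric_of_norm_lt_one hz).mul_left (z ^ k)
    have h3 : Function.Injective (fun j : ℕ => j + k) := fun a b h => by simpa using h
    rw [← h3.hasSum_iff]
    · have e : ((fun l : ℕ => if k ≤ l then z ^ l else 0) ∘ fun j : ℕ => j + k) =
          fun i => z ^ k * z ^ i := by
        funext j; simp [pow_add, mul_comm]
      rw [e]; exact h2
    · intro x hx
      rw [if_neg]
      intro hkx
      exact hx ⟨x - k, by simp; omega⟩
  have h4 := hasSum_sum (s := Finset.range p) (fun k _ => h1 k)
  convert h4 using 1
  · funext l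
    rw [← Finset.sum_filter, Finset.sum_const, nsmul_eq_mul]
    congr 2
    have : (Finset.range p).filter (fun k => k ≤ l) = Finset.range (min (l + 1) p) := by
      ext k; simp; omega
    rw [this, Finset.card_range]
  · rw [← Finset.sum_mul]
    have := geom_sum_mul_neg z p
    have e : GG q p t = (1 - z ^ p) / (1 - z) ^ 2 := rfl
    rw [e, ← this]
    field_simp

lemma S_hasSum {q : ℝ} (hq : 0 < q) (hq1 : q < 1) {p : ℕ} (hp : 0 < p) (γ : ℝ) (m : ℕ) (t : ℝ) :
    HasSum (fun l : ℕ => wl q p l * sin ((m + l : ℕ) * t + γ))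
      (exp (aa q p t) * sin (m * t + bb q p γ t)) := by
  have h1 := (GG_hasSum hq hq1 p t).mul_left (Complex.exp ((m * t + γ : ℝ) * Complex.I))
  have h2 := Complex.imCLM.hasSum h1
  convert h2 using 1
  · funext l
    simp only [Complex.imCLM_apply]
    have : Complex.exp ((m * t + γ : ℝ) * Complex.I) * (((min (l + 1) p : ℕ) : ℂ) * zz q t ^ l) =
        (wl q p l : ℂ) * Complex.exp ((((m + l : ℕ) * t + γ : ℝ) : ℂ) * Complex.I) := by
      unfold wl zz
      rw [mul_pow, ← Complex.exp_nat_mul]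
      have e : (((m + l : ℕ) * t + γ : ℝ) : ℂ) * Complex.I =
        ((m * t + γ : ℝ) : ℂ) * Complex.I + l * (t * Complex.I) := by push_cast; ring
      rw [e, Complex.exp_add, Complex.ofReal_mul, Complex.ofReal_natCast, Complex.ofReal_pow]
      ring
    rw [this, Complex.im_ofReal_mul, Complex.exp_ofReal_mul_I_im]
  · simp only [Complex.imCLM_apply]
    rw [← exp_LL hq hq1 hp, ← Complex.exp_add, Complex.exp_im]
    simp [aa, bb]
    congr 1; ring

lemma wl_nonneg {q : ℝ} (hq : 0 < q) (p l : ℕ) : 0 ≤ wl q p l := by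
  unfold wl; positivity

lemma wl_le {q : ℝ} (hq : 0 < q) (p l : ℕ) : wl q p l ≤ (l + 1) * q ^ l := by
  unfold wl
  gcongr
  have : min (l + 1) p ≤ l + 1 := min_le_left _ _
  exact_mod_cast this

lemma wl_summable_mul {q : ℝ} (hq : 0 < q) (hq1 : q < 1) (p m : ℕ) :
    Summable (fun l : ℕ => wl q p l * ((m + l : ℕ) : ℝ)) := by
  have hn : ‖q‖ < 1 := by rw [Real.norm_eq_abs, abs_of_pos hq]; exact hq1
  have h0 := summable_pow_mul_geometric_of_norm_lt_one 0 hn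
  have h1 := summable_pow_mul_geometric_of_norm_lt_one 1 hn
  have h2 := summable_pow_mul_geometric_of_norm_lt_one 2 hn
  refine Summable.of_nonneg_of_le (fun l => mul_nonneg (wl_nonneg hq p l) (by positivity))
    (fun l => mul_le_mul_of_nonneg_right (wl_le hq p l) (by positivity)) ?_
  refine ((h2.add (h1.mul_left (m + 1 : ℝ))).add (h0.mul_left (m : ℝ))).congr ?_
  intro l
  push_cast
  ring

lemma wl_summable {q : ℝ} (hq : 0 < q) (hq1 : q < 1) (p : ℕ) :
    Summable (fun l : ℕ => wl q p l) := by
  refine Summable.of_nonneg_of_le (fun l => wl_nonneg hq p l) ?_ (wl_summable_mul hq hq1 p 1)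
  intro l
  have h := wl_nonneg hq p l
  have : (1:ℝ) ≤ ((1 + l : ℕ) : ℝ) := by push_cast; linarith [Nat.cast_nonneg (α := ℝ) l]
  nlinarith

lemma wl_moment {q : ℝ} (hq : 0 < q) (hq1 : q < 1) {p : ℕ} (hp : 0 < p) :
    Summable (fun l : ℕ => wl q p l * (l : ℝ)) ∧
      ∑' l : ℕ, wl q p l * (l : ℝ) ≤ 2 / (1 - q) ^ δp p := by
  have hn : ‖q‖ < 1 := by rw [Real.norm_eq_abs, abs_of_pos hq]; exact hq1
  have hs : Summable (fun l : ℕ => wl q p l * (l : ℝ)) := by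
    simpa using wl_summable_mul hq hq1 p 0
  refine ⟨hs, ?_⟩
  have h1q : 0 < 1 - q := by linarith
  by_cases h1 : p = 1
  · have hd : δp p = 2 := by simp [δp, h1]
    rw [hd]
    have h2 := hasSum_choose_mul_geometric_of_norm_lt_one 1 hn
    calc ∑' l : ℕ, wl q p l * (l : ℝ) ≤ 1 / (1 - q) ^ (1 + 1) := by
          refine hasSum_le (fun l => ?_) hs.hasSum h2
          subst h1
          simp only [wl, Nat.choose_one_right]
          have : min (l + 1) 1 = 1 := by omega
          rw [this]
          push_cast
          have : 0 ≤ q ^ l := by positivity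
          nlinarith
      _ ≤ _ := by gcongr; norm_num
  · have hd : δp p = 3 := by simp [δp, h1]
    rw [hd]
    have h2 := (hasSum_choose_mul_geometric_of_norm_lt_one 2 hn).mul_left 2
    calc ∑' l : ℕ, wl q p l * (l : ℝ) ≤ 2 * (1 / (1 - q) ^ (2 + 1)) := by
          refine hasSum_le (fun l => ?_) hs.hasSum h2
          have h3 : (((l + 2).choose 2 : ℕ) : ℝ) = (l + 2) * (l + 1) / 2 := by
            rw [Nat.cast_choose_two]; push_cast; ring
          rw [h3]
          have h4 := mul_le_mul_of_nonneg_right (wl_le hq p l) (Nat.cast_nonneg (α := ℝ) l)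
          refine h4.trans ?_
          have : 0 ≤ q ^ l := by positivity
          have h5 : (0:ℝ) ≤ l := Nat.cast_nonneg l
          have : 0 ≤ (l:ℝ) * q ^ l := by positivity
          nlinarith
      _ = _ := by ring

/-- exchanging sum and integral -/
lemma swap_sum {φ : ℝ → ℝ} (hφ : Continuous φ) {w : ℕ → ℝ} (hw : Summable fun l => |w l|)
    {g : ℕ → ℝ → ℝ} (hg : ∀ l, Continuous (g l)) (hg1 : ∀ l t, |g l t| ≤ 1) :
    HasSum (fun l => w l * ∫ t in (0:ℝ)..(2 * π), φ t * g l t)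
      (∫ t in (0:ℝ)..(2 * π), φ t * ∑' l, w l * g l t) := by
  have h := intervalIntegral.hasSum_integral_of_dominated_convergence
    (μ := volume) (a := 0) (b := 2 * π) (F := fun l t => φ t * (w l * g l t))
    (f := fun t => φ t * ∑' l, w l * g l t)
    (fun l t => |φ t| * |w l|) ?_ ?_ ?_ ?_ ?_
  · have e : (fun l => w l * ∫ t in (0:ℝ)..(2 * π), φ t * g l t) =
        fun l => ∫ t in (0:ℝ)..(2 * π), φ t * (w l * g l t) := by
      funext l
      rw [← intervalIntegral.integral_const_mul]
      congr 1
      funext t; ring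
    rw [e]; exact h
  · intro l
    have := hg l
    exact (by fun_prop : Continuous fun t => φ t * (w l * g l t)).aestronglyMeasurable
  · intro l
    refine Filter.Eventually.of_forall fun t _ => ?_
    rw [Real.norm_eq_abs, abs_mul, abs_mul]
    have := hg1 l t
    gcongr
    exact mul_le_of_le_one_right (abs_nonneg _) this
  · exact Filter.Eventually.of_forall fun t _ => hw.mul_left _
  · have : (fun t => ∑' l, |φ t| * |w l|) = fun t => |φ t| * ∑' l, |w l| := by
      funext t; rw [tsum_mul_left]
    rw [this]
    exact (by fun_prop : Continuous fun t => |φ t| * ∑' l, |w l|).intervalIntegrable _ _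
  · refine Filter.Eventually.of_forall fun t _ => ?_
    refine (Summable.hasSum ?_).mul_left _
    refine Summable.of_norm_bounded hw fun l => ?_
    rw [Real.norm_eq_abs, abs_mul]
    exact mul_le_of_le_one_right (abs_nonneg _) (hg1 l t)

lemma Sder_tsum {q : ℝ} (hq : 0 < q) (hq1 : q < 1) {p : ℕ} (hp : 0 < p) (γ : ℝ) {m : ℕ}
    (hm : 6 / (1 - q) ≤ m) (t : ℝ) :
    Sder (aa q p) (bb q p γ) (aa' q p) (bb' q p) m t =
      ∑' l : ℕ, (wl q p l * ((m + l : ℕ) : ℝ)) * cos ((m + l : ℕ) * t + γ) := by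
  have hA := theAP hq hq1 hp γ hm
  have h1 : HasDerivAt (fun t => exp (aa q p t) * sin (m * t + bb q p γ t))
      (Sder (aa q p) (bb q p γ) (aa' q p) (bb' q p) m t) t := by
    refine (((hA.da t).exp).mul ((hA.dth t).sin)).congr_deriv ?_
    unfold Sder; ring
  have h2 := hasDerivAt_tsum (𝕜 := ℝ) (F := ℝ)
    (g := fun l t => wl q p l * sin ((m + l : ℕ) * t + γ))
    (g' := fun l t => (wl q p l * ((m + l : ℕ) : ℝ)) * cos ((m + l : ℕ) * t + γ)) (y₀ := 0)
    (wl_summable_mul hq hq1 p m) ?_ ?_ (S_hasSum hq hq1 hp γ m 0).summable t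
  · have e : (fun z => ∑' l : ℕ, wl q p l * sin ((m + l : ℕ) * z + γ)) =
      fun t => exp (aa q p t) * sin (m * t + bb q p γ t) := by
      funext z; exact (S_hasSum hq hq1 hp γ m z).tsum_eq
    rw [e] at h2
    exact h1.unique h2
  · intro l y
    have h3 : HasDerivAt (fun y : ℝ => ((m + l : ℕ) : ℝ) * y + γ) ((m + l : ℕ) : ℝ) y := by
      simpa using ((hasDerivAt_id y).const_mul ((m + l : ℕ) : ℝ)).add_const γ
    refine (h3.sin.const_mul _).congr_deriv ?_
    ring
  · intro l y
    rw [Real.norm_eq_abs, abs_mul, abs_of_nonneg (mul_nonneg (wl_nonneg hq p l) (by positivity))]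
    exact mul_le_of_le_one_right (mul_nonneg (wl_nonneg hq p l) (by positivity)) (abs_cos_le_one _)

/-- Fourier type coefficient -/
def cc (φ : ℝ → ℝ) (γ : ℝ) (k : ℕ) : ℝ := ∫ t in (0:ℝ)..(2 * π), φ t * cos (k * t + γ)

lemma cos_nat_per (k : ℕ) (γ t : ℝ) : cos (k * (t + 2 * π) + γ) = cos (k * t + γ) := by
  have : (k:ℝ) * (t + 2 * π) + γ = k * t + γ + k * (2 * π) := by ring
  rw [this, cos_add_nat_mul_two_pi]

lemma per_shift {f : ℝ → ℝ} (hf : ∀ x, f (x + 2 * π) = f x) (s : ℝ) :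
    ∫ t in (0:ℝ)..(2 * π), f (t + s) = ∫ t in (0:ℝ)..(2 * π), f t := by
  rw [intervalIntegral.integral_comp_add_right]
  have := Function.Periodic.intervalIntegral_add_eq (f := f) (T := 2 * π) hf s 0
  rw [zero_add] at this ⊢
  rw [← this, add_comm]

lemma cc_bound {ω φ : ℝ → ℝ} (hω : IsConcaveModulus ω) (hφ : φ ∈ Hclass ω) (γ : ℝ) {m k : ℕ}
    (hm : 0 < m) (hk : m ≤ k) : |cc φ γ k| ≤ 16 * ω (1 / (m:ℝ)) := by
  have hk0 : (0:ℝ) < k := by exact_mod_cast lt_of_lt_of_le hm hk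
  have hm0 : (0:ℝ) < m := by exact_mod_cast hm
  have hmk : (m:ℝ) ≤ k := by exact_mod_cast hk
  obtain ⟨hc, hper, hmod⟩ := hφ
  have h1 : cc φ γ k = ∫ t in (0:ℝ)..(2 * π), -(φ (t + π / k) * cos (k * t + γ)) := by
    unfold cc
    rw [← per_shift (f := fun t => φ t * cos (k * t + γ)) (by
      intro x; rw [hper, cos_nat_per]) (π / k)]
    congr 1
    funext t
    have : (k:ℝ) * (t + π / k) + γ = k * t + γ + π := by field_simp; ring
    rw [this, cos_add_pi]; ring
  have h2 : 2 * cc φ γ k = ∫ t in (0:ℝ)..(2 * π), (φ t - φ (t + π / k)) * cos (k * t + γ) := by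
    have e : 2 * cc φ γ k = cc φ γ k + ∫ t in (0:ℝ)..(2 * π), -(φ (t + π / k) * cos (k * t + γ)) := by
      rw [← h1]; ring
    rw [e]
    unfold cc
    rw [← intervalIntegral.integral_add]
    · congr 1; funext t; ring
    · exact Continuous.intervalIntegrable (by fun_prop) _ _
    · exact Continuous.intervalIntegrable (by fun_prop) _ _
  have h3 : ‖∫ t in (0:ℝ)..(2 * π), (φ t - φ (t + π / k)) * cos (k * t + γ)‖ ≤
      (4 * ω (1 / (m:ℝ))) * |2 * π - 0| := by
    refine intervalIntegral.norm_integral_le_of_norm_le_const fun t _ => ?_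
    rw [Real.norm_eq_abs, abs_mul]
    have h4 : |φ t - φ (t + π / k)| ≤ 4 * ω (1 / (m:ℝ)) := by
      refine (hmod _ _).trans ?_
      refine cm_pi hω hm0 (abs_nonneg _) ?_
      have : |t - (t + π / k)| = π / k := by
        rw [show t - (t + π / k) = -(π / k) by ring, abs_neg, abs_of_pos (by positivity)]
      rw [this]
      have := pi_le_four
      gcongr
    exact (mul_le_of_le_one_right (abs_nonneg _) (abs_cos_le_one _)).trans h4
  rw [← h2, Real.norm_eq_abs, abs_mul, sub_zero, abs_of_pos (by positivity : 0 < 2 * π)] at h3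
  rw [abs_of_pos (by norm_num : (0:ℝ) < 2)] at h3
  have h5 : 0 ≤ ω (1 / (m:ℝ)) := cm_nonneg hω (by positivity)
  have := pi_le_four
  nlinarith

/-- the functional -/
def TT (q : ℝ) (p m : ℕ) (γ : ℝ) (φ : ℝ → ℝ) : ℝ := ∑' l : ℕ, wl q p l * cc φ γ (m + l)

lemma TT_main {q : ℝ} (hq : 0 < q) (hq1 : q < 1) {p : ℕ} (hp : 0 < p) (γ : ℝ) {m : ℕ}
    (hm : 6 / (1 - q) ≤ m) {ω φ : ℝ → ℝ} (hω : IsConcaveModulus ω) (hφ : φ ∈ Hclass ω) :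
    |m * TT q p m γ φ - ∫ t in (0:ℝ)..(2 * π), φ t * Sder (aa q p) (bb q p γ) (aa' q p) (bb' q p) m t|
      ≤ 32 * ω (1 / (m:ℝ)) / (1 - q) ^ δp p := by
  have hA := theAP hq hq1 hp γ hm
  have hs1 := swap_sum (φ := φ) hφ.1 (w := fun l => wl q p l * ((m + l : ℕ) : ℝ))
    (by
      refine (wl_summable_mul hq hq1 p m).congr fun l => ?_
      rw [abs_of_nonneg (mul_nonneg (wl_nonneg hq p l) (by positivity))])
    (g := fun l t => cos ((m + l : ℕ) * t + γ)) (fun l => by fun_prop)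
    (fun l t => abs_cos_le_one _)
  have e1 : ∀ t, ∑' l : ℕ, (wl q p l * ((m + l : ℕ) : ℝ)) * cos ((m + l : ℕ) * t + γ) =
    Sder (aa q p) (bb q p γ) (aa' q p) (bb' q p) m t := fun t => (Sder_tsum hq hq1 hp γ hm t).symm
  simp only [e1] at hs1
  have hcb : ∀ l, |cc φ γ (m + l)| ≤ 16 * ω (1 / (m:ℝ)) :=
    fun l => cc_bound hω hφ γ hA.hm (by omega)
  have hs2 : Summable (fun l => wl q p l * cc φ γ (m + l)) := by
    refine Summable.of_norm_bounded ((wl_summable hq hq1 p).mul_right (16 * ω (1 / (m:ℝ)))) fun l => ?_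
    rw [Real.norm_eq_abs, abs_mul, abs_of_nonneg (wl_nonneg hq p l)]
    exact mul_le_mul_of_nonneg_left (hcb l) (wl_nonneg hq p l)
  have hs3 := (hs2.hasSum.mul_left (m:ℝ)).sub hs1
  obtain ⟨hw1, hw2⟩ := wl_moment hq hq1 hp
  have h4 : ‖∑' l : ℕ, ((m:ℝ) * (wl q p l * cc φ γ (m + l)) -
      wl q p l * ((m + l : ℕ) : ℝ) * ∫ t in (0:ℝ)..(2 * π), φ t * cos ((m + l : ℕ) * t + γ))‖ ≤
      (∑' l : ℕ, wl q p l * (l : ℝ)) * (16 * ω (1 / (m:ℝ))) := by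
    refine tsum_of_norm_bounded (hw1.hasSum.mul_right _) fun l => ?_
    have e : (m:ℝ) * (wl q p l * cc φ γ (m + l)) -
      wl q p l * ((m + l : ℕ) : ℝ) * (∫ t in (0:ℝ)..(2 * π), φ t * cos ((m + l : ℕ) * t + γ)) =
      - ((wl q p l * l) * cc φ γ (m + l)) := by
      unfold cc; push_cast; ring
    rw [e, norm_neg, Real.norm_eq_abs, abs_mul,
      abs_of_nonneg (mul_nonneg (wl_nonneg hq p l) (Nat.cast_nonneg l))]
    exact mul_le_mul_of_nonneg_left (hcb l) (mul_nonneg (wl_nonneg hq p l) (Nat.cast_nonneg l))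
  rw [hs3.tsum_eq, Real.norm_eq_abs] at h4
  have h5 : 0 ≤ ω (1 / (m:ℝ)) := cm_nonneg hω (by positivity)
  calc _ ≤ _ := h4
    _ ≤ (2 / (1 - q) ^ δp p) * (16 * ω (1 / (m:ℝ))) := by gcongr
    _ = _ := by ring

/-- integral of the amplitude -/
def KK (q : ℝ) (p : ℕ) : ℝ := ∫ t in (0:ℝ)..(2 * π), exp (aa q p t)

lemma errMΛ {q : ℝ} (hq1 : q < 1) (p : ℕ) :
    (2 / (1 - q) ^ (δp p - 1)) * (3 / (1 - q)) = 6 / (1 - q) ^ δp p := by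
  have h1q : 0 < 1 - q := by linarith
  have : δp p = (δp p - 1) + 1 := by unfold δp; split_ifs <;> rfl
  rw [this, pow_succ, Nat.add_sub_cancel]
  field_simp; norm_num

lemma TT_upper {q : ℝ} (hq : 0 < q) (hq1 : q < 1) {p : ℕ} (hp : 0 < p) (γ : ℝ) {m : ℕ}
    (hm : 6 / (1 - q) ≤ m) {ω φ : ℝ → ℝ} (hω : IsConcaveModulus ω) (hφ : φ ∈ Hclass ω) :
    |TT q p m γ φ| ≤ 1 / π * eInt m ω * KK q p +
      5000 * ω (1 / (m:ℝ)) / ((1 - q) ^ δp p * m) := by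
  have hA := theAP hq hq1 hp γ hm
  have hm0 := hA.m0
  have h1q : 0 < 1 - q := by linarith
  have h5 : 0 ≤ ω (1 / (m:ℝ)) := cm_nonneg hω (by positivity)
  have h1 := TT_main hq hq1 hp γ hm hω hφ
  have h2 := hA.upper hω hφ
  rw [errMΛ hq1] at h2
  change _ ≤ m / π * eInt m ω * KK q p + _ at h2
  have h3 : |m * TT q p m γ φ| ≤ m / π * eInt m ω * KK q p + 5000 * ω (1 / (m:ℝ)) / (1 - q) ^ δp p := by
    have h4 := abs_sub_abs_le_abs_sub (m * TT q p m γ φ)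
      (∫ t in (0:ℝ)..(2 * π), φ t * Sder (aa q p) (bb q p γ) (aa' q p) (bb' q p) m t)
    have h6 : 0 ≤ ω (1 / (m:ℝ)) / (1 - q) ^ δp p := by positivity
    have e1 : 704 * (ω (1 / (m:ℝ)) * (6 / (1 - q) ^ δp p)) = 4224 * (ω (1 / (m:ℝ)) / (1 - q) ^ δp p) := by
      ring
    rw [e1] at h2
    rw [mul_div_assoc] at h1 ⊢
    linarith
  rw [abs_mul, abs_of_pos hm0] at h3
  rw [← mul_le_mul_iff_right₀ hm0]
  refine h3.trans (le_of_eq ?_)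
  field_simp

lemma TT_lower {q : ℝ} (hq : 0 < q) (hq1 : q < 1) {p : ℕ} (hp : 0 < p) (γ : ℝ) {m : ℕ}
    (hm : 6 / (1 - q) ≤ m) {ω : ℝ → ℝ} (hω : IsConcaveModulus ω) :
    ∃ φ ∈ Hclass ω, 1 / π * eInt m ω * KK q p -
      5000 * ω (1 / (m:ℝ)) / ((1 - q) ^ δp p * m) ≤ TT q p m γ φ := by
  have hA := theAP hq hq1 hp γ hm
  have hm0 := hA.m0
  have h1q : 0 < 1 - q := by linarith
  have h5 : 0 ≤ ω (1 / (m:ℝ)) := cm_nonneg hω (by positivity)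
  obtain ⟨φ, hφ, h2⟩ := hA.lower hω
  refine ⟨φ, hφ, ?_⟩
  have h1 := TT_main hq hq1 hp γ hm hω hφ
  rw [errMΛ hq1] at h2
  change m / π * eInt m ω * KK q p - _ ≤ _ at h2
  have h3 : m / π * eInt m ω * KK q p - 5000 * ω (1 / (m:ℝ)) / (1 - q) ^ δp p ≤ m * TT q p m γ φ := by
    have h4 := (abs_le.1 h1).1
    have h6 : 0 ≤ ω (1 / (m:ℝ)) / (1 - q) ^ δp p := by positivity
    have e1 : 704 * (ω (1 / (m:ℝ)) * (6 / (1 - q) ^ δp p)) = 4224 * (ω (1 / (m:ℝ)) / (1 - q) ^ δp p) := by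
      ring
    rw [e1] at h2
    rw [mul_div_assoc] at h4 ⊢
    linarith
  rw [← mul_le_mul_iff_right₀ hm0]
  refine le_trans (le_of_eq ?_) h3
  field_simp

lemma int_cos_zero {d : ℤ} (hd : d ≠ 0) : ∫ t in (0:ℝ)..(2 * π), cos (d * t) = 0 := by
  have hd' : (d:ℝ) ≠ 0 := by exact_mod_cast hd
  rw [intervalIntegral.integral_comp_mul_left _ hd', integral_cos]
  have : sin ((d:ℝ) * (2 * π)) = 0 := by
    have := sin_int_mul_pi (2 * d)
    rw [← this]; push_cast; ring_nf
  simp [this]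

lemma int_sin_zero (d : ℤ) : ∫ t in (0:ℝ)..(2 * π), sin (d * t) = 0 := by
  by_cases hd : d = 0
  · simp [hd]
  have hd' : (d:ℝ) ≠ 0 := by exact_mod_cast hd
  rw [intervalIntegral.integral_comp_mul_left _ hd', integral_sin]
  have : cos ((d:ℝ) * (2 * π)) = 1 := cos_int_mul_two_pi d
  simp [this]

lemma orth_cc (j l : ℕ) : ∫ t in (0:ℝ)..(2 * π), cos (j * t) * cos ((l + 1 : ℕ) * t) =
    if j = l + 1 then π else 0 := by
  have e : ∀ t : ℝ, cos (j * t) * cos ((l + 1 : ℕ) * t) =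
      (1/2) * cos (((j - (l + 1) : ℤ) : ℝ) * t) + (1/2) * cos (((j + (l + 1) : ℤ) : ℝ) * t) := by
    intro t
    push_cast
    rw [sub_mul, add_mul (j:ℝ), cos_sub, cos_add]; ring
  simp only [e]
  rw [intervalIntegral.integral_add (Continuous.intervalIntegrable (by fun_prop) _ _)
    (Continuous.intervalIntegrable (by fun_prop) _ _), intervalIntegral.integral_const_mul,
    intervalIntegral.integral_const_mul, int_cos_zero (d := j + (l + 1)) (by omega)]
  split_ifs with h
  · subst h; simp
  · rw [int_cos_zero (by omega)]; simp

lemma orth_ss (j l : ℕ) : ∫ t in (0:ℝ)..(2 * π), sin (j * t) * sin ((l + 1 : ℕ) * t) =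
    if j = l + 1 then π else 0 := by
  have e : ∀ t : ℝ, sin (j * t) * sin ((l + 1 : ℕ) * t) =
      (1/2) * cos (((j - (l + 1) : ℤ) : ℝ) * t) - (1/2) * cos (((j + (l + 1) : ℤ) : ℝ) * t) := by
    intro t
    push_cast
    rw [sub_mul, add_mul (j:ℝ), cos_sub, cos_add]; ring
  simp only [e]
  rw [intervalIntegral.integral_sub (Continuous.intervalIntegrable (by fun_prop) _ _)
    (Continuous.intervalIntegrable (by fun_prop) _ _), intervalIntegral.integral_const_mul,
    intervalIntegral.integral_const_mul, int_cos_zero (d := j + (l + 1)) (by omega)]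
  split_ifs with h
  · subst h; simp
  · rw [int_cos_zero (by omega)]; simp

lemma orth_sc (j l : ℕ) : ∫ t in (0:ℝ)..(2 * π), sin (j * t) * cos (l * t) = 0 := by
  have e : ∀ t : ℝ, sin (j * t) * cos (l * t) =
      (1/2) * sin (((j - l : ℤ) : ℝ) * t) + (1/2) * sin (((j + l : ℤ) : ℝ) * t) := by
    intro t
    push_cast
    rw [sub_mul, add_mul (j:ℝ), sin_sub, sin_add]; ring
  simp only [e]
  rw [intervalIntegral.integral_add (Continuous.intervalIntegrable (by fun_prop) _ _)
    (Continuous.intervalIntegrable (by fun_prop) _ _), intervalIntegral.integral_const_mul,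
    intervalIntegral.integral_const_mul, int_sin_zero, int_sin_zero]
  simp

lemma orth_cs (j l : ℕ) : ∫ t in (0:ℝ)..(2 * π), cos (j * t) * sin (l * t) = 0 := by
  have h := orth_sc l j
  simp only [mul_comm (sin _)] at h
  exact h

/-- trigonometric series with absolutely summable coefficients -/
def FA (a : ℕ → ℝ) (t : ℝ) : ℝ := ∑' l : ℕ, a l * cos ((l + 1 : ℕ) * t)
def FB (b : ℕ → ℝ) (t : ℝ) : ℝ := ∑' l : ℕ, b l * sin ((l + 1 : ℕ) * t)

lemma FA_cont {a : ℕ → ℝ} (ha : Summable fun l => |a l|) : Continuous (FA a) := by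
  refine continuous_tsum (fun l => by fun_prop) ha fun l t => ?_
  rw [Real.norm_eq_abs, abs_mul]
  exact mul_le_of_le_one_right (abs_nonneg _) (abs_cos_le_one _)

lemma FB_cont {a : ℕ → ℝ} (ha : Summable fun l => |a l|) : Continuous (FB a) := by
  refine continuous_tsum (fun l => by fun_prop) ha fun l t => ?_
  rw [Real.norm_eq_abs, abs_mul]
  exact mul_le_of_le_one_right (abs_nonneg _) (abs_sin_le_one _)

lemma int_cA {a : ℕ → ℝ} (ha : Summable fun l => |a l|) (j : ℕ) :
    ∫ t in (0:ℝ)..(2 * π), cos ((j + 1 : ℕ) * t) * FA a t = π * a j := by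
  have h := swap_sum (φ := fun t => cos ((j + 1 : ℕ) * t)) (by fun_prop) ha
    (g := fun l t => cos ((l + 1 : ℕ) * t)) (fun l => by fun_prop) (fun l t => abs_cos_le_one _)
  simp only [orth_cc] at h
  unfold FA
  rw [← h.tsum_eq, tsum_eq_single j]
  · simp [mul_comm]
  · intro l hl
    rw [if_neg (by omega), mul_zero]

lemma int_cA0 {a : ℕ → ℝ} (ha : Summable fun l => |a l|) :
    ∫ t in (0:ℝ)..(2 * π), cos ((0 : ℕ) * t) * FA a t = 0 := by
  have h := swap_sum (φ := fun t => cos ((0 : ℕ) * t)) (by fun_prop) ha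
    (g := fun l t => cos ((l + 1 : ℕ) * t)) (fun l => by fun_prop) (fun l t => abs_cos_le_one _)
  simp only [orth_cc] at h
  unfold FA
  rw [← h.tsum_eq]
  simp

lemma int_sB {a : ℕ → ℝ} (ha : Summable fun l => |a l|) (j : ℕ) :
    ∫ t in (0:ℝ)..(2 * π), sin ((j + 1 : ℕ) * t) * FB a t = π * a j := by
  have h := swap_sum (φ := fun t => sin ((j + 1 : ℕ) * t)) (by fun_prop) ha
    (g := fun l t => sin ((l + 1 : ℕ) * t)) (fun l => by fun_prop) (fun l t => abs_sin_le_one _)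
  simp only [orth_ss] at h
  unfold FB
  rw [← h.tsum_eq, tsum_eq_single j]
  · simp [mul_comm]
  · intro l hl
    rw [if_neg (by omega), mul_zero]

lemma int_sA {a : ℕ → ℝ} (ha : Summable fun l => |a l|) (j : ℕ) :
    ∫ t in (0:ℝ)..(2 * π), sin (j * t) * FA a t = 0 := by
  have h := swap_sum (φ := fun t => sin (j * t)) (by fun_prop) ha
    (g := fun l t => cos ((l + 1 : ℕ) * t)) (fun l => by fun_prop) (fun l t => abs_cos_le_one _)
  simp only [orth_sc] at h
  unfold FA
  rw [← h.tsum_eq]; simp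

lemma int_cB {a : ℕ → ℝ} (ha : Summable fun l => |a l|) (j : ℕ) :
    ∫ t in (0:ℝ)..(2 * π), cos (j * t) * FB a t = 0 := by
  have h := swap_sum (φ := fun t => cos (j * t)) (by fun_prop) ha
    (g := fun l t => sin ((l + 1 : ℕ) * t)) (fun l => by fun_prop) (fun l t => abs_sin_le_one _)
  simp only [orth_cs] at h
  unfold FB
  rw [← h.tsum_eq]; simp

lemma coef_split {a b : ℕ → ℝ} (ha : Summable fun l => |a l|) (hb : Summable fun l => |b l|)
    (A₀ : ℝ) {g : ℝ → ℝ} (hg : Continuous g) :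
    ∫ t in (0:ℝ)..(2 * π), (A₀ + FA a t + FB b t) * g t =
      A₀ * (∫ t in (0:ℝ)..(2 * π), g t) + (∫ t in (0:ℝ)..(2 * π), g t * FA a t) +
        ∫ t in (0:ℝ)..(2 * π), g t * FB b t := by
  have hA := FA_cont ha
  have hB := FB_cont hb
  rw [← intervalIntegral.integral_const_mul, ← intervalIntegral.integral_add,
    ← intervalIntegral.integral_add]
  · congr 1; funext t; ring
  all_goals exact Continuous.intervalIntegrable (by fun_prop) _ _

lemma coefA_succ {a b : ℕ → ℝ} (ha : Summable fun l => |a l|) (hb : Summable fun l => |b l|)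
    (A₀ : ℝ) (j : ℕ) : coefA (fun t => A₀ + FA a t + FB b t) (j + 1) = a j := by
  unfold coefA
  rw [coef_split ha hb A₀ (by fun_prop), int_cA ha, int_cB hb]
  have : ∫ t in (0:ℝ)..(2 * π), cos ((j + 1 : ℕ) * t) = 0 := by
    have := int_cos_zero (d := j + 1) (by omega)
    push_cast at this ⊢
    exact this
  rw [this]
  field_simp; ring

lemma coefA_zero {a b : ℕ → ℝ} (ha : Summable fun l => |a l|) (hb : Summable fun l => |b l|)
    (A₀ : ℝ) : coefA (fun t => A₀ + FA a t + FB b t) 0 = 2 * A₀ := by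
  unfold coefA
  rw [coef_split ha hb A₀ (by fun_prop), int_cA0 ha, int_cB hb]
  simp
  field_simp

lemma coefB_succ {a b : ℕ → ℝ} (ha : Summable fun l => |a l|) (hb : Summable fun l => |b l|)
    (A₀ : ℝ) (j : ℕ) : coefB (fun t => A₀ + FA a t + FB b t) (j + 1) = b j := by
  unfold coefB
  rw [coef_split ha hb A₀ (by fun_prop), int_sA ha, int_sB hb]
  have : ∫ t in (0:ℝ)..(2 * π), sin ((j + 1 : ℕ) * t) = 0 := by
    have := int_sin_zero (j + 1)
    push_cast at this ⊢
    exact this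
  rw [this]
  field_simp; ring

lemma Ssum_eq {a b : ℕ → ℝ} (ha : Summable fun l => |a l|) (hb : Summable fun l => |b l|)
    (A₀ : ℝ) (k : ℕ) (x : ℝ) : Ssum (fun t => A₀ + FA a t + FB b t) k x =
      A₀ + ∑ i ∈ Finset.range k, (a i * cos ((i + 1 : ℕ) * x) + b i * sin ((i + 1 : ℕ) * x)) := by
  unfold Ssum
  rw [coefA_zero ha hb]
  congr 1
  · ring
  have h := Finset.sum_Ico_add' (fun j : ℕ =>
    coefA (fun t => A₀ + FA a t + FB b t) j * cos (j * x) +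
    coefB (fun t => A₀ + FA a t + FB b t) j * sin (j * x)) 0 k 1
  have e : Finset.Icc 1 k = Finset.Ico (0 + 1) (k + 1) := by ext j; simp
  rw [e, ← h, Finset.range_eq_Ico]
  refine Finset.sum_congr rfl fun i _ => ?_
  rw [coefA_succ ha hb, coefB_succ ha hb]

lemma tail_sum {u : ℕ → ℝ} (hu : Summable u) (n p : ℕ) (hpn : p < n) (hp : 0 < p) (A₀ : ℝ) :
    (A₀ + ∑' i, u i) - (1 / (p:ℝ)) * ∑ k ∈ Finset.Ico (n - p) n, (A₀ + ∑ i ∈ Finset.range k, u i) =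
      (1 / (p:ℝ)) * ∑' l : ℕ, ((min (l + 1) p : ℕ) : ℝ) * u (n - p + l) := by
  have hp0 : (p:ℝ) ≠ 0 := by exact_mod_cast hp.ne'
  set v : ℕ → ℝ := fun l => u (n - p + l) with hv
  have hvs : Summable v := by
    have := (summable_nat_add_iff (n - p)).2 hu
    refine this.congr fun l => ?_
    rw [hv, add_comm]
  have h1 : ∀ k : ℕ, HasSum (fun l : ℕ => if k ≤ l then v l else 0) (∑' i, v (i + k)) := by
    intro k
    have h2 := ((summable_nat_add_iff k).2 hvs).hasSum
    have h3 : Function.Injective (fun j : ℕ => j + k) := fun a b h => by simpa using h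
    rw [← h3.hasSum_iff]
    · have e : ((fun l : ℕ => if k ≤ l then v l else 0) ∘ fun j : ℕ => j + k) =
          fun i => v (i + k) := by
        funext j; simp
      rw [e]; exact h2
    · intro x hx
      rw [if_neg]
      intro hkx
      exact hx ⟨x - k, by simp; omega⟩
  have h4 := hasSum_sum (s := Finset.range p) (fun k _ => h1 k)
  have e4 : (fun l => ∑ k ∈ Finset.range p, if k ≤ l then v l else 0) =
      fun l : ℕ => ((min (l + 1) p : ℕ) : ℝ) * v l := by
    funext l
    rw [← Finset.sum_filter, Finset.sum_const, nsmul_eq_mul]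
    congr 2
    have : (Finset.range p).filter (fun k => k ≤ l) = Finset.range (min (l + 1) p) := by
      ext k; simp; omega
    rw [this, Finset.card_range]
  rw [e4] at h4
  rw [h4.tsum_eq]
  rw [Finset.sum_Ico_eq_sum_range, show n - (n - p) = p by omega]
  have h5 : ∀ k, A₀ + ∑ i ∈ Finset.range (n - p + k), u i = (A₀ + ∑' i, u i) - ∑' i, v (i + k) := by
    intro k
    rw [← hu.sum_add_tsum_nat_add (n - p + k)]
    have : ∑' i, v (i + k) = ∑' i, u (i + (n - p + k)) := by
      congr 1; funext i; simp only [hv]; congr 1; omega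
    rw [this]; ring
  simp only [h5]
  rw [Finset.sum_sub_distrib, Finset.sum_const, Finset.card_range, nsmul_eq_mul]
  field_simp
  ring

lemma cc_trivial {φ : ℝ → ℝ} {B : ℝ} (hB : ∀ t, |φ t| ≤ B) (g : ℝ → ℝ) (hg : ∀ t, |g t| ≤ 1) :
    |∫ t in (0:ℝ)..(2 * π), φ t * g t| ≤ B * (2 * π) := by
  have h := intervalIntegral.norm_integral_le_of_norm_le_const (a := 0) (b := 2 * π)
    (f := fun t => φ t * g t) (C := B) fun t _ => by
      rw [Real.norm_eq_abs, abs_mul]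
      exact (mul_le_of_le_one_right (abs_nonneg _) (hg t)).trans (hB t)
  rwa [sub_zero, abs_of_pos (by positivity : 0 < 2 * π), Real.norm_eq_abs] at h

lemma Hclass_bdd {ω φ : ℝ → ℝ} (hφ : φ ∈ Hclass ω) : ∃ B, ∀ t, |φ t| ≤ B := by
  obtain ⟨hc, hp, -⟩ := hφ
  have := (Function.Periodic.compact_of_continuous (f := φ) (c := 2 * π) hp
    (by positivity) hc)
  obtain ⟨B, hB⟩ := this.isBounded.exists_norm_le
  exact ⟨B, fun t => hB _ ⟨t, rfl⟩⟩

lemma Hclass_shift {ω φ : ℝ → ℝ} (hφ : φ ∈ Hclass ω) (x : ℝ) :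
    (fun t => φ (x + t)) ∈ Hclass ω := by
  obtain ⟨hc, hp, hm⟩ := hφ
  refine ⟨by fun_prop, fun t => ?_, fun s t => ?_⟩
  · change φ (x + (t + 2 * π)) = φ (x + t)
    rw [← add_assoc, hp]
  · have := hm (x + s) (x + t)
    rwa [show x + s - (x + t) = s - t by ring] at this

def ssn (φ : ℝ → ℝ) (γ : ℝ) (k : ℕ) : ℝ := ∫ t in (0:ℝ)..(2 * π), φ t * sin (k * t + γ)

lemma cc_shift {φ : ℝ → ℝ} (hc : Continuous φ) (hp : ∀ x, φ (x + 2 * π) = φ x) (γ x : ℝ) (k : ℕ) :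
    cc (fun t => φ (x + t)) γ k = cc φ γ k * cos (k * x) + ssn φ γ k * sin (k * x) := by
  unfold cc ssn
  have h := per_shift (f := fun s => φ s * cos (k * (s - x) + γ)) (by
    intro s
    rw [hp, show s + 2 * π - x = (s - x) + 2 * π by ring, cos_nat_per]) x
  have e1 : ∫ t in (0:ℝ)..(2 * π), φ (x + t) * cos (k * t + γ) =
      ∫ t in (0:ℝ)..(2 * π), φ (t + x) * cos (k * (t + x - x) + γ) := by
    congr 1; funext t; rw [add_sub_cancel_right, add_comm]
  rw [e1, h, ← intervalIntegral.integral_mul_const, ← intervalIntegral.integral_mul_const,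
    ← intervalIntegral.integral_add]
  · congr 1; funext t
    rw [show (k:ℝ) * (t - x) + γ = (k * t + γ) - k * x by ring, cos_sub]; ring
  all_goals exact Continuous.intervalIntegrable (by fun_prop) _ _

lemma geom_abs_summable {q : ℝ} (hq : 0 < q) (hq1 : q < 1) {c : ℕ → ℝ} {B : ℝ}
    (hc : ∀ l, |c l| ≤ B) : Summable fun l : ℕ => |q ^ (l + 1) / π * c (l + 1)| := by
  refine Summable.of_nonneg_of_le (fun l => abs_nonneg _) (fun l => ?_)
    ((summable_geometric_of_lt_one hq.le hq1).mul_left (q / π * B))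
  rw [abs_mul, abs_of_nonneg (by positivity)]
  calc q ^ (l + 1) / π * |c (l + 1)| ≤ q ^ (l + 1) / π * B := by gcongr; exact hc _
    _ = _ := by rw [pow_succ]; ring

/-- the deviation formula -/
lemma dev_formula {q β : ℝ} (hq : 0 < q) (hq1 : q < 1) {n p : ℕ} (hpn : p < n) (hp : 0 < p)
    {ω φ : ℝ → ℝ} (hφ : φ ∈ Hclass ω) (A₀ : ℝ) {f : ℝ → ℝ}
    (hf : f = fun x => A₀ + (1 / π) * ∫ t in (0:ℝ)..(2 * π), φ (x + t) * Pker q β t) (x : ℝ) :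
    f x - Vsum n p f x = q ^ (n - p + 1) / (p * π) *
      TT q p (n - p + 1) (β * π / 2) (fun t => φ (x + t)) := by
  set γ := β * π / 2 with hγ
  obtain ⟨B, hB⟩ := Hclass_bdd hφ
  have hA : ∀ l, |cc φ γ l| ≤ B * (2 * π) := fun l => cc_trivial hB _ fun t => abs_cos_le_one _
  have hS : ∀ l, |ssn φ γ l| ≤ B * (2 * π) := fun l => cc_trivial hB _ fun t => abs_sin_le_one _
  set a : ℕ → ℝ := fun l => q ^ (l + 1) / π * cc φ γ (l + 1) with ha
  set b : ℕ → ℝ := fun l => q ^ (l + 1) / π * ssn φ γ (l + 1) with hb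
  have hsa : Summable fun l => |a l| := geom_abs_summable hq hq1 hA
  have hsb : Summable fun l => |b l| := geom_abs_summable hq hq1 hS
  have hu1 : ∀ y, ∀ l, a l * cos ((l + 1 : ℕ) * y) + b l * sin ((l + 1 : ℕ) * y) =
      q ^ (l + 1) / π * cc (fun t => φ (y + t)) γ (l + 1) := by
    intro y l
    rw [cc_shift hφ.1 hφ.2.1, ha, hb]; ring
  have hsa' : ∀ y : ℝ, Summable fun l => a l * cos ((l + 1 : ℕ) * y) := fun y => by
    refine Summable.of_norm_bounded hsa fun l => ?_
    rw [Real.norm_eq_abs, abs_mul]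
    exact mul_le_of_le_one_right (abs_nonneg _) (abs_cos_le_one _)
  have hsb' : ∀ y : ℝ, Summable fun l => b l * sin ((l + 1 : ℕ) * y) := fun y => by
    refine Summable.of_norm_bounded hsb fun l => ?_
    rw [Real.norm_eq_abs, abs_mul]
    exact mul_le_of_le_one_right (abs_nonneg _) (abs_sin_le_one _)
  have hfy : ∀ y, f y = A₀ + ∑' l, (a l * cos ((l + 1 : ℕ) * y) + b l * sin ((l + 1 : ℕ) * y)) := by
    intro y
    have h1 := swap_sum (Hclass_shift hφ y).1 (w := fun l => q ^ (l + 1)) (by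
      have := (summable_geometric_of_lt_one hq.le hq1).mul_left q
      refine this.congr fun l => ?_
      rw [abs_of_pos (by positivity), pow_succ]; ring)
      (g := fun l t => cos ((l + 1 : ℕ) * t + γ)) (fun l => by fun_prop)
      (fun l t => abs_cos_le_one _)
    have h2 : f y = A₀ + (1 / π) * ∫ t in (0:ℝ)..(2 * π), φ (y + t) *
        ∑' l : ℕ, q ^ (l + 1) * cos ((l + 1 : ℕ) * t + γ) := by rw [hf]; rfl
    rw [h2, ← h1.tsum_eq, ← tsum_mul_left]
    congr 2
    funext l
    rw [hu1]
    unfold cc; ring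
  have hff : f = fun t => A₀ + FA a t + FB b t := by
    funext y
    rw [hfy, (hsa' y).tsum_add (hsb' y)]
    unfold FA FB; ring
  have hV : Vsum n p f x = (1 / (p:ℝ)) * ∑ k ∈ Finset.Ico (n - p) n, (A₀ + ∑ i ∈ Finset.range k,
      (a i * cos ((i + 1 : ℕ) * x) + b i * sin ((i + 1 : ℕ) * x))) := by
    unfold Vsum
    congr 1
    refine Finset.sum_congr rfl fun k _ => ?_
    rw [hff, Ssum_eq hsa hsb]
  rw [hV, hfy, tail_sum ((hsa' x).add (hsb' x)) n p hpn hp A₀]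
  unfold TT
  rw [← tsum_mul_left, ← tsum_mul_left]
  congr 1
  funext l
  rw [hu1, show n - p + l + 1 = n - p + 1 + l by ring, pow_add]
  unfold wl
  field_simp

def DD (r u : ℝ) : ℝ := 1 - 2 * r * cos u + r ^ 2

lemma DD_eq (r u : ℝ) : DD r u = (1 - r * cos u) ^ 2 + (r * sin u) ^ 2 := by
  unfold DD
  have := sin_sq_add_cos_sq u
  linear_combination (-r ^ 2) * this

lemma one_sub_rcos_pos {r : ℝ} (h0 : 0 < r) (h1 : r < 1) (u : ℝ) : 0 < 1 - r * cos u := by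
  have := cos_le_one u
  nlinarith

lemma DD_pos {r : ℝ} (h0 : 0 < r) (h1 : r < 1) (u : ℝ) : 0 < DD r u := by
  have := one_sub_rcos_pos h0 h1 u
  rw [DD_eq]; positivity

lemma norm_one_sub_zz (r u : ℝ) : ‖1 - zz r u‖ = √(DD r u) := by
  have h : ‖1 - zz r u‖ ^ 2 = DD r u := by
    rw [Complex.sq_norm, Complex.normSq_apply]
    have := sin_sq_add_cos_sq u
    simp [zz, Complex.exp_ofReal_mul_I_re, Complex.exp_ofReal_mul_I_im, DD]
    linear_combination (r ^ 2) * this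
  rw [← h, Real.sqrt_sq (norm_nonneg _)]

/-- Landen substitution -/
def sub1 (r t : ℝ) : ℝ := t + arctan (r * sin t / (1 - r * cos t))

lemma sub1_deriv {r : ℝ} (h0 : 0 < r) (h1 : r < 1) (t : ℝ) :
    HasDerivAt (sub1 r) ((1 - r * cos t) / DD r t) t := by
  have hp := one_sub_rcos_pos h0 h1 t
  have hD := DD_pos h0 h1 t
  have h2 : HasDerivAt (fun t => r * sin t / (1 - r * cos t))
      ((r * cos t * (1 - r * cos t) - r * sin t * (r * sin t)) / (1 - r * cos t) ^ 2) t := by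
    have h3 := (hasDerivAt_sin t).const_mul r
    have h4 := ((hasDerivAt_cos t).const_mul r).const_sub 1
    exact (h3.div h4 hp.ne').congr_deriv (by ring)
  refine ((hasDerivAt_id t).add h2.arctan).congr_deriv ?_
  have e : 1 + (r * sin t / (1 - r * cos t)) ^ 2 = DD r t / (1 - r * cos t) ^ 2 := by
    rw [DD_eq]; field_simp
  rw [e]
  have hs := sin_sq_add_cos_sq t
  field_simp
  unfold DD
  linear_combination (-r ^ 2) * hs

lemma sub1_sin {r : ℝ} (h0 : 0 < r) (h1 : r < 1) (t : ℝ) :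
    sin (sub1 r t) = sin t / √(DD r t) := by
  have hp := one_sub_rcos_pos h0 h1 t
  have hD := DD_pos h0 h1 t
  have e : 1 + (r * sin t / (1 - r * cos t)) ^ 2 = DD r t / (1 - r * cos t) ^ 2 := by
    rw [DD_eq]; field_simp
  unfold sub1
  rw [sin_add, cos_arctan, sin_arctan, e, Real.sqrt_div hD.le, Real.sqrt_sq hp.le]
  have : 0 < √(DD r t) := Real.sqrt_pos.2 hD
  field_simp
  ring

lemma ell_den {r : ℝ} (h0 : 0 < r) (h1 : r < 1) (t : ℝ) : 0 < 1 - r ^ 2 * sin t ^ 2 := by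
  have := sin_sq_le_one t
  have : r ^ 2 < 1 := by nlinarith
  nlinarith [sq_nonneg r]

lemma ell_cont {r : ℝ} (h0 : 0 < r) (h1 : r < 1) :
    Continuous fun t => 1 / √(1 - r ^ 2 * sin t ^ 2) := by
  refine Continuous.div continuous_const (by fun_prop) fun t => ?_
  exact (Real.sqrt_pos.2 (ell_den h0 h1 t)).ne'

lemma ell_four {r : ℝ} (h0 : 0 < r) (h1 : r < 1) :
    ∫ t in (0:ℝ)..(2 * π), 1 / √(1 - r ^ 2 * sin t ^ 2) = 4 * ellK r := by
  have hc := ell_cont h0 h1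
  set f : ℝ → ℝ := fun t => 1 / √(1 - r ^ 2 * sin t ^ 2) with hf
  have hi : ∀ a b, IntervalIntegrable f volume a b := fun a b => hc.intervalIntegrable a b
  have hper : Function.Periodic f π := by
    intro t; simp only [hf, sin_add_pi, neg_sq]
  have h2 : ∫ t in π..(2 * π), f t = ∫ t in (0:ℝ)..π, f t := by
    have := hper.intervalIntegral_add_eq π 0
    rw [zero_add] at this
    rw [← this]; congr 1; ring
  have h3 : ∫ t in (π / 2)..π, f t = ∫ t in (0:ℝ)..(π / 2), f t := by
    have := intervalIntegral.integral_comp_sub_left (a := 0) (b := π / 2) f π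
    have e : (fun x => f (π - x)) = f := by funext x; simp only [hf, sin_pi_sub]
    rw [e] at this
    rw [this]; congr 1 <;> ring
  rw [← intervalIntegral.integral_add_adjacent_intervals (hi 0 π) (hi π (2 * π)), h2,
    ← intervalIntegral.integral_add_adjacent_intervals (hi 0 (π / 2)) (hi (π / 2) π), h3]
  unfold ellK
  ring

lemma landen {r : ℝ} (h0 : 0 < r) (h1 : r < 1) :
    ∫ t in (0:ℝ)..(2 * π), 1 / ‖1 - zz r t‖ = 4 * ellK r := by
  rw [← ell_four h0 h1]
  have hDc : Continuous (DD r) := by unfold DD; fun_prop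
  have h := intervalIntegral.integral_comp_mul_deriv (a := 0) (b := 2 * π) (f := sub1 r)
    (f' := fun t => (1 - r * cos t) / DD r t) (g := fun t => 1 / √(1 - r ^ 2 * sin t ^ 2))
    (fun t _ => sub1_deriv h0 h1 t)
    (Continuous.continuousOn (Continuous.div (by fun_prop) hDc fun t => (DD_pos h0 h1 t).ne'))
    (ell_cont h0 h1)
  have e0 : sub1 r 0 = 0 := by simp [sub1]
  have e1 : sub1 r (2 * π) = 2 * π := by simp [sub1]
  rw [e0, e1] at h
  rw [← h]
  congr 1
  funext t
  have hp := one_sub_rcos_pos h0 h1 t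
  have hD := DD_pos h0 h1 t
  have hsD : 0 < √(DD r t) := Real.sqrt_pos.2 hD
  simp only [Function.comp, sub1_sin h0 h1]
  have e : 1 - r ^ 2 * (sin t / √(DD r t)) ^ 2 = (1 - r * cos t) ^ 2 / DD r t := by
    rw [div_pow, Real.sq_sqrt hD.le]
    have := DD_eq r t
    field_simp
    linear_combination this
  rw [e, Real.sqrt_div (by positivity), Real.sqrt_sq hp.le, norm_one_sub_zz]
  have h3 : √(DD r t) * √(DD r t) = DD r t := Real.mul_self_sqrt hD.le
  field_simp
  rw [sq, h3]

lemma zz_pow (q : ℝ) (p : ℕ) (t : ℝ) : zz q t ^ p = zz (q ^ p) (p * t) := by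
  unfold zz
  rw [mul_pow, ← Complex.exp_nat_mul]
  push_cast
  congr 2; ring

/-- reciprocal amplitude -/
def ww (r u : ℝ) : ℝ := 1 / ‖1 - zz r u‖

lemma ww_cont {r : ℝ} (h0 : 0 < r) (h1 : r < 1) : Continuous (ww r) := by
  have := zz_cont r
  refine Continuous.div continuous_const (by fun_prop) fun t => ?_
  exact norm_ne_zero_iff.2 (one_sub_ne (zz_norm_lt h0 h1 t))

lemma ww_per (r : ℝ) : Function.Periodic (ww r) (2 * π) := by
  intro t; unfold ww; rw [zz_periodic]

lemma geo_z {q : ℝ} (hq : 0 < q) (hq1 : q < 1) (p : ℕ) (t : ℝ) :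
    ‖GG q p t‖ = ‖∑ k ∈ Finset.range p, zz q t ^ k‖ * ww q t := by
  have hne := one_sub_ne (zz_norm_lt hq hq1 t)
  have h := geom_sum_mul_neg (zz q t) p
  unfold GG ww
  rw [← h, sq, ← div_div, mul_div_cancel_right₀ _ hne, norm_div]
  ring

lemma geo_sq {q : ℝ} (hq : 0 < q) (hq1 : q < 1) {p : ℕ} (hp : 0 < p) (t : ℝ) :
    ‖GG q p t‖ = ‖∑ k ∈ Finset.range p, zz q t ^ k‖ ^ 2 * ww (q ^ p) (p * t) := by
  have hne := one_sub_ne (zz_norm_lt hq hq1 t)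
  have hne' := one_sub_ne (zz_pow_norm_lt hq hq1 t hp)
  have h := geom_sum_mul_neg (zz q t) p
  rw [geo_z hq hq1]
  unfold ww
  rw [← zz_pow, ← h, norm_mul]
  have h2 : ‖∑ k ∈ Finset.range p, zz q t ^ k‖ ≠ 0 := by
    rw [norm_ne_zero_iff]
    intro h0
    rw [h0, zero_mul] at h
    exact hne' h.symm
  have h3 : ‖1 - zz q t‖ ≠ 0 := norm_ne_zero_iff.2 hne
  field_simp

lemma GG_cont {q : ℝ} (hq : 0 < q) (hq1 : q < 1) (p : ℕ) : Continuous (GG q p) := by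
  have := zz_cont q
  refine Continuous.div (by fun_prop) (by fun_prop) fun t => ?_
  exact pow_ne_zero _ (one_sub_ne (zz_norm_lt hq hq1 t))

lemma KK_eq {q : ℝ} (hq : 0 < q) (hq1 : q < 1) {p : ℕ} (hp : 0 < p) :
    KK q p = ∫ t in (0:ℝ)..(2 * π), ‖GG q p t‖ := by
  unfold KK aa
  simp only [GG_norm hq hq1 hp]

lemma KK_upper {q : ℝ} (hq : 0 < q) (hq1 : q < 1) {p : ℕ} (hp : 0 < p) :
    KK q p ≤ (1 - q ^ p) / (1 - q) * (4 * ellK q) := by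
  rw [KK_eq hq hq1 hp, ← landen hq hq1, ← intervalIntegral.integral_const_mul]
  refine intervalIntegral.integral_mono_on (by positivity) ?_ ?_ fun t _ => ?_
  · exact (GG_cont hq hq1 p).norm.intervalIntegrable _ _
  · exact ((ww_cont hq hq1).const_mul _).intervalIntegrable _ _
  · rw [geo_z hq hq1]
    change _ ≤ _ * ww q t
    have : 0 ≤ ww q t := by unfold ww; positivity
    gcongr
    have h1q : 1 - q ≠ 0 := by linarith
    calc ‖∑ k ∈ Finset.range p, zz q t ^ k‖ ≤ ∑ k ∈ Finset.range p, ‖zz q t ^ k‖ := norm_sum_le _ _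
      _ = ∑ k ∈ Finset.range p, q ^ k := by
        refine Finset.sum_congr rfl fun k _ => ?_
        rw [norm_pow, zz_norm hq.le]
      _ = _ := by
        rw [eq_div_iff h1q, geom_sum_mul_neg]

lemma per_shift_C {f : ℝ → ℂ} (hf : ∀ x, f (x + 2 * π) = f x) (s : ℝ) :
    ∫ t in (0:ℝ)..(2 * π), f (t + s) = ∫ t in (0:ℝ)..(2 * π), f t := by
  rw [intervalIntegral.integral_comp_add_right]
  have := Function.Periodic.intervalIntegral_add_eq (f := f) (T := 2 * π) hf s 0
  rw [zero_add] at this ⊢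
  rw [← this, add_comm]

lemma off_diag {r : ℝ} {p : ℕ} (hp : 0 < p) {d : ℤ} (hd : ¬ (p:ℤ) ∣ d) :
    ∫ t in (0:ℝ)..(2 * π), Complex.exp (d * t * Complex.I) * (ww r (p * t) : ℂ) = 0 := by
  have hp0 : (p:ℝ) ≠ 0 := by exact_mod_cast hp.ne'
  have hpc : (p:ℂ) ≠ 0 := by exact_mod_cast hp.ne'
  have h := per_shift_C (f := fun t => Complex.exp (d * t * Complex.I) * (ww r (p * t) : ℂ)) (by
    intro x
    have e1 : ww r (p * (x + 2 * π)) = ww r (p * x) := by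
      have := (ww_per r).nat_mul p (p * x)
      rw [mul_add, this]
    rw [e1]
    congr 1
    rw [Complex.exp_eq_exp_iff_exists_int]
    exact ⟨d, by push_cast; ring⟩) (2 * π / p)
  have e2 : ∀ t : ℝ, Complex.exp (d * ((t + 2 * π / p : ℝ) : ℂ) * Complex.I) *
      (ww r (p * (t + 2 * π / p)) : ℂ) =
      Complex.exp (d * (2 * π / p) * Complex.I) *
        (Complex.exp (d * t * Complex.I) * (ww r (p * t) : ℂ)) := by
    intro t
    have e3 : (p:ℝ) * (t + 2 * π / p) = p * t + 2 * π := by field_simp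
    rw [e3, ww_per r, ← mul_assoc, ← Complex.exp_add]
    congr 2
    push_cast; ring
  simp only [e2] at h
  rw [intervalIntegral.integral_const_mul] at h
  have h4 : Complex.exp (d * (2 * π / p) * Complex.I) ≠ 1 := by
    intro h5
    rw [Complex.exp_eq_one_iff] at h5
    obtain ⟨n, hn⟩ := h5
    apply hd
    refine ⟨n, ?_⟩
    have hpi : (π:ℂ) ≠ 0 := by exact_mod_cast pi_ne_zero
    have h6 : (d:ℂ) = p * n := by
      field_simp at hn
      linear_combination hn
    exact_mod_cast h6
  have h5 : (Complex.exp (d * (2 * π / p) * Complex.I) - 1) *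
    (∫ t in (0:ℝ)..(2 * π), Complex.exp (d * t * Complex.I) * (ww r (p * t) : ℂ)) = 0 := by
    rw [sub_mul, h, one_mul, sub_self]
  exact (mul_eq_zero.1 h5).resolve_left (sub_ne_zero.2 h4)

lemma diag {r : ℝ} (h0 : 0 < r) (h1 : r < 1) {p : ℕ} (hp : 0 < p) :
    ∫ t in (0:ℝ)..(2 * π), ww r (p * t) = 4 * ellK r := by
  have hp0 : (p:ℝ) ≠ 0 := by exact_mod_cast hp.ne'
  rw [intervalIntegral.integral_comp_mul_left _ hp0]
  have h := (ww_per r).intervalIntegral_add_zsmul_eq p 0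
    (fun a b => (ww_cont h0 h1).intervalIntegrable a b)
  simp only [zero_add, zsmul_eq_mul, Int.cast_natCast] at h
  rw [mul_zero, h, smul_eq_mul, ← mul_assoc, inv_mul_cancel₀ hp0, one_mul]
  exact landen h0 h1

lemma normsq_geo (q : ℝ) (p : ℕ) (t : ℝ) :
    ((‖∑ k ∈ Finset.range p, zz q t ^ k‖ ^ 2 : ℝ) : ℂ) =
      ∑ k ∈ Finset.range p, ∑ j ∈ Finset.range p,
        ((q ^ k * q ^ j : ℝ) : ℂ) * Complex.exp ((((k:ℤ) - j : ℤ) : ℂ) * t * Complex.I) := by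
  have h := Complex.mul_conj (∑ k ∈ Finset.range p, zz q t ^ k)
  rw [Complex.sq_norm, ← h, map_sum, Finset.sum_mul_sum]
  refine Finset.sum_congr rfl fun k _ => Finset.sum_congr rfl fun j _ => ?_
  unfold zz
  rw [map_pow, map_mul, ← Complex.exp_conj, mul_pow, mul_pow, ← Complex.exp_nat_mul,
    ← Complex.exp_nat_mul, map_mul, Complex.conj_ofReal, Complex.conj_ofReal, Complex.conj_I]
  have e : (((k:ℤ) - j : ℤ) : ℂ) * t * Complex.I = k * (t * Complex.I) + j * (t * -Complex.I) := by
    push_cast; ring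
  rw [e, Complex.exp_add]
  push_cast; ring

lemma KK_exact {q : ℝ} (hq : 0 < q) (hq1 : q < 1) {p : ℕ} (hp : 0 < p) :
    KK q p = (1 - q ^ (2 * p)) / (1 - q ^ 2) * (4 * ellK (q ^ p)) := by
  have hr0 : 0 < q ^ p := by positivity
  have hr1 : q ^ p < 1 := pow_lt_one₀ hq.le hq1 hp.ne'
  have hwc := ww_cont hr0 hr1
  rw [KK_eq hq hq1 hp]
  have hC : ((∫ t in (0:ℝ)..(2 * π), ‖GG q p t‖ : ℝ) : ℂ) =
      ∑ k ∈ Finset.range p, ((q ^ k * q ^ k * (4 * ellK (q ^ p)) : ℝ) : ℂ) := by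
    rw [← intervalIntegral.integral_ofReal]
    have e : ∀ t, ((‖GG q p t‖ : ℝ) : ℂ) = ∑ k ∈ Finset.range p, ∑ j ∈ Finset.range p,
        ((q ^ k * q ^ j : ℝ) : ℂ) * (Complex.exp ((((k:ℤ) - j : ℤ) : ℂ) * t * Complex.I) *
          (ww (q ^ p) (p * t) : ℂ)) := by
      intro t
      rw [geo_sq hq hq1 hp, Complex.ofReal_mul, normsq_geo, Finset.sum_mul]
      refine Finset.sum_congr rfl fun k _ => ?_
      rw [Finset.sum_mul]
      refine Finset.sum_congr rfl fun j _ => ?_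
      ring
    simp only [e]
    have hci : ∀ (d : ℤ), Continuous fun t : ℝ => Complex.exp ((d : ℂ) * t * Complex.I) *
          (ww (q ^ p) (p * t) : ℂ) := by
      intro d
      have h1 : Continuous fun t : ℝ => ww (q ^ p) (p * t) := by fun_prop
      have h2 : Continuous fun t : ℝ => ((ww (q ^ p) (p * t) : ℝ) : ℂ) :=
        Complex.continuous_ofReal.comp h1
      have h3 : Continuous fun t : ℝ => Complex.exp ((d : ℂ) * t * Complex.I) := by fun_prop
      exact h3.mul h2
    rw [intervalIntegral.integral_finsetSum]
    · refine Finset.sum_congr rfl fun k hk => ?_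
      rw [intervalIntegral.integral_finsetSum]
      · rw [Finset.sum_eq_single k]
        · rw [intervalIntegral.integral_const_mul]
          have e2 : ∀ t : ℝ, Complex.exp ((((k:ℤ) - k : ℤ) : ℂ) * t * Complex.I) *
              (ww (q ^ p) (p * t) : ℂ) = ((ww (q ^ p) (p * t) : ℝ) : ℂ) := by
            intro t; simp
          simp only [e2]
          rw [intervalIntegral.integral_ofReal, diag hr0 hr1 hp]
          push_cast; ring
        · intro j hj hjk
          rw [intervalIntegral.integral_const_mul, off_diag hp, mul_zero]
          intro hdvd
          have h1 := Finset.mem_range.1 hk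
          have h2 := Finset.mem_range.1 hj
          have h3 := Int.eq_zero_of_abs_lt_dvd hdvd (by rw [abs_lt]; constructor <;> omega)
          omega
        · intro h; exact absurd hk h
      · intro j _
        exact ((hci _).const_mul _).intervalIntegrable _ _
    · intro k _
      refine Continuous.intervalIntegrable ?_ _ _
      exact continuous_finsetSum _ fun j _ => (hci _).const_mul _
  have hR : ∫ t in (0:ℝ)..(2 * π), ‖GG q p t‖ =
      ∑ k ∈ Finset.range p, q ^ k * q ^ k * (4 * ellK (q ^ p)) := by
    exact_mod_cast hC
  rw [hR, ← Finset.sum_mul]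
  congr 1
  have hq2 : 1 - q ^ 2 ≠ 0 := by nlinarith
  rw [eq_div_iff hq2]
  have := geom_sum_mul_neg (q ^ 2) p
  rw [pow_mul, ← this]
  congr 1
  refine Finset.sum_congr rfl fun k _ => ?_
  ring

lemma ellK_one : ellK 1 = 0 := by
  unfold ellK
  apply intervalIntegral.integral_undef
  intro h
  have h1 : ∀ t ∈ Set.uIoc 0 (π / 2), |(t - π / 2)⁻¹| ≤ |1 / √(1 - 1 ^ 2 * sin t ^ 2)| := by
    intro t ht
    rw [Set.uIoc_of_le (by positivity)] at ht
    have e : 1 - 1 ^ 2 * sin t ^ 2 = cos t ^ 2 := by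
      have := sin_sq_add_cos_sq t; linarith
    have hc0 : 0 ≤ cos t := cos_nonneg_of_mem_Icc ⟨by linarith [ht.1, pi_pos], ht.2⟩
    rw [e, Real.sqrt_sq hc0, abs_inv, abs_div, abs_one, abs_of_nonneg hc0]
    rcases ht.2.eq_or_lt with h2 | h2
    · rw [h2]; simp
    have hc : 0 < cos t := cos_pos_of_mem_Ioo ⟨by linarith [ht.1, pi_pos], h2⟩
    rw [one_div]
    gcongr
    have h3 : cos t = sin (π / 2 - t) := by rw [sin_pi_div_two_sub]
    rw [h3, abs_sub_comm, abs_of_pos (by linarith)]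
    exact sin_le (by linarith)
  have h2 : IntervalIntegrable (fun t : ℝ => (t - π / 2)⁻¹) volume 0 (π / 2) := by
    refine h.mono_fun ?_ ?_
    · exact (by fun_prop : Measurable fun t : ℝ => (t - π / 2)⁻¹).aestronglyMeasurable
    · filter_upwards [ae_restrict_mem measurableSet_uIoc] with t ht
      exact h1 t ht
  rw [intervalIntegrable_sub_inv_iff] at h2
  rcases h2 with h2 | h2
  · linarith [pi_pos]
  · exact h2 Set.right_mem_uIcc

lemma zero_mem_H {ω : ℝ → ℝ} (hω : IsConcaveModulus ω) : (fun _ => (0:ℝ)) ∈ Hclass ω :=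
  ⟨continuous_const, fun _ => rfl, fun s t => by
    simp only [sub_self, abs_zero]; exact cm_nonneg hω (abs_nonneg _)⟩

lemma const_mem {q β : ℝ} {ω : ℝ → ℝ} (hω : IsConcaveModulus ω) (A : ℝ) :
    (fun _ => A) ∈ CqbH q β ω :=
  ⟨A, _, zero_mem_H hω, by funext x; simp⟩

lemma Edev_p_zero {q β : ℝ} {ω : ℝ → ℝ} (hω : IsConcaveModulus ω) (n : ℕ) :
    Edev (CqbH q β ω) (Vsum n 0) = 0 := by
  unfold Edev
  apply Real.iSup_of_not_bddAbove
  rintro ⟨B, hB⟩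
  have h := hB ⟨⟨fun _ => |B| + 1, const_mem hω _⟩, rfl⟩
  have e : (⨆ x : ℝ, |(fun _ : ℝ => |B| + 1) x - Vsum n 0 (fun _ => |B| + 1) x|) = |B| + 1 := by
    simp only [Vsum, Nat.cast_zero, div_zero, zero_mul, sub_zero]
    rw [ciSup_const, abs_of_pos (by positivity)]
  simp only [e] at h
  linarith [le_abs_self B]

lemma ellK_nonneg (r : ℝ) : 0 ≤ ellK r :=
  intervalIntegral.integral_nonneg (by positivity) fun t _ => by positivity

lemma Edev_main {q β : ℝ} (hq : 0 < q) (hq1 : q < 1) {n p : ℕ} (hpn : p < n) (hp : 0 < p)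
    {ω : ℝ → ℝ} (hω : IsConcaveModulus ω) (hm : 6 / (1 - q) ≤ ((n - p + 1 : ℕ) : ℝ)) :
    |Edev (CqbH q β ω) (Vsum n p) -
      q ^ (n - p + 1) / (p * π) * (1 / π * eInt (n - p + 1) ω * KK q p)| ≤
      q ^ (n - p + 1) / (p * π) * (5000 * ω (1 / ((n - p + 1 : ℕ) : ℝ)) /
        ((1 - q) ^ δp p * ((n - p + 1 : ℕ) : ℝ))) := by
  set m := n - p + 1 with hmdef
  set X := 1 / π * eInt m ω * KK q p
  set Y := 5000 * ω (1 / (m : ℝ)) / ((1 - q) ^ δp p * (m : ℝ))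
  have hp0 : (0:ℝ) < p := by exact_mod_cast hp
  have hc : 0 ≤ q ^ m / (p * π) := by positivity
  have hup : ∀ f ∈ CqbH q β ω, ∀ x, |f x - Vsum n p f x| ≤ q ^ m / (p * π) * (X + Y) := by
    rintro f ⟨A₀, φ, hφ, hf⟩ x
    rw [dev_formula hq hq1 hpn hp hφ A₀ hf x, abs_mul, abs_of_nonneg hc]
    exact mul_le_mul_of_nonneg_left (TT_upper hq hq1 hp _ hm hω (Hclass_shift hφ x)) hc
  obtain ⟨φ, hφ, hlow⟩ := TT_lower hq hq1 hp (β * π / 2) hm hω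
  change X - Y ≤ _ at hlow
  let f : ℝ → ℝ := fun x => 0 + (1 / π) * ∫ t in (0:ℝ)..(2 * π), φ (x + t) * Pker q β t
  have hfm : f ∈ CqbH q β ω := ⟨0, φ, hφ, rfl⟩
  have hinner : ∀ f ∈ CqbH q β ω, (⨆ x : ℝ, |f x - Vsum n p f x|) ≤ q ^ m / (p * π) * (X + Y) :=
    fun f hf => ciSup_le (hup f hf)
  have hE1 : Edev (CqbH q β ω) (Vsum n p) ≤ q ^ m / (p * π) * (X + Y) := by
    unfold Edev
    haveI : Nonempty (CqbH q β ω) := ⟨⟨f, hfm⟩⟩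
    exact ciSup_le fun g => hinner g g.2
  have hE2 : q ^ m / (p * π) * (X - Y) ≤ Edev (CqbH q β ω) (Vsum n p) := by
    have h1 : q ^ m / (p * π) * (X - Y) ≤ |f 0 - Vsum n p f 0| := by
      rw [dev_formula hq hq1 hpn hp hφ 0 (f := f) rfl 0]
      refine le_trans ?_ (le_abs_self _)
      simp only [zero_add]
      exact mul_le_mul_of_nonneg_left hlow hc
    refine h1.trans ?_
    have h2 : |f 0 - Vsum n p f 0| ≤ ⨆ x : ℝ, |f x - Vsum n p f x| :=
      le_ciSup (f := fun x => |f x - Vsum n p f x|)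
        ⟨_, by rintro _ ⟨x, rfl⟩; exact hup f hfm x⟩ 0
    refine h2.trans ?_
    unfold Edev
    exact le_ciSup (f := fun g : CqbH q β ω => ⨆ x : ℝ, |(g : ℝ → ℝ) x - Vsum n p g x|)
      ⟨_, by rintro _ ⟨g, rfl⟩; exact hinner g g.2⟩ ⟨f, hfm⟩
  rw [abs_le]
  constructor <;> nlinarith

theorem final_thm :
    ∃ C : ℝ, 0 < C ∧
      ∀ (q β : ℝ) (n p : ℕ) (ω : ℝ → ℝ),
        q ∈ Set.Ioo (0:ℝ) 1 → p < n → IsConcaveModulus ω →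
        6 / (1 - q) ≤ (n : ℝ) - (p : ℝ) →
        ∃ J : ℝ,
          (1 + q ^ p) / (1 + q) * ellK (q ^ p) ≤ J ∧ J ≤ ellK q ∧
          |Edev (CqbH q β ω) (Vsum n p) -
              q ^ (n - p + 1) / (p : ℝ) * (4 * J / π ^ 2) *
                ((1 - q ^ p) / (1 - q)) * eInt (n - p + 1) ω| ≤
            C * (q ^ (n - p + 1) / (p : ℝ)) * ω (1 / ((n - p + 1 : ℕ) : ℝ)) /
              ((1 - q) ^ δp p * ((n - p + 1 : ℕ) : ℝ)) := by
  refine ⟨5000, by norm_num, ?_⟩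
  rintro q β n p ω ⟨hq, hq1⟩ hpn hω hm
  rcases Nat.eq_zero_or_pos p with hp | hp
  · subst hp
    refine ⟨0, ?_, ellK_nonneg q, ?_⟩
    · rw [pow_zero, ellK_one, mul_zero]
    · rw [Edev_p_zero hω]; simp
  have hm' : 6 / (1 - q) ≤ ((n - p + 1 : ℕ) : ℝ) := by
    rw [Nat.cast_add, Nat.cast_sub hpn.le]; push_cast; linarith
  have h1q : 0 < 1 - q := by linarith
  have hr1 : q ^ p < 1 := pow_lt_one₀ hq.le hq1 hp.ne'
  have h1r : 0 < 1 - q ^ p := by linarith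
  have hp0 : (0:ℝ) < p := by exact_mod_cast hp
  have h := Edev_main (β := β) hq hq1 hpn hp hω hm'
  have hωn : 0 ≤ ω (1 / ((n - p + 1 : ℕ) : ℝ)) := cm_nonneg hω (by positivity)
  refine ⟨KK q p * (1 - q) / (4 * (1 - q ^ p)), ?_, ?_, ?_⟩
  · rw [KK_exact hq hq1 hp]
    refine le_of_eq ?_
    have e1 : 1 - q ^ (2 * p) = (1 - q ^ p) * (1 + q ^ p) := by ring
    have e2 : 1 - q ^ 2 = (1 - q) * (1 + q) := by ring
    rw [e1, e2]
    field_simp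
  · have := KK_upper hq hq1 hp
    rw [div_le_iff₀ (by positivity)]
    calc KK q p * (1 - q) ≤ (1 - q ^ p) / (1 - q) * (4 * ellK q) * (1 - q) := by gcongr
      _ = _ := by field_simp
  · have e : q ^ (n - p + 1) / (p : ℝ) * (4 * (KK q p * (1 - q) / (4 * (1 - q ^ p))) / π ^ 2) *
          ((1 - q ^ p) / (1 - q)) * eInt (n - p + 1) ω =
        q ^ (n - p + 1) / (p * π) * (1 / π * eInt (n - p + 1) ω * KK q p) := by
      field_simp
    rw [e]
    refine h.trans ?_
    set W := ω (1 / ((n - p + 1 : ℕ) : ℝ)) / ((1 - q) ^ δp p * ((n - p + 1 : ℕ) : ℝ)) with hW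
    have hW0 : 0 ≤ W := by positivity
    have e3 : q ^ (n - p + 1) / (p * π) * (5000 * ω (1 / ((n - p + 1 : ℕ) : ℝ)) /
        ((1 - q) ^ δp p * ((n - p + 1 : ℕ) : ℝ))) = (5000 * (q ^ (n - p + 1) / p) * W) / π := by
      rw [hW]; field_simp
    have e4 : 5000 * (q ^ (n - p + 1) / (p : ℝ)) * ω (1 / ((n - p + 1 : ℕ) : ℝ)) /
              ((1 - q) ^ δp p * ((n - p + 1 : ℕ) : ℝ)) = 5000 * (q ^ (n - p + 1) / p) * W := by
      rw [hW]; ring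
    rw [e3, e4]
    exact div_le_self (by positivity) (by linarith [pi_gt_three])

/-- **Theorem 3** (Serdyuk–Ovsii): asymptotic formula for `E(C^q_β H_ω; V_{n,p})` with a
constant `J = J_{q,p}(n,ω)` lying between `((1+q^p)/(1+q))·K(q^p)` and `K(q)`. -/
theorem vallee_poussin_Homega_ellipticForm :
    ∃ C : ℝ, 0 < C ∧
      ∀ (q β : ℝ) (n p : ℕ) (ω : ℝ → ℝ),
        q ∈ Set.Ioo (0:ℝ) 1 → p < n → IsConcaveModulus ω →
        6 / (1 - q) ≤ (n : ℝ) - (p : ℝ) →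
        ∃ J : ℝ,
          (1 + q ^ p) / (1 + q) * ellK (q ^ p) ≤ J ∧ J ≤ ellK q ∧
          |Edev (CqbH q β ω) (Vsum n p) -
              q ^ (n - p + 1) / (p : ℝ) * (4 * J / π ^ 2) *
                ((1 - q ^ p) / (1 - q)) * eInt (n - p + 1) ω| ≤
            C * (q ^ (n - p + 1) / (p : ℝ)) * ω (1 / ((n - p + 1 : ℕ) : ℝ)) /
              ((1 - q) ^ δp p * ((n - p + 1 : ℕ) : ℝ)) := by
  exact final_thm
end
end

section
/- For every p ∈ ℕ and q ∈ (0,1), the constant K_{p,q} = ∫₀^{2π} √(1 − 2q^p cos(pt) + q^{2p}) / (1 − 2q cos t + q²) dt satisfies K_{p,q} = 4 · ((1 − q^{2p})/(1 − q²)) · K(q^p), where K(r) = ∫₀^{π/2} dt/√(1 − r² sin² t) is the complete elliptic integral of the first kind. -/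
open Real MeasureTheory intervalIntegral

noncomputable section

lemma aux_den_pos {q : ℝ} (h0 : 0 < q) (h1 : q < 1) (c : ℝ) (hc : c ≤ 1) :
    0 < 1 - 2 * q * c + q ^ 2 := by
  nlinarith [mul_le_mul_of_nonneg_left hc h0.le, sq_nonneg (1 - q), mul_pos (sub_pos.2 h1) (sub_pos.2 h1)]

lemma aux_norm {q : ℝ} (h0 : 0 < q) (t : ℝ) :
    ‖(q : ℂ) * Complex.exp (t * Complex.I)‖ = q := by
  rw [norm_mul, Complex.norm_exp_ofReal_mul_I, mul_one, Complex.norm_real, Real.norm_of_nonneg h0.le]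

lemma aux_poisson_re {q : ℝ} (h0 : 0 < q) (h1 : q < 1) (t : ℝ) :
    (1 - q ^ 2) / (1 - 2 * q * Real.cos t + q ^ 2) =
      2 * ((1 - (q : ℂ) * Complex.exp (t * Complex.I))⁻¹).re - 1 := by
  have hD := aux_den_pos h0 h1 (Real.cos t) (Real.cos_le_one t)
  have hre : (1 - (q : ℂ) * Complex.exp (t * Complex.I)).re = 1 - q * Real.cos t := by
    simp [Complex.exp_ofReal_mul_I_re]
  have him : (1 - (q : ℂ) * Complex.exp (t * Complex.I)).im = - (q * Real.sin t) := by
    simp [Complex.exp_ofReal_mul_I_im]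
  have hn : Complex.normSq (1 - (q : ℂ) * Complex.exp (t * Complex.I))
      = 1 - 2 * q * Real.cos t + q ^ 2 := by
    rw [Complex.normSq_apply, hre, him]
    nlinarith [Real.sin_sq_add_cos_sq t]
  rw [Complex.inv_re, hre, hn, div_eq_iff hD.ne', sub_mul, mul_assoc, div_mul_cancel₀ _ hD.ne']
  ring

lemma aux_roots {p : ℕ} (hp : 0 < p) {ζ : ℂ} (hζ : IsPrimitiveRoot ζ p) {x : ℂ} (hx : ‖x‖ < 1) :
    ∑ k ∈ Finset.range p, (1 - x * ζ ^ k)⁻¹ = p * (1 - x ^ p)⁻¹ := by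
  have hxp : 1 - x ^ p ≠ 0 := by
    intro h
    have : ‖x ^ p‖ < 1 := by
      rw [norm_pow]; exact pow_lt_one₀ (norm_nonneg _) hx hp.ne'
    rw [← sub_eq_zero.1 h] at this
    simp at this
  have h1 : ∀ k ∈ Finset.range p, (1 - x * ζ ^ k)⁻¹ =
      (∑ j ∈ Finset.range p, x ^ j * (ζ ^ j) ^ k) * (1 - x ^ p)⁻¹ := by
    intro k _
    have hg := mul_neg_geom_sum (x * ζ ^ k) p
    have hpow : (x * ζ ^ k) ^ p = x ^ p := by
      rw [mul_pow, ← pow_mul, mul_comm k p, pow_mul, hζ.pow_eq_one, one_pow, mul_one]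
    rw [hpow] at hg
    have hs : ∑ j ∈ Finset.range p, x ^ j * (ζ ^ j) ^ k = ∑ i ∈ Finset.range p, (x * ζ ^ k) ^ i := by
      refine Finset.sum_congr rfl fun j _ => ?_
      rw [mul_pow, ← pow_mul, ← pow_mul, mul_comm j k]
    rw [hs]
    have hne : 1 - x * ζ ^ k ≠ 0 := by
      intro h; rw [h, zero_mul] at hg; exact hxp hg.symm
    field_simp
    rw [← hg]
  rw [Finset.sum_congr rfl h1, ← Finset.sum_mul, Finset.sum_comm]
  congr 1
  rw [Finset.sum_eq_single_of_mem 0 (Finset.mem_range.2 hp)]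
  · simp
  · intro j hj hj0
    rw [← Finset.mul_sum]
    have hne : ζ ^ j ≠ 1 := hζ.pow_ne_one_of_pos_of_lt hj0 (Finset.mem_range.1 hj)
    have hg := mul_neg_geom_sum (ζ ^ j) p
    rw [← pow_mul, mul_comm j p, pow_mul, hζ.pow_eq_one, one_pow, sub_self] at hg
    rcases mul_eq_zero.1 hg with h | h
    · exact absurd (sub_eq_zero.1 h).symm hne
    · rw [h, mul_zero]

lemma aux_sum {p : ℕ} (hp : 0 < p) {q : ℝ} (h0 : 0 < q) (h1 : q < 1) (t : ℝ) :
    ∑ k ∈ Finset.range p,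
      (1 - q ^ 2) / (1 - 2 * q * Real.cos (t + k * (2 * π / p)) + q ^ 2) =
    p * ((1 - (q ^ p) ^ 2) / (1 - 2 * q ^ p * Real.cos (p * t) + (q ^ p) ^ 2)) := by
  have hζ := Complex.isPrimitiveRoot_exp p hp.ne'
  have hr0 : 0 < q ^ p := pow_pos h0 p
  have hr1 : q ^ p < 1 := pow_lt_one₀ h0.le h1 hp.ne'
  have hR := aux_roots hp hζ (x := (q : ℂ) * Complex.exp (t * Complex.I))
    (by rw [aux_norm h0]; exact h1)
  have hpC : (p : ℂ) ≠ 0 := by exact_mod_cast hp.ne'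
  have e1 : ∀ k : ℕ, (q : ℂ) * Complex.exp (t * Complex.I) * Complex.exp (2 * π * Complex.I / p) ^ k
      = q * Complex.exp (((t + k * (2 * π / p) : ℝ) : ℂ) * Complex.I) := by
    intro k
    rw [← Complex.exp_nat_mul, mul_assoc, ← Complex.exp_add]
    congr 2
    push_cast
    ring
  have e2 : ((q : ℂ) * Complex.exp (t * Complex.I)) ^ p
      = ((q ^ p : ℝ) : ℂ) * Complex.exp (((p * t : ℝ) : ℂ) * Complex.I) := by
    rw [mul_pow, ← Complex.exp_nat_mul]
    push_cast
    congr 2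
    ring
  simp only [e1, e2] at hR
  have hR' := congrArg Complex.re hR
  rw [Complex.re_sum, ← Complex.ofReal_natCast, Complex.re_ofReal_mul] at hR'
  rw [Finset.sum_congr rfl fun (k : ℕ) _ => aux_poisson_re h0 h1 (t + k * (2 * π / p)),
    aux_poisson_re hr0 hr1, Finset.sum_sub_distrib, ← Finset.mul_sum, hR']
  simp
  ring

lemma aux_landen {r : ℝ} (h0 : 0 < r) (h1 : r < 1) :
    ∫ u in (0:ℝ)..(2 * π), 1 / Real.sqrt (1 - 2 * r * Real.cos u + r ^ 2) =
    ∫ t in (0:ℝ)..(2 * π), 1 / Real.sqrt (1 - r ^ 2 * Real.sin t ^ 2) := by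
  have hD : ∀ u, 0 < 1 - 2 * r * Real.cos u + r ^ 2 :=
    fun u => aux_den_pos h0 h1 _ (Real.cos_le_one u)
  have hc : ∀ u, 0 < 1 - r * Real.cos u := fun u => by
    nlinarith [Real.cos_le_one u]
  have hs : ∀ t, 0 < 1 - r ^ 2 * Real.sin t ^ 2 := fun t => by
    nlinarith [Real.sin_sq_le_one t, sq_nonneg (Real.sin t), mul_pos h0 h0]
  have hder : ∀ u ∈ Set.uIcc (0:ℝ) (2 * π),
      HasDerivAt (fun u => u + Real.arctan (r * Real.sin u / (1 - r * Real.cos u)))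
        ((1 - r * Real.cos u) / (1 - 2 * r * Real.cos u + r ^ 2)) u := by
    intro u _
    have a := ((Real.hasDerivAt_sin u).const_mul r).div
      (((Real.hasDerivAt_cos u).const_mul r).const_sub 1) (hc u).ne'
    have b := (hasDerivAt_id u).add a.arctan
    refine b.congr_deriv ?_
    have := hc u
    have := hD u
    have e : 1 + (r * Real.sin u / (1 - r * Real.cos u)) ^ 2
        = (1 - 2 * r * Real.cos u + r ^ 2) / (1 - r * Real.cos u) ^ 2 := by
      field_simp
      nlinarith [Real.sin_sq_add_cos_sq u]
    simp only [Pi.div_apply]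
    rw [e]
    field_simp
    have hsq : Real.sin u ^ 2 = 1 - Real.cos u ^ 2 := Real.sin_sq u
    ring_nf
    simp only [hsq]
    ring
  have hcont : Continuous fun u => (1 - r * Real.cos u) / (1 - 2 * r * Real.cos u + r ^ 2) :=
    Continuous.div (by fun_prop) (by fun_prop) fun u => (hD u).ne'
  have hg : Continuous fun t => 1 / Real.sqrt (1 - r ^ 2 * Real.sin t ^ 2) :=
    Continuous.div (by fun_prop) (by fun_prop) fun t => (Real.sqrt_pos.2 (hs t)).ne'
  have key := intervalIntegral.integral_comp_mul_deriv (a := 0) (b := 2 * π) hder hcont.continuousOn hg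
  simp only [Real.sin_zero, Real.sin_two_pi, mul_zero, zero_div, Real.arctan_zero, add_zero] at key
  rw [← key]
  refine intervalIntegral.integral_congr fun u _ => ?_
  have hcu := hc u
  have hDu := hD u
  have e1 : 1 - r ^ 2 * Real.sin (u + Real.arctan (r * Real.sin u / (1 - r * Real.cos u))) ^ 2
      = (1 - r * Real.cos u) ^ 2 / (1 - 2 * r * Real.cos u + r ^ 2) := by
    rw [Real.sin_add, Real.sin_arctan, Real.cos_arctan]
    have e : 1 + (r * Real.sin u / (1 - r * Real.cos u)) ^ 2
        = (1 - 2 * r * Real.cos u + r ^ 2) / (1 - r * Real.cos u) ^ 2 := by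
      field_simp
      nlinarith [Real.sin_sq_add_cos_sq u]
    rw [e, Real.sqrt_div hDu.le, Real.sqrt_sq hcu.le]
    have hS := Real.sqrt_pos.2 hDu
    have hS2 := Real.sq_sqrt hDu.le
    have e3 : Real.sin u * (1 / (√(1 - 2 * r * Real.cos u + r ^ 2) / (1 - r * Real.cos u))) +
        Real.cos u * (r * Real.sin u / (1 - r * Real.cos u) /
          (√(1 - 2 * r * Real.cos u + r ^ 2) / (1 - r * Real.cos u)))
        = Real.sin u / √(1 - 2 * r * Real.cos u + r ^ 2) := by
      field_simp
      ring
    rw [e3, div_pow, hS2, eq_div_iff hDu.ne', sub_mul, mul_assoc (r ^ 2), div_mul_cancel₀ _ hDu.ne',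
      Real.sin_sq]
    ring
  simp only [Function.comp]
  rw [e1, Real.sqrt_div (sq_nonneg _), Real.sqrt_sq hcu.le]
  have hS := Real.sqrt_pos.2 hDu
  have hS2 := Real.sq_sqrt hDu.le
  rw [one_div_div, div_mul_div_comm, div_eq_div_iff hS.ne' (by positivity)]
  rw [one_mul]
  nth_rewrite 1 [← hS2]
  ring

lemma aux_quarter {r : ℝ} (h0 : 0 < r) (h1 : r < 1) :
    ∫ t in (0:ℝ)..(2 * π), 1 / Real.sqrt (1 - r ^ 2 * Real.sin t ^ 2) = 4 * ellK r := by
  have hs : ∀ t, 0 < 1 - r ^ 2 * Real.sin t ^ 2 := fun t => by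
    nlinarith [Real.sin_sq_le_one t, sq_nonneg (Real.sin t), mul_pos h0 h0]
  set g : ℝ → ℝ := fun t => 1 / Real.sqrt (1 - r ^ 2 * Real.sin t ^ 2) with hgdef
  have hg : Continuous g :=
    Continuous.div (by fun_prop) (by fun_prop) fun t => (Real.sqrt_pos.2 (hs t)).ne'
  have hi : ∀ a b, IntervalIntegrable g volume a b := fun a b => hg.intervalIntegrable a b
  have hK : ellK r = ∫ t in (0:ℝ)..(π / 2), g t := rfl
  have r1 : ∫ t in (π / 2)..π, g t = ∫ t in (0:ℝ)..(π / 2), g t := by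
    have := intervalIntegral.integral_comp_sub_left (a := 0) (b := π / 2) g π
    rw [sub_zero, show π - π / 2 = π / 2 by ring] at this
    rw [← this]
    simp [hgdef]
  have r2 : ∫ t in π..(2 * π), g t = ∫ t in (0:ℝ)..π, g t := by
    have := intervalIntegral.integral_comp_add_right (a := 0) (b := π) g π
    rw [zero_add, show π + π = 2 * π by ring] at this
    rw [← this]
    simp [hgdef]
  rw [← intervalIntegral.integral_add_adjacent_intervals (hi 0 π) (hi π (2 * π)), r2,
    ← intervalIntegral.integral_add_adjacent_intervals (hi 0 (π / 2)) (hi (π / 2) π), r1, hK]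
  ring

lemma aux_periodic_scale {p : ℕ} (hp : 0 < p) {h : ℝ → ℝ} (hper : Function.Periodic h (2 * π))
    (hc : Continuous h) :
    ∫ t in (0:ℝ)..(2 * π), h (p * t) = ∫ t in (0:ℝ)..(2 * π), h t := by
  have hp' : (p : ℝ) ≠ 0 := by exact_mod_cast hp.ne'
  rw [intervalIntegral.integral_comp_mul_left h hp']
  have := hper.intervalIntegral_add_zsmul_eq (p : ℤ) 0
    (fun a b => hc.intervalIntegrable a b)
  simp only [zero_add, zsmul_eq_mul, Int.cast_natCast] at this
  rw [mul_zero, this, smul_eq_mul, inv_mul_cancel_left₀ (by exact_mod_cast hp.ne')]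
  done

/-- `K_{p,q} = 4 ((1-q^{2p})/(1-q²)) K(q^p)`, where `K` is the complete elliptic
integral of the first kind. -/
theorem Kpq_eq_elliptic (p : ℕ) (hp : 0 < p) (q : ℝ) (hq : q ∈ Set.Ioo (0:ℝ) 1) :
    Kpq p q = 4 * ((1 - q ^ (2 * p)) / (1 - q ^ 2)) * ellK (q ^ p) := by
  obtain ⟨h0, h1⟩ := hq
  have hr0 : 0 < q ^ p := pow_pos h0 p
  have hr1 : q ^ p < 1 := pow_lt_one₀ h0.le h1 hp.ne'
  have hp' : (p : ℝ) ≠ 0 := by exact_mod_cast hp.ne'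
  have hq2 : 0 < 1 - q ^ 2 := by nlinarith
  have h2p : q ^ (2 * p) = (q ^ p) ^ 2 := by rw [mul_comm, pow_mul]
  unfold Kpq
  rw [h2p]
  set r := q ^ p with hr
  have hD : ∀ u, 0 < 1 - 2 * q * Real.cos u + q ^ 2 :=
    fun u => aux_den_pos h0 h1 _ (Real.cos_le_one u)
  have hDr : ∀ u, 0 < 1 - 2 * r * Real.cos u + r ^ 2 :=
    fun u => aux_den_pos hr0 hr1 _ (Real.cos_le_one u)
  set f : ℝ → ℝ := fun t => Real.sqrt (1 - 2 * r * Real.cos (p * t) + r ^ 2) /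
      (1 - 2 * q * Real.cos t + q ^ 2) with hf
  have hfc : Continuous f := Continuous.div (by fun_prop) (by fun_prop) fun t => (hD t).ne'
  have hfper : Function.Periodic f (2 * π) := by
    intro t
    simp only [hf, Real.cos_add_two_pi, mul_add, Real.cos_add_nat_mul_two_pi]
  have hshift : ∀ c : ℝ, ∫ t in (0:ℝ)..(2 * π), f (t + c) = ∫ t in (0:ℝ)..(2 * π), f t := by
    intro c
    rw [intervalIntegral.integral_comp_add_right f c]
    have := hfper.intervalIntegral_add_eq c 0
    rw [zero_add, add_comm c] at this
    rw [zero_add, this]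
  have hsum : (p : ℝ) * ∫ t in (0:ℝ)..(2 * π), f t =
      ∫ t in (0:ℝ)..(2 * π), ∑ k ∈ Finset.range p, f (t + k * (2 * π / p)) := by
    rw [intervalIntegral.integral_finsetSum]
    · simp [hshift]
    · intro k _
      exact (hfc.comp (by fun_prop : Continuous fun t : ℝ => t + k * (2 * π / p))).intervalIntegrable _ _
  have hpt : ∀ t, ∑ k ∈ Finset.range p, f (t + k * (2 * π / p)) =
      p * ((1 - r ^ 2) / (1 - q ^ 2)) * (1 / Real.sqrt (1 - 2 * r * Real.cos (p * t) + r ^ 2)) := by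
    intro t
    have e : ∀ k ∈ Finset.range p, f (t + k * (2 * π / p)) =
        (Real.sqrt (1 - 2 * r * Real.cos (p * t) + r ^ 2) / (1 - q ^ 2)) *
        ((1 - q ^ 2) / (1 - 2 * q * Real.cos (t + k * (2 * π / p)) + q ^ 2)) := by
      intro k _
      have : (p : ℝ) * (t + k * (2 * π / p)) = p * t + k * (2 * π) := by
        field_simp
      simp only [hf, this, Real.cos_add_nat_mul_two_pi]
      rw [div_mul_div_cancel₀ hq2.ne']
    rw [Finset.sum_congr rfl e, ← Finset.mul_sum, aux_sum hp h0 h1, ← hr]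
    have hS := Real.sqrt_pos.2 (hDr (p * t))
    have hS2 := Real.sq_sqrt (hDr (p * t)).le
    nth_rewrite 2 [← hS2]
    field_simp
  have hper : Function.Periodic (fun u => 1 / Real.sqrt (1 - 2 * r * Real.cos u + r ^ 2)) (2 * π) := by
    intro t
    simp only [Real.cos_add_two_pi]
  have hcont : Continuous (fun u => 1 / Real.sqrt (1 - 2 * r * Real.cos u + r ^ 2)) :=
    Continuous.div (by fun_prop) (by fun_prop) fun t => (Real.sqrt_pos.2 (hDr t)).ne'
  simp only [hpt] at hsum
  rw [intervalIntegral.integral_const_mul, aux_periodic_scale hp hper hcont, aux_landen hr0 hr1,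
    aux_quarter hr0 hr1, mul_assoc] at hsum
  have := mul_left_cancel₀ hp' hsum
  rw [this]
  ring
end
end

section
/- Let ω be a convex upwards (concave) modulus of continuity and k ∈ ℕ. Then (2/π) · ω(π/k) ≤ ∫₀^{π/2} ω(2t/k) sin t dt ≤ ω(π/k). -/
open Real MeasureTheory intervalIntegral

noncomputable section

/-- Two-sided estimate `(2/π) ω(π/k) ≤ e_k(ω) ≤ ω(π/k)` for a concave modulus of
continuity `ω`. -/
theorem eInt_two_sided (ω : ℝ → ℝ) (hω : IsConcaveModulus ω) (k : ℕ) (hk : 0 < k) :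
    2 / π * ω (π / k) ≤ (∫ t in (0:ℝ)..(π / 2), ω (2 * t / k) * Real.sin t) ∧
      (∫ t in (0:ℝ)..(π / 2), ω (2 * t / k) * Real.sin t) ≤ ω (π / k) := by
  obtain ⟨⟨hc, hm, -, h0⟩, hcv⟩ := hω
  have hk' : (0:ℝ) < k := by exact_mod_cast hk
  have hpi := Real.pi_pos
  have hle : (0:ℝ) ≤ π / 2 := by positivity
  have hfc : ContinuousOn (fun t : ℝ => ω (2 * t / k) * Real.sin t) (Set.Icc 0 (π / 2)) := by
    refine ContinuousOn.mul (hc.comp (by fun_prop) ?_) (by fun_prop)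
    intro t ht
    have := ht.1
    simp only [Set.mem_Ici]
    positivity
  have hfi : IntervalIntegrable (fun t : ℝ => ω (2 * t / k) * Real.sin t) volume 0 (π / 2) :=
    ContinuousOn.intervalIntegrable_of_Icc hle hfc
  have hsin : ∀ t ∈ Set.Icc (0:ℝ) (π / 2), 0 ≤ Real.sin t := fun t ht =>
    Real.sin_nonneg_of_nonneg_of_le_pi ht.1 (by linarith [ht.2])
  have hpk : (0:ℝ) ≤ π / k := by positivity
  constructor
  · have hI : (∫ t in (0:ℝ)..(π / 2), 2 / π * ω (π / k) * (t * Real.sin t))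
        = 2 / π * ω (π / k) := by
      rw [intervalIntegral.integral_const_mul]
      have : (∫ t in (0:ℝ)..(π / 2), t * Real.sin t) = 1 := by
        rw [intervalIntegral.integral_eq_sub_of_hasDerivAt
          (f := fun t => Real.sin t - t * Real.cos t)]
        · simp
        · intro t _
          have := (Real.hasDerivAt_sin t).sub ((hasDerivAt_id t).mul (Real.hasDerivAt_cos t))
          refine HasDerivAt.congr_deriv (f := fun t => Real.sin t - t * Real.cos t) this ?_
          simp only [id]
          ring
        · exact Continuous.intervalIntegrable (by fun_prop) _ _
      rw [this, mul_one]
    rw [← hI]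
    refine intervalIntegral.integral_mono_on hle
      (Continuous.intervalIntegrable (by fun_prop) _ _) hfi ?_
    intro t ht
    have hs := hsin t ht
    have key : 2 * t / π * ω (π / k) ≤ ω (2 * t / k) := by
      have ha : 0 ≤ 2 * t / π := by have := ht.1; positivity
      have hb : 0 ≤ 1 - 2 * t / π := by
        rw [sub_nonneg, div_le_one hpi]; linarith [ht.2]
      have := hcv.2 (x := π / k) (y := 0) hpk (Set.mem_Ici.2 le_rfl) ha hb (by ring)
      simp only [smul_eq_mul, h0, mul_zero, add_zero] at this
      have e : 2 * t / π * (π / k) = 2 * t / k := by field_simp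
      rwa [e] at this
    calc 2 / π * ω (π / k) * (t * Real.sin t) = (2 * t / π * ω (π / k)) * Real.sin t := by ring
      _ ≤ _ := mul_le_mul_of_nonneg_right key hs
  · have hI : (∫ t in (0:ℝ)..(π / 2), ω (π / k) * Real.sin t) = ω (π / k) := by
      rw [intervalIntegral.integral_const_mul, integral_sin]
      simp
    conv_rhs => rw [← hI]
    refine intervalIntegral.integral_mono_on hle hfi
      (Continuous.intervalIntegrable (by fun_prop) _ _) ?_
    intro t ht
    refine mul_le_mul_of_nonneg_right (hm ?_ hpk ?_) (hsin t ht)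
    · have := ht.1
      simp only [Set.mem_Ici]
      positivity
    · gcongr
      linarith [ht.2]
end
end

section
/- Let q ∈ (0,1), β ∈ ℝ, n,p ∈ ℕ with p ≤ n, and t ∈ ℝ. Then Σ_{k=n−p+1}^{n} q^k cos(kt + θ_q(t) + βπ/2) = q^{n−p+1} · (Z_q(t)/Z_{q^p}(pt)) · cos( (n−p+1)t + 2θ_q(t) − θ_{q^p}(pt) + βπ/2 ), where Z_r(u) = 1/√(1 − 2r cos u + r²) and θ_r(u) = arctan( r sin u / (1 − r cos u) ) for r ∈ (0,1). -/
open Real MeasureTheory intervalIntegral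

noncomputable section

theorem aux_shift (r u x : ℝ) (hr : r ∈ Set.Ioo (0:ℝ) 1) :
    0 < Zf r u ∧ Zf r u * (Real.cos x - r * Real.cos (x + u)) = Real.cos (x - θf r u) := by
  obtain ⟨h0, h1⟩ := hr
  have ha : 0 < 1 - r * Real.cos u := by nlinarith [Real.cos_le_one u]
  have hs : 1 - 2 * r * Real.cos u + r ^ 2
      = (1 - r * Real.cos u) ^ 2 + (r * Real.sin u) ^ 2 := by
    nlinarith [Real.sin_sq_add_cos_sq u]
  have hpos : 0 < 1 - 2 * r * Real.cos u + r ^ 2 := by rw [hs]; positivity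
  have hS : 0 < Real.sqrt (1 - 2 * r * Real.cos u + r ^ 2) := Real.sqrt_pos.mpr hpos
  have hw : Real.sqrt (1 + (r * Real.sin u / (1 - r * Real.cos u)) ^ 2)
      = Real.sqrt (1 - 2 * r * Real.cos u + r ^ 2) / (1 - r * Real.cos u) := by
    rw [Real.sqrt_eq_iff_mul_self_eq (by positivity) (by positivity), div_mul_div_comm,
      Real.mul_self_sqrt hpos.le, hs]
    field_simp
  refine ⟨by unfold Zf; positivity, ?_⟩
  rw [Real.cos_sub, θf, Real.cos_arctan, Real.sin_arctan, hw, Zf, Real.cos_add]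
  generalize Real.sqrt (1 - 2 * r * Real.cos u + r ^ 2) = S at hS
  field_simp
  ring

theorem aux_sum_s7 (q t c : ℝ) (hq : q ∈ Set.Ioo (0:ℝ) 1) (m p : ℕ) :
    (∑ k ∈ Finset.Icc (m + 1) (m + p), q ^ k * Real.cos ((k : ℝ) * t + θf q t + c)) =
      Zf q t * (q ^ (m + 1) * Real.cos (((m + 1 : ℕ) : ℝ) * t + 2 * θf q t + c)
        - q ^ (m + p + 1) * Real.cos (((m + p + 1 : ℕ) : ℝ) * t + 2 * θf q t + c)) := by
  induction p with
  | zero => simp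
  | succ p ih =>
    rw [← add_assoc, Finset.sum_Icc_succ_top (by omega), ih]
    have h := (aux_shift q t (((m + p + 1 : ℕ) : ℝ) * t + 2 * θf q t + c) hq).2
    have e1 : ((m + p + 1 : ℕ) : ℝ) * t + 2 * θf q t + c - θf q t
        = ((m + p + 1 : ℕ) : ℝ) * t + θf q t + c := by ring
    have e2 : ((m + p + 1 : ℕ) : ℝ) * t + 2 * θf q t + c + t
        = ((m + p + 1 + 1 : ℕ) : ℝ) * t + 2 * θf q t + c := by push_cast; ring
    rw [e1, e2] at h
    rw [← h]
    ring

/-- Closed form of the trigonometric sum `Σ_{k=n-p+1}^n q^k cos(kt + θ_q(t) + βπ/2)`. -/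
theorem block_sum_closed_form (q : ℝ) (hq : q ∈ Set.Ioo (0:ℝ) 1) (β : ℝ)
    (n p : ℕ) (hp : 0 < p) (hpn : p ≤ n) (t : ℝ) :
    (∑ k ∈ Finset.Icc (n - p + 1) n,
        q ^ k * Real.cos ((k : ℝ) * t + θf q t + β * π / 2)) =
      q ^ (n - p + 1) * (Zf q t / Zf (q ^ p) ((p : ℝ) * t)) *
        Real.cos (((n - p + 1 : ℕ) : ℝ) * t + 2 * θf q t - θf (q ^ p) ((p : ℝ) * t) +
          β * π / 2) := by
  obtain ⟨m, rfl⟩ := Nat.exists_eq_add_of_le' hpn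
  rw [Nat.add_sub_cancel, aux_sum_s7 q t _ hq m p]
  have hqp : q ^ p ∈ Set.Ioo (0:ℝ) 1 :=
    ⟨pow_pos hq.1 p, pow_lt_one₀ hq.1.le hq.2 hp.ne'⟩
  obtain ⟨hZ, h⟩ := aux_shift (q ^ p) ((p : ℝ) * t)
    (((m + 1 : ℕ) : ℝ) * t + 2 * θf q t + β * π / 2) hqp
  have e1 : ((m + 1 : ℕ) : ℝ) * t + 2 * θf q t + β * π / 2 - θf (q ^ p) ((p : ℝ) * t)
      = ((m + 1 : ℕ) : ℝ) * t + 2 * θf q t - θf (q ^ p) ((p : ℝ) * t) + β * π / 2 := by ring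
  have e2 : ((m + 1 : ℕ) : ℝ) * t + 2 * θf q t + β * π / 2 + (p : ℝ) * t
      = ((m + p + 1 : ℕ) : ℝ) * t + 2 * θf q t + β * π / 2 := by push_cast; ring
  rw [e1, e2] at h
  rw [← h]
  generalize Zf (q ^ p) ((p : ℝ) * t) = Z at hZ
  field_simp
  ring
end
end

section
/- Let q ∈ (0,1), β ∈ ℝ, n,p ∈ ℕ with p ≤ n, and let f(x) = A₀ + (1/π) ∫₀^{2π} φ(x+t) P_{q,β}(t) dt with φ a continuous 2π-periodic function. Then for every x ∈ ℝ, f(x) − V_{n,p}(f;x) = (q^{n−p+1}/(πp)) ∫₀^{2π} ( φ(x+t) − φ(x) ) · ( Z_q²(t)/Z_{q^p}(pt) ) · cos( (n−p+1)t + 2θ_q(t) − θ_{q^p}(pt) + βπ/2 ) dt, where Z_r(u) = 1/√(1 − 2r cos u + r²) and θ_r(u) = arctan( r sin u/(1 − r cos u) ). -/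
open Real MeasureTheory intervalIntegral

noncomputable section

lemma polar_one_sub (r u : ℝ) (h0 : 0 ≤ r) (h1 : r < 1) :
    (1 : ℂ) - r * Complex.exp (u * Complex.I) =
      ((Zf r u)⁻¹ : ℝ) * Complex.exp (-(θf r u * Complex.I)) := by
  have hpos : 0 < 1 - r * Real.cos u := by
    have := Real.cos_le_one u
    nlinarith
  have hs : (Zf r u)⁻¹ = (1 - r * Real.cos u) *
      √(1 + (r * Real.sin u / (1 - r * Real.cos u)) ^ 2) := by
    unfold Zf
    rw [one_div, inv_inv]
    have hsplit : ∀ y : ℝ, (1 - r * Real.cos u) * √y = √((1 - r * Real.cos u) ^ 2 * y) := by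
      intro y
      rw [Real.sqrt_mul (by positivity), Real.sqrt_sq hpos.le]
    rw [hsplit]
    congr 1
    field_simp
    nlinarith [Real.sin_sq_add_cos_sq u]
  have hsq : 0 < √(1 + (r * Real.sin u / (1 - r * Real.cos u)) ^ 2) := by positivity
  have e1 : (Zf r u)⁻¹ * Real.cos (θf r u) = 1 - r * Real.cos u := by
    rw [hs]; unfold θf; rw [Real.cos_arctan]
    field_simp
  have e2 : (Zf r u)⁻¹ * Real.sin (θf r u) = r * Real.sin u := by
    rw [hs]; unfold θf; rw [Real.sin_arctan]
    field_simp
  rw [← neg_mul, ← Complex.ofReal_neg, Complex.exp_mul_I, Complex.exp_mul_I,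
    ← Complex.ofReal_cos, ← Complex.ofReal_sin, ← Complex.ofReal_cos, ← Complex.ofReal_sin]
  apply Complex.ext
  · simp [-Complex.ofReal_cos, -Complex.ofReal_sin]
    linarith
  · simp [-Complex.ofReal_cos, -Complex.ofReal_sin]
    linarith

lemma term_re (q γ t : ℝ) (k : ℕ) :
    q ^ k * Real.cos ((k : ℝ) * t + γ) =
      (Complex.exp (γ * Complex.I) * (q * Complex.exp (t * Complex.I)) ^ k).re := by
  rw [mul_pow, ← Complex.exp_nat_mul, mul_left_comm, ← Complex.exp_add,
    show (γ : ℂ) * Complex.I + k * (t * Complex.I) = ((k * t + γ : ℝ) : ℂ) * Complex.I by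
      push_cast; ring, ← Complex.ofReal_pow, Complex.re_ofReal_mul,
    Complex.exp_ofReal_mul_I_re]

lemma norm_z (q t : ℝ) (hq : q ∈ Set.Ioo (0:ℝ) 1) :
    ‖(q : ℂ) * Complex.exp (t * Complex.I)‖ < 1 := by
  rw [norm_mul, Complex.norm_exp_ofReal_mul_I, Complex.norm_real, Real.norm_eq_abs,
    abs_of_pos hq.1, mul_one]
  exact hq.2

lemma tail_re (q β t : ℝ) (hq : q ∈ Set.Ioo (0:ℝ) 1) (k : ℕ) :
    Pker q β t - ∑ j ∈ Finset.range k,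
        q ^ (j + 1) * Real.cos ((j + 1 : ℕ) * t + β * π / 2) =
      (Complex.exp ((β * π / 2 : ℝ) * Complex.I) *
        ((q * Complex.exp (t * Complex.I)) ^ (k + 1) /
          (1 - q * Complex.exp (t * Complex.I)))).re := by
  set γ := β * π / 2 with hγ
  set z : ℂ := q * Complex.exp (t * Complex.I) with hz
  have hz1 : ‖z‖ < 1 := norm_z q t hq
  have hne : 1 - z ≠ 0 := by
    intro h
    have : z = 1 := (sub_eq_zero.mp h).symm
    rw [this] at hz1; simp at hz1
  have hP : Pker q β t = (Complex.exp (γ * Complex.I) * (z / (1 - z))).re := by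
    unfold Pker
    have h1 := ((hasSum_geometric_of_norm_lt_one hz1).mul_left
      (Complex.exp (γ * Complex.I) * z))
    have h2 := Complex.hasSum_re h1
    rw [mul_assoc, ← div_eq_mul_inv] at h2
    rw [← h2.tsum_eq]
    congr 1
    funext j
    rw [term_re, ← hz, pow_succ']
    congr 1; ring
  induction k with
  | zero => simp [hP]
  | succ k ih =>
    rw [Finset.sum_range_succ, ← sub_sub, ih, term_re, ← hz, ← Complex.sub_re]
    congr 1
    field_simp
    ring

lemma kernel_sum (q β t : ℝ) (hq : q ∈ Set.Ioo (0:ℝ) 1) (m p : ℕ) (hp : 0 < p) :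
    ∑ k ∈ Finset.range p, (Pker q β t - ∑ j ∈ Finset.range (m + k),
        q ^ (j + 1) * Real.cos ((j + 1 : ℕ) * t + β * π / 2)) =
      q ^ (m + 1) * (((Zf q t) ^ 2 / Zf (q ^ p) ((p : ℝ) * t)) *
              Real.cos (((m + 1 : ℕ) : ℝ) * t + 2 * θf q t -
                θf (q ^ p) ((p : ℝ) * t) + β * π / 2)) := by
  simp_rw [tail_re q β t hq, ← Complex.re_sum]
  set γ := β * π / 2 with hγ
  have hA := polar_one_sub q t hq.1.le hq.2
  have hB := polar_one_sub (q ^ p) (p * t) (by have := hq.1; positivity)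
    (pow_lt_one₀ hq.1.le hq.2 hp.ne')
  set z : ℂ := q * Complex.exp (t * Complex.I) with hz
  have hz1 : ‖z‖ < 1 := norm_z q t hq
  have hne : 1 - z ≠ 0 := by
    intro h
    have : z = 1 := (sub_eq_zero.mp h).symm
    rw [this] at hz1; simp at hz1
  have hne' : z - 1 ≠ 0 := fun h => hne (by linear_combination -h)
  have hzp : ((q ^ p : ℝ) : ℂ) * Complex.exp ((p * t : ℝ) * Complex.I) = z ^ p := by
    rw [hz, mul_pow, ← Complex.exp_nat_mul]; push_cast; ring_nf
  rw [hzp] at hB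
  have hsum : ∑ k ∈ Finset.range p, Complex.exp (γ * Complex.I) * (z ^ (m + k + 1) / (1 - z)) =
      Complex.exp (γ * Complex.I) * z ^ (m + 1) * (1 - z ^ p) / (1 - z) ^ 2 := by
    have : ∀ k ∈ Finset.range p, Complex.exp (γ * Complex.I) * (z ^ (m + k + 1) / (1 - z)) =
      (Complex.exp (γ * Complex.I) * z ^ (m + 1) / (1 - z)) * z ^ k := by
      intro k _; field_simp; ring
    rw [Finset.sum_congr rfl this, ← Finset.mul_sum, geom_sum_eq (fun h => hne' (by rw [h]; ring))]
    rw [div_mul_div_comm, div_eq_div_iff (mul_ne_zero hne hne') (pow_ne_zero 2 hne)]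
    ring
  rw [hsum, hB, hA, hz, mul_pow, ← Complex.exp_nat_mul, mul_pow, ← Complex.exp_nat_mul]
  set A := (Zf q t)⁻¹
  have hAz : (Zf q t) ^ 2 = (A ^ 2)⁻¹ := by simp [A]
  rw [hAz, div_eq_mul_inv _ (Zf _ _)]
  set B := (Zf (q ^ p) ((p : ℝ) * t))⁻¹
  have : Complex.exp (γ * Complex.I) * (q ^ (m + 1) * Complex.exp ((m + 1 : ℕ) * (t * Complex.I))) *
      (B * Complex.exp (-(θf (q ^ p) (p * t) * Complex.I))) /
      ((A : ℂ) ^ 2 * Complex.exp ((2 : ℕ) * -(θf q t * Complex.I))) =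
      ((q ^ (m + 1) * ((A ^ 2)⁻¹ * B) : ℝ) : ℂ) * Complex.exp ((((m + 1 : ℕ) : ℝ) * t + 2 * θf q t -
                θf (q ^ p) ((p : ℝ) * t) + γ : ℝ) * Complex.I) := by
    have e : Complex.exp ((((m + 1 : ℕ) : ℝ) * t + 2 * θf q t -
                θf (q ^ p) ((p : ℝ) * t) + γ : ℝ) * Complex.I) =
        Complex.exp (γ * Complex.I) * Complex.exp ((m + 1 : ℕ) * (t * Complex.I)) *
        Complex.exp (-(θf (q ^ p) (p * t) * Complex.I)) *
        (Complex.exp ((2 : ℕ) * -(θf q t * Complex.I)))⁻¹ := by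
      rw [← Complex.exp_neg, ← Complex.exp_add, ← Complex.exp_add, ← Complex.exp_add]
      congr 1; push_cast; ring
    rw [e, div_eq_mul_inv, mul_inv]; push_cast; ring
  rw [this, Complex.re_ofReal_mul, Complex.exp_ofReal_mul_I_re]
  ring

lemma integral_cos_int (k : ℤ) (a : ℝ) :
    ∫ t in (0:ℝ)..(2 * π), Real.cos (k * t + a) = if k = 0 then 2 * π * Real.cos a else 0 := by
  split_ifs with h
  · subst h; simp
  · have hk : (k : ℝ) ≠ 0 := by exact_mod_cast h
    rw [intervalIntegral.integral_comp_mul_add (fun x => Real.cos x) hk a, integral_cos]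
    have : Real.sin ((k : ℝ) * (2 * π) + a) = Real.sin a := by
      rw [add_comm]; exact Real.sin_add_int_mul_two_pi a k
    simp [this]

lemma orth (i j : ℕ) (hij : 0 < i + j) (a b : ℝ) :
    ∫ t in (0:ℝ)..(2 * π), Real.cos (i * t + a) * Real.cos (j * t + b) =
      if i = j then π * Real.cos (a - b) else 0 := by
  have e : ∀ t : ℝ, Real.cos (i * t + a) * Real.cos (j * t + b) =
      (1 / 2) * (Real.cos (((i - j : ℤ) : ℝ) * t + (a - b)) +
        Real.cos (((i + j : ℤ) : ℝ) * t + (a + b))) := by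
    intro t
    have h1 : ((i - j : ℤ) : ℝ) * t + (a - b) = (i * t + a) - (j * t + b) := by push_cast; ring
    have h2 : ((i + j : ℤ) : ℝ) * t + (a + b) = (i * t + a) + (j * t + b) := by push_cast; ring
    rw [h1, h2, Real.cos_sub (i * t + a), Real.cos_add (i * t + a)]; ring
  simp_rw [e]
  rw [intervalIntegral.integral_const_mul, intervalIntegral.integral_add
    (Continuous.intervalIntegrable (by fun_prop) _ _)
    (Continuous.intervalIntegrable (by fun_prop) _ _), integral_cos_int, integral_cos_int]
  rw [if_neg (show ¬ ((i : ℤ) + j = 0) by omega)]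
  by_cases h : i = j
  · rw [if_pos (by omega), if_pos h]; ring
  · rw [if_neg (by omega), if_neg h]; ring

lemma interchange (g : ℝ → ℝ) (hg : Continuous g) (c : ℕ → ℝ → ℝ) (hc : ∀ k, Continuous (c k))
    (M : ℕ → ℝ) (hM : Summable M) (hcM : ∀ k t, |c k t| ≤ M k) :
    HasSum (fun k => ∫ t in (0:ℝ)..(2 * π), g t * c k t)
      (∫ t in (0:ℝ)..(2 * π), g t * ∑' k, c k t) := by
  apply intervalIntegral.hasSum_integral_of_dominated_convergence (fun k t => |g t| * M k)
  · intro k; exact ((hg.mul (hc k)).aestronglyMeasurable)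
  · intro k; refine Filter.Eventually.of_forall fun t _ => ?_
    rw [Real.norm_eq_abs, abs_mul]
    exact mul_le_mul_of_nonneg_left (hcM k t) (abs_nonneg _)
  · exact Filter.Eventually.of_forall fun t _ => hM.mul_left _
  · simp_rw [tsum_mul_left]
    exact (hg.abs.mul continuous_const).intervalIntegrable _ _
  · refine Filter.Eventually.of_forall fun t _ => ?_
    have hsm : Summable (fun k => c k t) := Summable.of_norm_bounded hM (fun k => hcM k t)
    exact hsm.hasSum.mul_left (g t)

lemma summable_q (q : ℝ) (hq : q ∈ Set.Ioo (0:ℝ) 1) : Summable (fun k : ℕ => q ^ (k + 1)) :=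
  (summable_nat_add_iff 1).mpr (summable_geometric_of_lt_one hq.1.le hq.2)

lemma term_bound (q a : ℝ) (hq : q ∈ Set.Ioo (0:ℝ) 1) (k : ℕ) :
    |q ^ k * Real.cos a| ≤ q ^ k := by
  have := hq.1
  rw [abs_mul, abs_of_pos (by positivity)]
  exact mul_le_of_le_one_right (by positivity) (Real.abs_cos_le_one a)

lemma Pker_continuous (q β : ℝ) (hq : q ∈ Set.Ioo (0:ℝ) 1) : Continuous (Pker q β) := by
  unfold Pker
  exact continuous_tsum (fun k => by fun_prop) (summable_q q hq)
    (fun k t => term_bound q _ hq (k + 1))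

/-- The harmonic terms of the Poisson integral. -/
def harm (q β : ℝ) (φ : ℝ → ℝ) (k : ℕ) (x : ℝ) : ℝ :=
  ∫ t in (0:ℝ)..(2 * π), φ (x + t) * (q ^ (k + 1) * Real.cos ((k + 1 : ℕ) * t + β * π / 2))

lemma harm_hasSum (q β : ℝ) (hq : q ∈ Set.Ioo (0:ℝ) 1) (φ : ℝ → ℝ) (hφ : Continuous φ) (x : ℝ) :
    HasSum (fun k => harm q β φ k x) (∫ t in (0:ℝ)..(2 * π), φ (x + t) * Pker q β t) :=
  interchange (fun t => φ (x + t)) (by fun_prop) _ (fun k => by fun_prop) _ (summable_q q hq)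
    (fun k t => term_bound q _ hq (k + 1))

lemma harm_eq (q β : ℝ) (φ : ℝ → ℝ) (hφ : Continuous φ)
    (hper : ∀ x, φ (x + 2 * π) = φ x) (k : ℕ) :
    ∃ c d : ℝ, ∀ x, harm q β φ k x =
      c * Real.cos ((k + 1 : ℕ) * x) + d * Real.cos ((k + 1 : ℕ) * x - π / 2) := by
  refine ⟨∫ s in (0:ℝ)..(2 * π), φ s * (q ^ (k + 1) * Real.cos ((k + 1 : ℕ) * s + β * π / 2)),
    ∫ s in (0:ℝ)..(2 * π), φ s * (q ^ (k + 1) * Real.sin ((k + 1 : ℕ) * s + β * π / 2)), ?_⟩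
  intro x
  set F : ℝ → ℝ := fun s => φ s *
    (q ^ (k + 1) * Real.cos ((k + 1 : ℕ) * (s - x) + β * π / 2)) with hF
  have hFper : Function.Periodic F (2 * π) := by
    intro s
    simp only [hF, hper]
    congr 2
    rw [show ((k + 1 : ℕ) : ℝ) * (s + 2 * π - x) + β * π / 2 =
      ((k + 1 : ℕ) * (s - x) + β * π / 2) + (k + 1 : ℕ) * (2 * π) by ring]
    exact Real.cos_add_nat_mul_two_pi _ _
  have h1 : harm q β φ k x = ∫ t in (0:ℝ)..(2 * π), F (x + t) := by
    unfold harm; simp [hF]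
  rw [h1, intervalIntegral.integral_comp_add_left F x, add_zero,
    hFper.intervalIntegral_add_eq x 0, zero_add, Real.cos_sub_pi_div_two,
    ← intervalIntegral.integral_mul_const, ← intervalIntegral.integral_mul_const,
    ← intervalIntegral.integral_add (Continuous.intervalIntegrable (by fun_prop) _ _)
      (Continuous.intervalIntegrable (by fun_prop) _ _)]
  congr 1
  funext s
  simp only [hF]
  rw [show ((k + 1 : ℕ) : ℝ) * (s - x) + β * π / 2 =
      ((k + 1 : ℕ) * s + β * π / 2) - (k + 1 : ℕ) * x by ring, Real.cos_sub]
  ring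

lemma harm_orth (q β : ℝ) (φ : ℝ → ℝ) (hφ : Continuous φ)
    (hper : ∀ x, φ (x + 2 * π) = φ x) (k j : ℕ) (x : ℝ) :
    ∫ t in (0:ℝ)..(2 * π), Real.cos (j * t + -(j * x)) * harm q β φ k t =
      if k + 1 = j then π * harm q β φ k x else 0 := by
  obtain ⟨c, d, h⟩ := harm_eq q β φ hφ hper k
  simp_rw [h]
  have e : ∀ t : ℝ, Real.cos (j * t + -(j * x)) * (c * Real.cos ((k + 1 : ℕ) * t) +
      d * Real.cos ((k + 1 : ℕ) * t - π / 2)) =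
      c * (Real.cos ((k + 1 : ℕ) * t + 0) * Real.cos (j * t + -(j * x))) +
      d * (Real.cos ((k + 1 : ℕ) * t + -(π / 2)) * Real.cos (j * t + -(j * x))) := by
    intro t; rw [add_zero, ← sub_eq_add_neg _ (π / 2)]; ring
  simp_rw [e]
  rw [intervalIntegral.integral_add (Continuous.intervalIntegrable (by fun_prop) _ _)
      (Continuous.intervalIntegrable (by fun_prop) _ _), intervalIntegral.integral_const_mul,
      intervalIntegral.integral_const_mul, orth _ _ (by omega), orth _ _ (by omega)]
  split_ifs with hkj
  · subst hkj
    rw [show (0 : ℝ) - -(((k + 1 : ℕ) : ℝ) * x) = (k + 1 : ℕ) * x by ring,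
      show -(π / 2) - -(((k + 1 : ℕ) : ℝ) * x) = (k + 1 : ℕ) * x - π / 2 by ring]
    ring
  · simp

lemma harm_cont (q β : ℝ) (φ : ℝ → ℝ) (hφ : Continuous φ)
    (hper : ∀ x, φ (x + 2 * π) = φ x) (k : ℕ) : Continuous (harm q β φ k) := by
  obtain ⟨c, d, h⟩ := harm_eq q β φ hφ hper k
  rw [show harm q β φ k = _ from funext h]
  fun_prop

lemma harm_bound (q β : ℝ) (hq : q ∈ Set.Ioo (0:ℝ) 1) (φ : ℝ → ℝ) (hφ : Continuous φ)
    (hper : ∀ x, φ (x + 2 * π) = φ x) :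
    ∃ C : ℝ, ∀ k x, |harm q β φ k x| ≤ C * q ^ (k + 1) := by
  have hp : Function.Periodic φ (2 * π) := hper
  obtain ⟨B, hB⟩ : ∃ B, ∀ x, |φ x| ≤ B := by
    obtain ⟨B, hB⟩ := isCompact_Icc.exists_bound_of_continuousOn
      (s := Set.Icc (0:ℝ) (2 * π)) hφ.continuousOn
    refine ⟨B, fun x => ?_⟩
    obtain ⟨y, hy, hxy⟩ := hp.exists_mem_Ico₀ (by positivity) x
    rw [hxy]; exact hB y ⟨hy.1, hy.2.le⟩
  refine ⟨B * (2 * π), fun k x => ?_⟩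
  have := intervalIntegral.norm_integral_le_of_norm_le_const (a := 0) (b := 2 * π)
    (C := B * q ^ (k + 1)) (f := fun t => φ (x + t) *
      (q ^ (k + 1) * Real.cos ((k + 1 : ℕ) * t + β * π / 2))) (by
      intro t _
      rw [Real.norm_eq_abs, abs_mul]
      exact mul_le_mul (hB _) (term_bound q _ hq (k + 1)) (abs_nonneg _)
        ((abs_nonneg _).trans (hB 0)))
  rw [sub_zero, abs_of_pos (by positivity)] at this
  unfold harm
  rw [← Real.norm_eq_abs]
  linarith

lemma poisson_coef (q β : ℝ) (hq : q ∈ Set.Ioo (0:ℝ) 1) (A₀ : ℝ) (φ : ℝ → ℝ)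
    (hφ : Continuous φ) (hper : ∀ x, φ (x + 2 * π) = φ x) (f : ℝ → ℝ)
    (hf : f = fun x => A₀ + (1 / π) * ∫ t in (0:ℝ)..(2 * π), φ (x + t) * Pker q β t) :
    Continuous f ∧ ∀ (j : ℕ) (x : ℝ),
      ∫ t in (0:ℝ)..(2 * π), f t * Real.cos (j * t + -(j * x)) =
        if j = 0 then 2 * π * A₀ else harm q β φ (j - 1) x := by
  obtain ⟨C, hC⟩ := harm_bound q β hq φ hφ hper
  have hcont := harm_cont q β φ hφ hper
  have hM := (summable_q q hq).mul_left C
  have hf' : f = fun x => A₀ + (1 / π) * ∑' k, harm q β φ k x := by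
    rw [hf]; funext x; rw [(harm_hasSum q β hq φ hφ x).tsum_eq]
  have hSc : Continuous (fun x => ∑' k, harm q β φ k x) :=
    continuous_tsum hcont hM (fun k t => hC k t)
  refine ⟨by rw [hf']; fun_prop, fun j x => ?_⟩
  have hs := interchange (fun t => Real.cos (j * t + -(j * x))) (by fun_prop) _ hcont _ hM hC
  simp_rw [harm_orth q β φ hφ hper] at hs
  have e : ∀ t, f t * Real.cos (j * t + -(j * x)) = A₀ * Real.cos (((j : ℤ) : ℝ) * t + -(j * x)) +
      (1 / π) * (Real.cos (j * t + -(j * x)) * ∑' k, harm q β φ k t) := by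
    intro t; rw [hf']; push_cast; ring
  simp_rw [e]
  rw [intervalIntegral.integral_add (Continuous.intervalIntegrable (by fun_prop) _ _)
      (Continuous.intervalIntegrable (by fun_prop) _ _), intervalIntegral.integral_const_mul,
      intervalIntegral.integral_const_mul, integral_cos_int, ← hs.tsum_eq]
  rcases j with _ | j
  · simp [mul_comm]
  · have : ∀ k, (if k + 1 = j + 1 then π * harm q β φ k x else 0) =
        if k = j then π * harm q β φ k x else 0 := by intro k; simp
    simp_rw [this, tsum_ite_eq]
    rw [if_neg (by omega), if_neg (by omega)]
    have := Real.pi_ne_zero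
    simp

lemma Ssum_eq_s8 (q β : ℝ) (hq : q ∈ Set.Ioo (0:ℝ) 1) (A₀ : ℝ) (φ : ℝ → ℝ)
    (hφ : Continuous φ) (hper : ∀ x, φ (x + 2 * π) = φ x) (f : ℝ → ℝ)
    (hf : f = fun x => A₀ + (1 / π) * ∫ t in (0:ℝ)..(2 * π), φ (x + t) * Pker q β t)
    (k : ℕ) (x : ℝ) :
    Ssum f k x = A₀ + (1 / π) * ∑ j ∈ Finset.range k, harm q β φ j x := by
  obtain ⟨hfc, hco⟩ := poisson_coef q β hq A₀ φ hφ hper f hf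
  have hπ := Real.pi_ne_zero
  have h0 : coefA f 0 / 2 = A₀ := by
    have := hco 0 x
    unfold coefA
    simp at this ⊢
    rw [this]; field_simp
  have h : ∀ j : ℕ, coefA f (j + 1) * Real.cos ((j + 1 : ℕ) * x) +
      coefB f (j + 1) * Real.sin ((j + 1 : ℕ) * x) = (1 / π) * harm q β φ j x := by
    intro j
    have := hco (j + 1) x
    rw [if_neg (by omega), Nat.add_sub_cancel] at this
    rw [← this]
    unfold coefA coefB
    rw [mul_assoc, mul_assoc, ← mul_add, ← intervalIntegral.integral_mul_const,
      ← intervalIntegral.integral_mul_const,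
      ← intervalIntegral.integral_add (Continuous.intervalIntegrable (by fun_prop) _ _)
      (Continuous.intervalIntegrable (by fun_prop) _ _)]
    congr 2
    funext t
    rw [← sub_eq_add_neg, Real.cos_sub]; ring
  unfold Ssum
  rw [h0, Finset.mul_sum, ← Finset.sum_congr rfl (fun j _ => h j), Finset.range_eq_Ico,
    Finset.sum_Ico_add' (fun j : ℕ => coefA f j * Real.cos (j * x) + coefB f j * Real.sin (j * x))
      0 k 1]
  rfl

lemma tail_int (q β : ℝ) (hq : q ∈ Set.Ioo (0:ℝ) 1) (φ : ℝ → ℝ)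
    (hφ : Continuous φ) (k : ℕ) (x : ℝ) :
    (∫ t in (0:ℝ)..(2 * π), φ (x + t) * Pker q β t) - ∑ j ∈ Finset.range k, harm q β φ j x =
      ∫ t in (0:ℝ)..(2 * π), (φ (x + t) - φ x) * (Pker q β t - ∑ j ∈ Finset.range k,
        q ^ (j + 1) * Real.cos ((j + 1 : ℕ) * t + β * π / 2)) := by
  have hPc := Pker_continuous q β hq
  have gen : ∀ ψ : ℝ → ℝ, Continuous ψ →
    (∫ t in (0:ℝ)..(2 * π), ψ (x + t) * Pker q β t) - ∑ j ∈ Finset.range k, harm q β ψ j x =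
      ∫ t in (0:ℝ)..(2 * π), ψ (x + t) * (Pker q β t - ∑ j ∈ Finset.range k,
        q ^ (j + 1) * Real.cos ((j + 1 : ℕ) * t + β * π / 2)) := by
    intro ψ hψ
    unfold harm
    rw [← intervalIntegral.integral_finsetSum (fun j _ =>
        Continuous.intervalIntegrable (by fun_prop) _ _),
      ← intervalIntegral.integral_sub (Continuous.intervalIntegrable (by fun_prop) _ _)
      (Continuous.intervalIntegrable (by fun_prop) _ _)]
    congr 1
    funext t
    rw [mul_sub, Finset.mul_sum]
  have hz : ∀ j, harm q β (fun _ => φ x) j x = 0 := by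
    intro j
    unfold harm
    have := integral_cos_int ((j + 1 : ℕ) : ℤ) (β * π / 2)
    rw [if_neg (by omega)] at this
    rw [intervalIntegral.integral_const_mul, intervalIntegral.integral_const_mul]
    rw [Int.cast_natCast] at this
    rw [this]; simp
  have hc := gen (fun _ => φ x) continuous_const
  have hs := harm_hasSum q β hq (fun _ => φ x) continuous_const x
  simp_rw [hz] at hs hc
  rw [hs.unique hasSum_zero] at hc
  rw [gen φ hφ]
  simp_rw [sub_mul]
  rw [intervalIntegral.integral_sub (Continuous.intervalIntegrable (by fun_prop) _ _)
      (Continuous.intervalIntegrable (by fun_prop) _ _), ← hc]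
  simp

/-- Integral representation of the deviation `f - V_{n,p}(f)` for a Poisson integral `f`. -/
theorem deviation_integral_representation (q β : ℝ) (hq : q ∈ Set.Ioo (0:ℝ) 1)
    (n p : ℕ) (hp : 0 < p) (hpn : p ≤ n) (A₀ : ℝ) (φ : ℝ → ℝ)
    (hφc : Continuous φ) (hφper : ∀ x, φ (x + 2 * π) = φ x) (f : ℝ → ℝ)
    (hf : f = fun x => A₀ + (1 / π) * ∫ t in (0:ℝ)..(2 * π), φ (x + t) * Pker q β t) :
    ∀ x : ℝ,
      f x - Vsum n p f x =
        q ^ (n - p + 1) / (π * (p : ℝ)) *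
          ∫ t in (0:ℝ)..(2 * π),
            (φ (x + t) - φ x) * ((Zf q t) ^ 2 / Zf (q ^ p) ((p : ℝ) * t)) *
              Real.cos (((n - p + 1 : ℕ) : ℝ) * t + 2 * θf q t -
                θf (q ^ p) ((p : ℝ) * t) + β * π / 2) := by
  intro x
  have hPc := Pker_continuous q β hq
  have hπ := Real.pi_ne_zero
  have hp0 : (p : ℝ) ≠ 0 := by exact_mod_cast hp.ne'
  obtain ⟨m, rfl⟩ : ∃ m, n = m + p := ⟨n - p, by omega⟩
  rw [Nat.add_sub_cancel]
  have hfx : f x = A₀ + (1 / π) * ∫ t in (0:ℝ)..(2 * π), φ (x + t) * Pker q β t := by rw [hf]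
  have hd : ∀ k, f x - Ssum f k x = (1 / π) *
      ∫ t in (0:ℝ)..(2 * π), (φ (x + t) - φ x) * (Pker q β t - ∑ j ∈ Finset.range k,
        q ^ (j + 1) * Real.cos ((j + 1 : ℕ) * t + β * π / 2)) := by
    intro k
    rw [Ssum_eq_s8 q β hq A₀ φ hφc hφper f hf, hfx, ← tail_int q β hq φ hφc]; ring
  have hV : f x - Vsum (m + p) p f x =
      (1 / (p : ℝ)) * ∑ k ∈ Finset.range p, (f x - Ssum f (m + k) x) := by
    unfold Vsum
    rw [Nat.add_sub_cancel, Finset.sum_sub_distrib, Finset.sum_Ico_eq_sum_range,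
      Nat.add_sub_cancel_left]
    simp
    field_simp
  rw [hV]
  simp_rw [hd]
  rw [← Finset.mul_sum, ← intervalIntegral.integral_finsetSum (fun j _ =>
        Continuous.intervalIntegrable (by fun_prop) _ _)]
  simp_rw [← Finset.mul_sum, kernel_sum q β _ hq m p hp]
  have hk : ∀ t : ℝ, (φ (x + t) - φ x) * (q ^ (m + 1) * (((Zf q t) ^ 2 / Zf (q ^ p) ((p : ℝ) * t)) *
              Real.cos (((m + 1 : ℕ) : ℝ) * t + 2 * θf q t -
                θf (q ^ p) ((p : ℝ) * t) + β * π / 2))) = q ^ (m + 1) * ((φ (x + t) - φ x) *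
              ((Zf q t) ^ 2 / Zf (q ^ p) ((p : ℝ) * t)) *
              Real.cos (((m + 1 : ℕ) : ℝ) * t + 2 * θf q t -
                θf (q ^ p) ((p : ℝ) * t) + β * π / 2)) := by
    intro t; ring
  simp_rw [hk]
  rw [intervalIntegral.integral_const_mul]
  rw [← mul_assoc, ← mul_assoc]
  congr 1
  field_simp
end
end
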